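/- (i) For every r > 0 and every x₀ ∈ ℝ^k × {0_{ℝ^{n−k}}}, the set B_r(x₀) ∩ Σ achieves equality in the weighted isoperimetric inequality, i.e. Per_w(B_r(x₀) ∩ Σ) / w(B_r(x₀) ∩ Σ)^((D−1)/D) = Per_w(B₁ ∩ Σ) / w(B₁ ∩ Σ)^((D−1)/D). (ii) Conversely, if an open set E ⊆ Σ with 0 < w(E) < ∞ and Per_w(E) < ∞ satisfies Per_w(E) / w(E)^((D−1)/D) = Per_w(B₁ ∩ Σ) / w(B₁ ∩ Σ)^((D−1)/D), then there exist r > 0 and x₀ ∈ ℝ^k × {0_{ℝ^{n−k}}} such that w(E Δ (B_r(x₀) ∩ Σ)) = 0. -/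

import Mathlib

open MeasureTheory Metric Set
open scoped RealInnerProductSpace ENNReal NNReal Topology

noncomputable section

abbrev Euc (n : ℕ) := EuclideanSpace ℝ (Fin n)

def IsOpenConvexCone {n : ℕ} (S : Set (Euc n)) : Prop :=
  IsOpen S ∧ Convex ℝ S ∧ ∀ x ∈ S, ∀ t : ℝ, 0 < t → t • x ∈ S

def IsAdmissibleWeight {n : ℕ} (S : Set (Euc n)) (α : ℝ) (w : Euc n → ℝ) : Prop :=
  ContinuousOn w (closure S) ∧ (∀ x ∈ closure S, 0 ≤ w x) ∧
  (∃ x ∈ closure S, w x ≠ 0) ∧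
  (∀ x ∈ closure S, ∀ t : ℝ, 0 < t → w (t • x) = t ^ α * w x) ∧
  ConcaveOn ℝ S (fun x => w x ^ (1 / α))

def wVol {n : ℕ} (w : Euc n → ℝ) (E : Set (Euc n)) : ℝ≥0∞ :=
  ∫⁻ x in E, ENNReal.ofReal (w x)

def wPer {n : ℕ} (S : Set (Euc n)) (w : Euc n → ℝ) (E : Set (Euc n)) : ℝ≥0∞ :=
  ∫⁻ x in frontier E ∩ S, ENNReal.ofReal (w x) ∂(μH[(n : ℝ) - 1])

/-- The subspace `ℝ^k × {0_{ℝ^{n-k}}}` of `ℝⁿ` (first `k` coordinates free). -/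
def linSpan (n k : ℕ) : Set (Euc n) := {x | ∀ i : Fin n, k ≤ (i : ℕ) → x i = 0}

set_option linter.all false
set_option linter.deprecated false

noncomputable section

open scoped Pointwise in
lemma bm1_compact {A B : Set ℝ} (hA : IsCompact A) (hB : IsCompact B) (nA : A.Nonempty)
    (nB : B.Nonempty) : volume A + volume B ≤ volume (A + B) := by
  obtain ⟨a, ha, hamax⟩ := hA.exists_isMaxOn nA continuousOn_id
  obtain ⟨b, hb, hbmin⟩ := hB.exists_isMinOn nB continuousOn_id
  have h1 : volume A = volume ((fun x => x + b) '' A) := by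
    simp
  have h2 : volume B = volume ((fun x => a + x) '' B) := by
    simp
  have hsub : ((fun x => x + b) '' A) ∪ ((fun x => a + x) '' B) ⊆ A + B := by
    rintro _ (⟨x, hx, rfl⟩ | ⟨x, hx, rfl⟩)
    · exact Set.add_mem_add hx hb
    · exact Set.add_mem_add ha hx
  have hdisj : AEDisjoint volume ((fun x => x + b) '' A) ((fun x => a + x) '' B) := by
    apply measure_mono_null (t := {a + b}) _ (by simp)
    rintro _ ⟨⟨x, hx, rfl⟩, ⟨y, hy, hxy⟩⟩
    have e1 : x ≤ a := hamax hx
    have e2 : b ≤ y := hbmin hy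
    simp only at hxy
    simp only [mem_singleton_iff]; linarith
  have hm : MeasurableSet ((fun x => a + x) '' B) :=
    (hB.image (by fun_prop)).measurableSet
  calc volume A + volume B = volume (((fun x => x + b) '' A) ∪ ((fun x => a + x) '' B)) := by
        rw [measure_union₀ hm.nullMeasurableSet hdisj, ← h1, ← h2]
    _ ≤ _ := measure_mono hsub


open scoped Pointwise in
lemma bm1 {A B C : Set ℝ} (hA : MeasurableSet A) (hB : MeasurableSet B) (nA : A.Nonempty)
    (nB : B.Nonempty) (hC : ∀ x ∈ A, ∀ y ∈ B, x + y ∈ C) : volume A + volume B ≤ volume C := by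
  obtain ⟨a, ha⟩ := nA
  obtain ⟨b, hb⟩ := nB
  rw [hA.measure_eq_iSup_isCompact, hB.measure_eq_iSup_isCompact]
  have key : ∀ K1 ⊆ A, IsCompact K1 → ∀ K2 ⊆ B, IsCompact K2 →
      volume K1 + volume K2 ≤ volume C := by
    intro K1 h1 c1 K2 h2 c2
    calc volume K1 + volume K2 ≤ volume (insert a K1) + volume (insert b K2) :=
          add_le_add (measure_mono (subset_insert _ _)) (measure_mono (subset_insert _ _))
      _ ≤ volume (insert a K1 + insert b K2) :=
          bm1_compact (c1.insert a) (c2.insert b) (insert_nonempty _ _) (insert_nonempty _ _)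
      _ ≤ volume C := by
          apply measure_mono
          rintro _ ⟨x, hx, y, hy, rfl⟩
          exact hC x (insert_subset ha h1 hx) y (insert_subset hb h2 hy)
  have e1 : volume (∅ : Set ℝ) = 0 := measure_empty
  have hadd : (⨆ K, ⨆ (_ : K ⊆ A), ⨆ (_ : IsCompact K), volume K) +
      (⨆ K, ⨆ (_ : K ⊆ B), ⨆ (_ : IsCompact K), volume K) ≤ volume C := by
    have r1 : ∀ X : Set ℝ, (⨆ K, ⨆ (_ : K ⊆ X), ⨆ (_ : IsCompact K), volume K) =
      ⨆ K : {K : Set ℝ // K ⊆ X ∧ IsCompact K}, volume K.1 := by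
      intro X
      rw [iSup_subtype]
      simp only [iSup_and]
    haveI : ∀ X : Set ℝ, Nonempty {K : Set ℝ // K ⊆ X ∧ IsCompact K} :=
      fun X => ⟨⟨∅, empty_subset _, isCompact_empty⟩⟩
    rw [r1, r1]
    apply ENNReal.iSup_add_iSup_le
    rintro ⟨K1, h1, c1⟩ ⟨K2, h2, c2⟩
    exact key K1 h1 c1 K2 h2 c2
  exact hadd

/-- ENNReal layer cake for functions bounded by one -/
lemma layer1 {X : Type*} [MeasurableSpace X] (μ : Measure X) {f : X → ℝ≥0∞} (hf : Measurable f)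
    (hf1 : ∀ x, f x ≤ 1) :
    ∫⁻ x, f x ∂μ = ∫⁻ t in Ioo (0:ℝ) 1, μ {x | ENNReal.ofReal t < f x} := by
  have e : ∀ x, f x = ENNReal.ofReal (f x).toReal := fun x =>
    (ENNReal.ofReal_toReal (ne_top_of_le_ne_top ENNReal.one_ne_top (hf1 x))).symm
  have h0 : ∫⁻ x, f x ∂μ = ∫⁻ t in Ioi (0:ℝ), μ {x | ENNReal.ofReal t < f x} := by
    rw [lintegral_congr e, lintegral_eq_lintegral_meas_lt μ (Filter.Eventually.of_forall
      fun x => ENNReal.toReal_nonneg) hf.ennreal_toReal.aemeasurable]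
    apply setLIntegral_congr_fun measurableSet_Ioi
    intro t ht
    simp only
    congr 1
    ext x
    simp only [mem_setOf_eq]
    rw [ENNReal.ofReal_lt_iff_lt_toReal (le_of_lt ht) (ne_top_of_le_ne_top ENNReal.one_ne_top (hf1 x))]
  rw [h0, ← Ioo_union_Ici_eq_Ioi (zero_lt_one' ℝ), lintegral_union measurableSet_Ici]
  · have : ∫⁻ t in Ici (1:ℝ), μ {x | ENNReal.ofReal t < f x} = 0 := by
      rw [setLIntegral_congr_fun (g := fun _ => 0) measurableSet_Ici]
      · simp
      · intro t ht
        simp only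
        convert measure_empty (μ := μ)
        ext x
        simp only [mem_setOf_eq, mem_empty_iff_false, iff_false, not_lt]
        refine (hf1 x).trans ?_
        rw [← ENNReal.ofReal_one]
        exact ENNReal.ofReal_le_ofReal ht
    rw [this, add_zero]
  · exact Set.disjoint_left.2 fun x hx hx' => not_lt.2 hx' hx.2

lemma nbm1 {f g h : ℝ → ℝ≥0∞} (hf : Measurable f) (hg : Measurable g) (hh : Measurable h)
    (f1 : ⨆ x, f x = 1) (g1 : ⨆ x, g x = 1)
    (H : ∀ x y, f x ≠ 0 → g y ≠ 0 → min (f x) (g y) ≤ h (x + y)) :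
    (∫⁻ x, f x) + (∫⁻ x, g x) ≤ ∫⁻ x, h x := by
  have hh1 : Measurable (fun x => min (h x) 1) := hh.min measurable_const
  calc (∫⁻ x, f x) + (∫⁻ x, g x) ≤ ∫⁻ x, min (h x) 1 := by
        rw [layer1 _ hf (fun x => f1 ▸ le_iSup f x), layer1 _ hg (fun x => g1 ▸ le_iSup g x),
          layer1 _ hh1 (fun x => min_le_right _ _), ← lintegral_add_left']
        · apply setLIntegral_mono' measurableSet_Ioo
          intro t ht
          have ht1 : ENNReal.ofReal t < 1 := by
            rw [← ENNReal.ofReal_one]; exact (ENNReal.ofReal_lt_ofReal_iff one_pos).2 ht.2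
          have n1 : ∃ x, ENNReal.ofReal t < f x := by rw [← lt_iSup_iff, f1]; exact ht1
          have n2 : ∃ x, ENNReal.ofReal t < g x := by rw [← lt_iSup_iff, g1]; exact ht1
          apply bm1 (measurableSet_lt measurable_const hf) (measurableSet_lt measurable_const hg)
            n1 n2
          intro x hx y hy
          simp only [mem_setOf_eq] at hx hy ⊢
          refine lt_min ?_ ht1
          exact (lt_min hx hy).trans_le (H x y (ne_bot_of_gt hx) (ne_bot_of_gt hy))
        · apply Antitone.measurable _ |>.aemeasurable
          intro a b hab
          apply measure_mono
          intro x hx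
          exact (ENNReal.ofReal_le_ofReal hab).trans_lt hx
    _ ≤ _ := lintegral_mono fun x => min_le_left _ _

lemma holder2 {α : ℝ} (hα : 0 < α) {a b M N : ℝ≥0∞} (hM : M ≠ 0) (hN : N ≠ 0) (hM' : M ≠ ⊤)
    (hN' : N ≠ ⊤) :
    (a ^ (1/(α+1)) + b ^ (1/(α+1))) ^ (α+1) ≤ (M ^ (1/α) + N ^ (1/α)) ^ α * (a / M + b / N) := by
  have hpq : (α+1).HolderConjugate ((α+1)/α) := by
    rw [Real.holderConjugate_iff]
    constructor
    · linarith
    · field_simp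
      ring
  have h := ENNReal.inner_le_Lp_mul_Lq (Finset.univ : Finset (Fin 2))
    ![(a/M) ^ (1/(α+1)), (b/N) ^ (1/(α+1))] ![M ^ (1/(α+1)), N ^ (1/(α+1))] hpq
  simp only [Fin.sum_univ_two, Matrix.cons_val_zero, Matrix.cons_val_one] at h
  have h1 : (0:ℝ) ≤ 1/(α+1) := by positivity
  rw [← ENNReal.mul_rpow_of_nonneg _ _ h1, ← ENNReal.mul_rpow_of_nonneg _ _ h1,
    ENNReal.div_mul_cancel hM hM', ENNReal.div_mul_cancel hN hN'] at h
  simp only [← ENNReal.rpow_mul] at h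
  have e1 : 1/(α+1)*(α+1) = 1 := by field_simp
  have e2 : 1/(α+1)*((α+1)/α) = 1/α := by field_simp
  have e3 : 1/((α+1)/α) = α/(α+1) := by field_simp
  rw [e1, e2, e3] at h
  simp only [ENNReal.rpow_one] at h
  have h2 := ENNReal.rpow_le_rpow h (by positivity : 0 ≤ α+1)
  rw [ENNReal.mul_rpow_of_nonneg _ _ (by positivity : 0 ≤ α+1), ← ENNReal.rpow_mul,
    ← ENNReal.rpow_mul, e1] at h2
  have e4 : α/(α+1)*(α+1) = α := by field_simp
  rw [e4, ENNReal.rpow_one, mul_comm] at h2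
  exact h2

lemma bbl1_bdd {α : ℝ} (hα : 0 < α) {f g h : ℝ → ℝ≥0∞} (hf : Measurable f) (hg : Measurable g)
    (hh : Measurable h) (fb : ⨆ x, f x ≠ ⊤) (gb : ⨆ x, g x ≠ ⊤)
    (f0 : ∫⁻ x, f x ≠ 0) (g0 : ∫⁻ x, g x ≠ 0)
    (H : ∀ x y, f x ≠ 0 → g y ≠ 0 → (f x ^ (1/α) + g y ^ (1/α)) ^ α ≤ h (x + y)) :
    ((∫⁻ x, f x) ^ (1/(α+1)) + (∫⁻ x, g x) ^ (1/(α+1))) ^ (α+1) ≤ ∫⁻ x, h x := by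
  have aux : ∀ f : ℝ → ℝ≥0∞, ∫⁻ x, f x ≠ 0 → ⨆ x, f x ≠ 0 := by
    intro f hf h0
    apply hf
    rw [ENNReal.iSup_eq_zero] at h0
    simp [h0]
  set M := ⨆ x, f x with hMdef
  set N := ⨆ x, g x with hNdef
  have M0 : M ≠ 0 := aux f f0
  have N0 : N ≠ 0 := aux g g0
  set C := (M ^ (1/α) + N ^ (1/α)) ^ α with hC
  have hαi : 0 < 1/α := by positivity
  have C0 : C ≠ 0 := by
    rw [hC]
    have : M ^ (1/α) + N ^ (1/α) ≠ 0 := by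
      simp [M0, hαi, hα.le, not_lt.2 hα.le]
    intro h
    rcases (ENNReal.rpow_eq_zero_iff.1 h) with h | h
    · exact this h.1
    · linarith [h.2]
  have Ct : C ≠ ⊤ := by
    apply ENNReal.rpow_ne_top_of_nonneg hα.le
    exact ENNReal.add_ne_top.2 ⟨ENNReal.rpow_ne_top_of_nonneg hαi.le fb,
      ENNReal.rpow_ne_top_of_nonneg hαi.le gb⟩
  refine (holder2 hα M0 N0 fb gb).trans ?_
  rw [← hC]
  have hn := nbm1 (f := fun x => f x / M) (g := fun x => g x / N) (h := fun x => h x / C)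
    (by fun_prop) (by fun_prop) (by fun_prop)
    (by rw [← ENNReal.iSup_div, ← hMdef, ENNReal.div_self M0 fb])
    (by rw [← ENNReal.iSup_div, ← hNdef, ENNReal.div_self N0 gb]) ?_
  · simp only [div_eq_mul_inv] at hn ⊢
    rw [lintegral_mul_const _ hf, lintegral_mul_const _ hg, lintegral_mul_const _ hh] at hn
    calc _ ≤ C * ((∫⁻ x, h x) * C⁻¹) := by gcongr
      _ = _ := by rw [mul_comm (∫⁻ x, h x), ← mul_assoc, ENNReal.mul_inv_cancel C0 Ct, one_mul]
  · intro x y hx hy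
    have hx' : f x ≠ 0 := by rintro h; simp [h] at hx
    have hy' : g y ≠ 0 := by rintro h; simp [h] at hy
    set r := min (f x / M) (g y / N) with hr
    have r1 : r * M ≤ f x := by
      rw [← ENNReal.le_div_iff_mul_le (Or.inl M0) (Or.inl fb)]; exact min_le_left _ _
    have r2 : r * N ≤ g y := by
      rw [← ENNReal.le_div_iff_mul_le (Or.inl N0) (Or.inl gb)]; exact min_le_right _ _
    rw [ENNReal.le_div_iff_mul_le (Or.inl C0) (Or.inl Ct)]
    refine le_trans ?_ (H x y hx' hy')
    calc r * C = ((r*M) ^ (1/α) + (r*N) ^ (1/α)) ^ α := by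
          rw [ENNReal.mul_rpow_of_nonneg _ _ hαi.le, ENNReal.mul_rpow_of_nonneg _ _ hαi.le,
            ← mul_add, ENNReal.mul_rpow_of_nonneg _ _ hα.le, ← ENNReal.rpow_mul]
          rw [one_div_mul_cancel hα.ne', ENNReal.rpow_one]
      _ ≤ _ := by gcongr

lemma bbl1 {α : ℝ} (hα : 0 < α) {f g h : ℝ → ℝ≥0∞} (hf : Measurable f) (hg : Measurable g)
    (hh : Measurable h) (f0 : ∫⁻ x, f x ≠ 0) (g0 : ∫⁻ x, g x ≠ 0)
    (H : ∀ x y, f x ≠ 0 → g y ≠ 0 → (f x ^ (1/α) + g y ^ (1/α)) ^ α ≤ h (x + y)) :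
    ((∫⁻ x, f x) ^ (1/(α+1)) + (∫⁻ x, g x) ^ (1/(α+1))) ^ (α+1) ≤ ∫⁻ x, h x := by
  have tr : ∀ f : ℝ → ℝ≥0∞, Measurable f → 
      Filter.Tendsto (fun k : ℕ => ∫⁻ x, min (f x) k) Filter.atTop (𝓝 (∫⁻ x, f x)) := by
    intro f hf
    apply lintegral_tendsto_of_tendsto_of_monotone
    · intro k; fun_prop
    · filter_upwards with x
      intro i j hij
      exact min_le_min le_rfl (by exact_mod_cast hij)
    · filter_upwards with x
      have := (tendsto_const_nhds (x := f x)).min ENNReal.tendsto_nat_nhds_top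
      simpa using this
  have hlim : Filter.Tendsto (fun k : ℕ => ((∫⁻ x, min (f x) k) ^ (1/(α+1)) +
      (∫⁻ x, min (g x) k) ^ (1/(α+1))) ^ (α+1)) Filter.atTop
      (𝓝 (((∫⁻ x, f x) ^ (1/(α+1)) + (∫⁻ x, g x) ^ (1/(α+1))) ^ (α+1))) :=
    (((tr f hf).ennrpow_const _).add ((tr g hg).ennrpow_const _)).ennrpow_const _
  apply le_of_tendsto hlim
  have e1 := (tr f hf).eventually_ne f0
  have e2 := (tr g hg).eventually_ne g0
  filter_upwards [e1, e2, Filter.eventually_gt_atTop 0] with k h1 h2 hk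
  apply bbl1_bdd hα (by fun_prop) (by fun_prop) hh _ _ h1 h2
  · intro x y hx hy
    refine le_trans ?_ (H x y ?_ ?_)
    · gcongr <;> exact min_le_left _ _
    · rintro h; simp [h] at hx
    · rintro h; simp [h] at hy
  · exact ne_top_of_le_ne_top (ENNReal.natCast_ne_top k) (iSup_le fun x => min_le_right _ _)
  · exact ne_top_of_le_ne_top (ENNReal.natCast_ne_top k) (iSup_le fun x => min_le_right _ _)

lemma bblN (n : ℕ) : ∀ {α : ℝ} (_ : 0 < α) {f g h : (Fin n → ℝ) → ℝ≥0∞} (_ : Measurable f)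
    (_ : Measurable g) (_ : Measurable h) (_ : ∫⁻ x, f x ≠ 0) (_ : ∫⁻ x, g x ≠ 0)
    (_ : ∀ x y, f x ≠ 0 → g y ≠ 0 → (f x ^ (1/α) + g y ^ (1/α)) ^ α ≤ h (x + y)),
    ((∫⁻ x, f x) ^ (1/(α+n)) + (∫⁻ x, g x) ^ (1/(α+n))) ^ (α+n) ≤ ∫⁻ x, h x := by
  induction n with
  | zero =>
    intro α hα f g h hf hg hh f0 g0 H
    rw [lintegral_unique] at f0 g0
    simp only [lintegral_unique] 
    have e : (volume : Measure (Fin 0 → ℝ)) univ = 1 := by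
      simp [volume_pi, Measure.pi_of_empty]
    rw [e] at f0 g0 ⊢
    simp only [mul_one, Nat.cast_zero, add_zero] at *
    have := H _ _ f0 g0
    convert this using 2
  | succ n ih =>
    intro α hα f g h hf hg hh f0 g0 H
    have ps : ∀ p : ℝ × (Fin n → ℝ), (MeasurableEquiv.piFinSuccAbove (fun _ : Fin (n+1) => ℝ) 0).symm p
        = Fin.cons p.1 p.2 := by
      intro p
      ext i
      refine Fin.cases ?_ (fun j => ?_) i <;> simp [MeasurableEquiv.piFinSuccAbove]
    have fub : ∀ f : (Fin (n+1) → ℝ) → ℝ≥0∞, Measurable f →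
        ∫⁻ x, f x = ∫⁻ t : ℝ, ∫⁻ y : Fin n → ℝ, f (Fin.cons t y) := by
      intro f hf
      have mp := (volume_preserving_piFinSuccAbove (fun _ : Fin (n+1) => ℝ) 0).symm
      rw [← mp.lintegral_comp hf]
      rw [Measure.volume_eq_prod, lintegral_prod]
      · simp only [ps]
      · exact (hf.comp (MeasurableEquiv.measurable _)).aemeasurable
    have mc : ∀ f : (Fin (n+1) → ℝ) → ℝ≥0∞, Measurable f →
        Measurable (fun p : ℝ × (Fin n → ℝ) => f (Fin.cons p.1 p.2)) := by
      intro f hf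
      have := hf.comp (MeasurableEquiv.piFinSuccAbove (fun _ : Fin (n+1) => ℝ) 0).symm.measurable
      convert this using 2 with p
      simp only [Function.comp, ps]
    have ms : ∀ f : (Fin (n+1) → ℝ) → ℝ≥0∞, Measurable f → ∀ t : ℝ,
        Measurable (fun y : (Fin n → ℝ) => f (Fin.cons t y)) := by
      intro f hf t
      exact (mc f hf).comp (measurable_const.prodMk measurable_id)
    rw [fub f hf] at f0 ⊢
    rw [fub g hg] at g0 ⊢
    rw [fub h hh]
    have e : α + ((n+1 : ℕ) : ℝ) = (α + n) + 1 := by push_cast; ring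
    rw [e]
    apply bbl1 (by positivity) (mc f hf).lintegral_prod_right' (mc g hg).lintegral_prod_right'
      (mc h hh).lintegral_prod_right' f0 g0
    intro s t hs ht
    apply ih hα (ms f hf s) (ms g hg t) (ms h hh (s+t)) hs ht
    intro x y hx hy
    have := H _ _ hx hy
    convert this using 2
    ext i
    refine Fin.cases ?_ (fun j => ?_) i <;> simp

end

noncomputable section

structure Ctx {n : ℕ} (S : Set (Euc n)) (α : ℝ) (w : Euc n → ℝ) : Prop where
  hn : 1 ≤ n
  hα : 0 < α
  hS : IsOpenConvexCone S
  hw : IsAdmissibleWeight S α w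
  z : (0 : Euc n) ∉ S

namespace Ctx
variable {n : ℕ} {S : Set (Euc n)} {α : ℝ} {w : Euc n → ℝ}

lemma op (h : Ctx S α w) : IsOpen S := h.hS.1
lemma cvx (h : Ctx S α w) : Convex ℝ S := h.hS.2.1
lemma cone (h : Ctx S α w) {x : Euc n} (hx : x ∈ S) {t : ℝ} (ht : 0 < t) : t • x ∈ S :=
  h.hS.2.2 x hx t ht
lemma ne (h : Ctx S α w) : S.Nonempty := by
  obtain ⟨x, hx, _⟩ := h.hw.2.2.1
  exact closure_nonempty_iff.1 ⟨x, hx⟩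
lemma add (h : Ctx S α w) {x y : Euc n} (hx : x ∈ S) (hy : y ∈ S) : x + y ∈ S := by
  have h1 : (1/2:ℝ) • x + (1/2:ℝ) • y ∈ S := h.cvx hx hy (by norm_num) (by norm_num) (by norm_num)
  have h2 := h.cone h1 (t := 2) (by norm_num)
  simpa [smul_smul] using h2
lemma conecl (h : Ctx S α w) {x : Euc n} (hx : x ∈ closure S) {t : ℝ} (ht : 0 < t) :
    t • x ∈ closure S := by
  have : MapsTo (fun x : Euc n => t • x) (closure S) (closure S) :=
    MapsTo.closure (fun y hy => h.cone hy ht) (continuous_const_smul t)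
  exact this hx
lemma addcl (h : Ctx S α w) {x y : Euc n} (hx : x ∈ S) (hy : y ∈ closure S) : x + y ∈ S := by
  have h1 : (1/2:ℝ) • x + (1/2:ℝ) • y ∈ interior S :=
    h.cvx.combo_interior_closure_mem_interior (by rwa [h.op.interior_eq]) hy (by norm_num)
      (by norm_num) (by norm_num)
  rw [h.op.interior_eq] at h1
  have h2 := h.cone h1 (t := 2) (by norm_num)
  simpa [smul_smul] using h2
lemma zcl (h : Ctx S α w) : (0 : Euc n) ∈ closure S := by
  obtain ⟨x, hx⟩ := h.ne
  have : Filter.Tendsto (fun t : ℝ => t • x) (𝓝[>] 0) (𝓝 0) := by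
    have : Filter.Tendsto (fun t : ℝ => t • x) (𝓝 0) (𝓝 ((0:ℝ) • x)) := by
      apply Continuous.tendsto; fun_prop
    rw [zero_smul] at this
    exact this.mono_left nhdsWithin_le_nhds
  apply mem_closure_of_tendsto this
  filter_upwards [self_mem_nhdsWithin] with t ht
  exact h.cone hx ht
lemma wcont (h : Ctx S α w) : ContinuousOn w S := h.hw.1.mono subset_closure
lemma wcontAt (h : Ctx S α w) {x : Euc n} (hx : x ∈ S) : ContinuousAt w x :=
  h.wcont.continuousAt (h.op.mem_nhds hx)
lemma wnn (h : Ctx S α w) {x : Euc n} (hx : x ∈ S) : 0 ≤ w x := h.hw.2.1 x (subset_closure hx)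
lemma hom (h : Ctx S α w) {x : Euc n} (hx : x ∈ S) {t : ℝ} (ht : 0 < t) :
    w (t • x) = t ^ α * w x := h.hw.2.2.2.1 x (subset_closure hx) t ht
lemma uhom (h : Ctx S α w) {x : Euc n} (hx : x ∈ S) {t : ℝ} (ht : 0 < t) :
    w (t • x) ^ (1/α) = t * w x ^ (1/α) := by
  rw [h.hom hx ht, Real.mul_rpow (by positivity) (h.wnn hx), ← Real.rpow_mul ht.le,
    mul_one_div_cancel h.hα.ne', Real.rpow_one]
lemma usuper (h : Ctx S α w) {x y : Euc n} (hx : x ∈ S) (hy : y ∈ S) :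
    w x ^ (1/α) + w y ^ (1/α) ≤ w (x + y) ^ (1/α) := by
  have hcc : ConcaveOn ℝ S (fun x => w x ^ (1 / α)) := h.hw.2.2.2.2
  have h1 := hcc.2 hx hy (by norm_num : (0:ℝ) ≤ 1/2) (by norm_num : (0:ℝ) ≤ 1/2) (by norm_num)
  have h2 : (1/2:ℝ) • x + (1/2:ℝ) • y = (1/2:ℝ) • (x+y) := by rw [smul_add]
  simp only [h2] at h1
  rw [h.uhom (h.add hx hy) (by norm_num)] at h1
  simp only [smul_eq_mul] at h1
  linarith
lemma wpos (h : Ctx S α w) {x : Euc n} (hx : x ∈ S) : 0 < w x := by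
  have hex : ∃ x1 ∈ S, 0 < w x1 := by
    by_contra hc
    push Not at hc
    obtain ⟨x0, hx0, hne⟩ := h.hw.2.2.1
    apply hne
    obtain ⟨u, hu, hlim⟩ := mem_closure_iff_seq_limit.1 hx0
    have h1 : Filter.Tendsto (fun k => w (u k)) Filter.atTop (𝓝 (w x0)) := by
      have := (h.hw.1 x0 hx0).tendsto
      refine this.comp (tendsto_nhdsWithin_iff.2 ⟨hlim, Filter.Eventually.of_forall fun k => subset_closure (hu k)⟩)
    have h2 : (fun k => w (u k)) = fun _ => 0 := by
      ext k; exact le_antisymm (hc _ (hu k)) (h.wnn (hu k))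
    rw [h2] at h1
    exact tendsto_nhds_unique h1 tendsto_const_nhds
  obtain ⟨x1, hx1, hp⟩ := hex
  have : Filter.Tendsto (fun t : ℝ => x - t • x1) (𝓝[>] 0) (𝓝 x) := by
    have : Filter.Tendsto (fun t : ℝ => x - t • x1) (𝓝 0) (𝓝 (x - (0:ℝ) • x1)) := by
      apply Continuous.tendsto; fun_prop
    rw [zero_smul, sub_zero] at this
    exact this.mono_left nhdsWithin_le_nhds
  obtain ⟨t, ht, ht0⟩ := ((this.eventually (h.op.mem_nhds hx)).and self_mem_nhdsWithin).exists
  have ht0 : 0 < t := ht0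
  have h3 := h.usuper ht (h.cone hx1 ht0)
  rw [sub_add_cancel, h.uhom hx1 ht0] at h3
  have h4 : 0 < w x ^ (1/α) := by
    have : 0 < w x1 ^ (1/α) := by positivity
    have : 0 ≤ w (x - t • x1) ^ (1/α) := Real.rpow_nonneg (h.wnn ht) _
    have : 0 < t * w x1 ^ (1/α) := by positivity
    linarith
  rcases (h.wnn hx).lt_or_eq with h5 | h5
  · exact h5
  · rw [← h5, Real.zero_rpow (by have := h.hα; positivity)] at h4
    exact absurd h4 (lt_irrefl _)
lemma wsuper (h : Ctx S α w) {x y : Euc n} (hx : x ∈ S) (hy : y ∈ S) :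
    (w x ^ (1/α) + w y ^ (1/α)) ^ α ≤ w (x + y) := by
  have h1 := h.usuper hx hy
  have p1 := h.wpos hx
  have p2 := h.wpos hy
  have p3 := h.wpos (h.add hx hy)
  have h2 := Real.rpow_le_rpow (by positivity) h1 h.hα.le
  rwa [← Real.rpow_mul p3.le, one_div_mul_cancel h.hα.ne', Real.rpow_one] at h2
lemma wmono (h : Ctx S α w) {x y : Euc n} (hx : x ∈ S) (hy : y ∈ S) : w x ≤ w (x + y) := by
  have h1 := h.usuper hx hy
  have p1 := h.wpos hx
  have p2 := h.wpos hy
  have p3 := h.wpos (h.add hx hy)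
  have : 0 < w y ^ (1/α) := by positivity
  have h2 := Real.rpow_le_rpow (by positivity) (by linarith : w x ^ (1/α) ≤ w (x+y) ^ (1/α)) h.hα.le
  rwa [← Real.rpow_mul p3.le, ← Real.rpow_mul p1.le, one_div_mul_cancel h.hα.ne', Real.rpow_one,
    Real.rpow_one] at h2
lemma wmonocl (h : Ctx S α w) {x y : Euc n} (hx : x ∈ S) (hy : y ∈ closure S) :
    w x ≤ w (x + y) := by
  obtain ⟨u, hu, hlim⟩ := mem_closure_iff_seq_limit.1 hy
  have h1 : Filter.Tendsto (fun k => w (x + u k)) Filter.atTop (𝓝 (w (x + y))) :=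
    (h.wcontAt (h.addcl hx hy)).tendsto.comp (hlim.const_add x)
  exact ge_of_tendsto' h1 fun k => h.wmono hx (hu k)
lemma wbdd (h : Ctx S α w) (R : ℝ) : ∃ C : ℝ, 0 < C ∧ ∀ x ∈ S, ‖x‖ ≤ R → w x ≤ C := by
  have hc : IsCompact (closure S ∩ closedBall 0 R) :=
    (isCompact_closedBall 0 R).inter_left isClosed_closure
  obtain ⟨C, hC⟩ := (hc.image_of_continuousOn (h.hw.1.mono inter_subset_left)).bddAbove
  refine ⟨max C 1, by positivity, fun x hx hxR => le_max_of_le_left (hC ⟨x, ⟨subset_closure hx, by simpa using hxR⟩, rfl⟩)⟩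
end Ctx

/-- weighted density -/
def wd {n : ℕ} (S : Set (Euc n)) (w : Euc n → ℝ) : Euc n → ℝ≥0∞ :=
  S.indicator (fun x => ENNReal.ofReal (w x))

/-- weighted measure -/
def wm {n : ℕ} (S : Set (Euc n)) (w : Euc n → ℝ) : Measure (Euc n) :=
  volume.withDensity (wd S w)

namespace Ctx
variable {n : ℕ} {S : Set (Euc n)} {α : ℝ} {w : Euc n → ℝ}

lemma wd_meas (h : Ctx S α w) : Measurable (wd S w) := by
  have h1 : Measurable (S.indicator w) := by
    classical
    have := h.wcont.measurable_piecewise (g := fun _ => (0:ℝ)) continuousOn_const h.op.measurableSet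
    convert this using 1
    ext x
    by_cases hx : x ∈ S <;> simp [hx]
  have h2 : wd S w = fun x => ENNReal.ofReal (S.indicator w x) := by
    ext x
    by_cases hx : x ∈ S <;> simp [wd, hx]
  rw [h2]
  exact h1.ennreal_ofReal

lemma wm_apply (h : Ctx S α w) {A : Set (Euc n)} (hA : MeasurableSet A) :
    wm S w A = ∫⁻ x in A, wd S w x := by
  rw [wm, withDensity_apply _ hA]

lemma wm_eq_wVol (h : Ctx S α w) {A : Set (Euc n)} (hA : MeasurableSet A) (hAS : A ⊆ S) :
    wm S w A = wVol w A := by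
  rw [h.wm_apply hA, wVol]
  apply setLIntegral_congr_fun hA
  intro x hx
  simp [wd, hAS hx]

lemma wm_compl (h : Ctx S α w) : wm S w Sᶜ = 0 := by
  rw [h.wm_apply h.op.measurableSet.compl]
  rw [setLIntegral_congr_fun (g := fun _ => 0) h.op.measurableSet.compl]
  · simp
  · intro x hx
    simp [wd, notMem_of_mem_compl hx]

lemma ae_S (h : Ctx S α w) : ∀ᵐ x ∂(wm S w), x ∈ S := h.wm_compl

lemma wm_pos (h : Ctx S α w) {A : Set (Euc n)} (hA : IsOpen A) (hAS : A ⊆ S) (hne : A.Nonempty) :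
    wm S w A ≠ 0 := by
  rw [h.wm_apply hA.measurableSet]
  intro h0
  rw [lintegral_eq_zero_iff h.wd_meas] at h0
  have : ∀ᵐ x ∂(volume.restrict A), False := by
    filter_upwards [h0, ae_restrict_mem hA.measurableSet] with x hx hxA
    have := h.wpos (hAS hxA)
    simp [wd, hAS hxA] at hx
    linarith
  have h2 : volume.restrict A = 0 := by
    rw [← ae_eq_bot, ← Filter.empty_mem_iff_bot]
    exact Filter.mem_of_superset this (fun x hx => hx)
  rw [Measure.restrict_eq_zero] at h2
  exact (hA.measure_pos volume hne).ne' h2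

lemma wm_lt_top (h : Ctx S α w) {A : Set (Euc n)} (hA : Bornology.IsBounded A) :
    wm S w A < ⊤ := by
  obtain ⟨R, hR⟩ := hA.subset_closedBall 0
  obtain ⟨C, hC, hb⟩ := h.wbdd R
  refine (measure_mono hR).trans_lt ?_
  rw [h.wm_apply measurableSet_closedBall]
  calc ∫⁻ x in closedBall 0 R, wd S w x ≤ ∫⁻ x in closedBall (0: Euc n) R, ENNReal.ofReal C := by
        apply setLIntegral_mono' measurableSet_closedBall
        intro x hx
        by_cases hxS : x ∈ S
        · simp only [wd, hxS, indicator_of_mem]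
          exact ENNReal.ofReal_le_ofReal (hb x hxS (by simpa using hx))
        · simp [wd, hxS]
    _ < ⊤ := by
        rw [setLIntegral_const]
        exact ENNReal.mul_lt_top ENNReal.ofReal_lt_top (isCompact_closedBall 0 R).measure_lt_top

lemma wd_super (h : Ctx S α w) {x y : Euc n} (hx : x ∈ S) (hy : y ∈ S) :
    (wd S w x ^ (1/α) + wd S w y ^ (1/α)) ^ α ≤ wd S w (x + y) := by
  have h1 := h.wsuper hx hy
  have p1 := h.wpos hx
  have p2 := h.wpos hy
  have hα := h.hα
  simp only [wd, hx, hy, h.add hx hy, indicator_of_mem]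
  rw [ENNReal.ofReal_rpow_of_pos p1, ENNReal.ofReal_rpow_of_pos p2, ← ENNReal.ofReal_add
    (by positivity) (by positivity), ENNReal.ofReal_rpow_of_pos (by positivity)]
  exact ENNReal.ofReal_le_ofReal h1

/-- weighted Brunn-Minkowski -/
lemma bm (h : Ctx S α w) {A K C : Set (Euc n)} (hA : MeasurableSet A) (hK : MeasurableSet K)
    (hC : MeasurableSet C) (hAS : A ⊆ S) (hKS : K ⊆ S) (A0 : wm S w A ≠ 0) (K0 : wm S w K ≠ 0)
    (H : ∀ x ∈ A, ∀ y ∈ K, x + y ∈ C) :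
    (wm S w A ^ (1/((n:ℝ)+α)) + wm S w K ^ (1/((n:ℝ)+α))) ^ ((n:ℝ)+α) ≤ wm S w C := by
  have key : ∀ A : Set (Euc n), MeasurableSet A → Measurable (fun x : Fin n → ℝ =>
      A.indicator (wd S w) (WithLp.toLp 2 x)) ∧
      wm S w A = ∫⁻ x : Fin n → ℝ, A.indicator (wd S w) (WithLp.toLp 2 x) := by
    intro A hA
    have hm := h.wd_meas.indicator hA
    refine ⟨hm.comp (by fun_prop), ?_⟩
    rw [h.wm_apply hA, ← lintegral_indicator hA]
    exact ((PiLp.volume_preserving_toLp (Fin n)).lintegral_comp hm).symm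
  rw [(key A hA).2] at A0 ⊢
  rw [(key K hK).2] at K0 ⊢
  rw [(key C hC).2, add_comm (n:ℝ) α]
  apply bblN n h.hα (key A hA).1 (key K hK).1 (key C hC).1 A0 K0
  intro x y hx hy
  have hx' := mem_of_indicator_ne_zero hx
  have hy' := mem_of_indicator_ne_zero hy
  simp only [indicator_of_mem hx', indicator_of_mem hy']
  have hxy := H _ hx' _ hy'
  rw [WithLp.toLp_add, indicator_of_mem hxy]
  exact h.wd_super (hAS hx') (hKS hy')
end Ctx

end

noncomputable section

lemma bernoulli_enn {D : ℝ} (hD : 1 ≤ D) {a c : ℝ≥0∞} (hc : c ≠ ⊤) (ha : a ≠ 0) :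
    a + ENNReal.ofReal D * c * a ^ ((D-1)/D) ≤ (a ^ (1/D) + c) ^ D := by
  have hD0 : 0 < D := by linarith
  by_cases hat : a = ⊤
  · rw [hat, ENNReal.top_rpow_of_pos (by positivity : 0 < 1/D), top_add, top_add, ENNReal.top_rpow_of_pos hD0]
  lift a to ℝ≥0 using hat
  lift c to ℝ≥0 using hc
  have ha' : 0 < a := by rw [pos_iff_ne_zero]; exact_mod_cast ha
  have hq : 0 ≤ (D-1)/D := div_nonneg (by linarith) hD0.le
  have e0 : ENNReal.ofReal D = ((D.toNNReal : ℝ≥0) : ℝ≥0∞) := rfl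
  rw [e0, ← ENNReal.coe_rpow_of_nonneg _ hq, ← ENNReal.coe_rpow_of_nonneg _ (by positivity : 0 ≤ 1/D),
    ← ENNReal.coe_mul, ← ENNReal.coe_mul, ← ENNReal.coe_add, ← ENNReal.coe_add,
    ← ENNReal.coe_rpow_of_nonneg _ hD0.le, ENNReal.coe_le_coe, ← NNReal.coe_le_coe]
  push_cast
  rw [Real.coe_toNNReal _ hD0.le]
  have ha2 : 0 < (a:ℝ) := by exact_mod_cast ha'
  generalize (a:ℝ) = x at *
  have hc2 : 0 ≤ (c:ℝ) := c.2
  generalize (c:ℝ) = y at *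
  set b := x ^ (1/D) with hb
  have hb0 : 0 < b := by positivity
  have e1 : b ^ D = x := by
    rw [hb, ← Real.rpow_mul ha2.le, one_div_mul_cancel hD0.ne', Real.rpow_one]
  have e2 : x ^ ((D-1)/D) = b ^ (D-1) := by
    rw [hb, ← Real.rpow_mul ha2.le]; congr 1; field_simp
  have h1 := one_add_mul_self_le_rpow_one_add (s := y/b) (by linarith [div_nonneg hc2 hb0.le]) hD
  have e3 : b + y = b * (1 + y/b) := by field_simp
  rw [e3, Real.mul_rpow hb0.le (by positivity), e2]
  have e4 : b ^ (D-1) = b ^ D / b := by rw [Real.rpow_sub hb0, Real.rpow_one]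
  rw [e4]
  calc x + D * y * (b ^ D / b) = b ^ D * (1 + D * (y/b)) := by rw [e1]; field_simp
    _ ≤ _ := by gcongr

namespace Ctx
variable {n : ℕ} {S : Set (Euc n)} {α : ℝ} {w : Euc n → ℝ}

lemma D1 (h : Ctx S α w) : 1 ≤ (n:ℝ) + α := by
  have := h.hn; have := h.hα
  have : (1:ℝ) ≤ n := by exact_mod_cast h.hn
  linarith

lemma smul_mem_iff (h : Ctx S α w) {x : Euc n} {t : ℝ} (ht : 0 < t) : t • x ∈ S ↔ x ∈ S := by
  constructor
  · intro hx
    have := h.cone hx (inv_pos.2 ht)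
    rwa [smul_smul, inv_mul_cancel₀ ht.ne', one_smul] at this
  · intro hx; exact h.cone hx ht

lemma wd_smul (h : Ctx S α w) (x : Euc n) {t : ℝ} (ht : 0 < t) :
    wd S w (t • x) = ENNReal.ofReal (t ^ α) * wd S w x := by
  by_cases hx : x ∈ S
  · simp only [wd, hx, h.cone hx ht, indicator_of_mem]
    rw [h.hom hx ht, ENNReal.ofReal_mul (by positivity)]
  · have := (h.smul_mem_iff ht).not.2 hx
    simp [wd, hx, this]

open scoped Pointwise in
lemma wm_smul (h : Ctx S α w) {A : Set (Euc n)} (hA : MeasurableSet A) {r : ℝ} (hr : 0 < r) :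
    wm S w (r • A) = ENNReal.ofReal (r ^ ((n:ℝ) + α)) * wm S w A := by
  have hrA : MeasurableSet (r • A) := hA.const_smul_of_ne_zero hr.ne'
  have e : ∀ f : Euc n → ℝ≥0∞, Measurable f → ∫⁻ x, f x = ENNReal.ofReal (r ^ n) * ∫⁻ x, f (r • x) := by
    intro f hf
    have h1 := Measure.map_addHaar_smul (volume : Measure (Euc n)) hr.ne'
    have h2 : ∫⁻ x, f (r • x) = ∫⁻ x, f x ∂(Measure.map (fun x => r • x) volume) := by
      rw [lintegral_map hf (by fun_prop)]
    have h1' : Measure.map (fun x => r • x) (volume : Measure (Euc n)) =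
      ENNReal.ofReal |(r ^ Module.finrank ℝ (Euc n))⁻¹| • volume := h1
    rw [h2, h1', lintegral_smul_measure, smul_eq_mul, ← mul_assoc, ← ENNReal.ofReal_mul (by positivity),
      finrank_euclideanSpace, Fintype.card_fin, abs_of_pos (by positivity),
      mul_inv_cancel₀ (by positivity), ENNReal.ofReal_one, one_mul]
  rw [h.wm_apply hrA, h.wm_apply hA, ← lintegral_indicator hrA, ← lintegral_indicator hA,
    e _ (h.wd_meas.indicator hrA)]
  have : ∀ x, (r • A).indicator (wd S w) (r • x) = ENNReal.ofReal (r ^ α) * A.indicator (wd S w) x := by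
    intro x
    by_cases hx : x ∈ A
    · rw [indicator_of_mem hx, indicator_of_mem (smul_mem_smul_set hx), h.wd_smul x hr]
    · rw [indicator_of_notMem hx, indicator_of_notMem, mul_zero]
      rwa [Set.smul_mem_smul_set_iff₀ hr.ne']
  simp only [this]
  rw [lintegral_const_mul _ (h.wd_meas.indicator hA), ← mul_assoc, ← ENNReal.ofReal_mul (by positivity),
    Real.rpow_add hr, Real.rpow_natCast]

end Ctx

/-- tame functions -/
structure Tame {n : ℕ} (S : Set (Euc n)) (w : Euc n → ℝ) (g : Euc n → ℝ) (p : Euc n → Euc n) :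
    Prop where
  gm : Measurable g
  g0 : ∀ x, 0 ≤ g x
  g1 : ∀ x, g x ≤ 1
  gi : Integrable g (wm S w)
  pm : Measurable p
  pi : Integrable p (wm S w)
  ex : ∃ G : ℝ → Euc n → ℝ, ∃ ε0 > 0, (∀ ε, 0 < ε → ε ≤ ε0 → Integrable (G ε) (wm S w)) ∧
    Filter.Tendsto (fun ε => (∫ x, G ε x ∂(wm S w)) / ε) (𝓝[>] 0) (𝓝 0) ∧
    ∀ ε, 0 < ε → ε ≤ ε0 → ∀ z ∈ S, ∀ v : Euc n, ‖v‖ ≤ ε →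
      |g (z + v) - g z - ⟪p z, v⟫| ≤ G ε z

namespace Ctx
variable {n : ℕ} {S : Set (Euc n)} {α : ℝ} {w : Euc n → ℝ}

open scoped Pointwise in
lemma G (h : Ctx S α w) {g : Euc n → ℝ} {p : Euc n → Euc n} (hg : Tame S w g p)
    {K : Set (Euc n)} (hK : IsOpen K) (hKS : K ⊆ S) (hKb : Bornology.IsBounded K)
    (hKn : K.Nonempty) {Φ : Euc n → ℝ} (hΦ : Integrable Φ (wm S w))
    (H : ∀ z ∈ S, ∀ y ∈ K, - ⟪p z, y⟫ ≤ Φ z) :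
    ENNReal.ofReal ((n:ℝ) + α) * (wm S w K) ^ (1/((n:ℝ)+α)) *
      ∫⁻ s in Ioo (0:ℝ) 1, (wm S w {x | s < g x}) ^ (((n:ℝ)+α-1)/((n:ℝ)+α)) ≤
      ENNReal.ofReal (∫ x, Φ x ∂(wm S w)) := by
  set D := (n:ℝ) + α with hDdef
  have hD := h.D1
  have hD0 : 0 < D := by linarith
  set m := wm S w with hm
  have hK0 := h.wm_pos hK hKS hKn
  have hKt := (h.wm_lt_top hKb).ne
  obtain ⟨R, hR0, hR⟩ : ∃ R > 0, ∀ y ∈ K, ‖y‖ ≤ R := hKb.exists_pos_norm_le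
  obtain ⟨G, ε0, hε0, Gi, Gl, Ge⟩ := hg.ex
  obtain ⟨y0, hy0⟩ := hKn
  -- the main inequality at fixed ε
  have main : ∀ ε, 0 < ε → ε * R ≤ ε0 → ENNReal.ofReal D * (m K) ^ (1/D) *
      ∫⁻ s in Ioo (0:ℝ) 1, (m {x | s < g x}) ^ ((D-1)/D) ≤
      ENNReal.ofReal (∫ x, Φ x ∂m + (∫ x, G (ε * R) x ∂m) / ε) := by
    intro ε hε hεR
    have hGi := Gi (ε * R) (by positivity) hεR
    have pt : ∀ z ∈ S, ∀ y ∈ K, g (z - ε • y) ≤ g z + ε * Φ z + G (ε * R) z := by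
      intro z hz y hy
      have h1 := Ge (ε * R) (by positivity) hεR z hz (-(ε • y)) (by
        rw [norm_neg, norm_smul, Real.norm_of_nonneg hε.le]; gcongr; exact hR y hy)
      have h2 := (abs_le.1 h1).2
      rw [← sub_eq_add_neg, inner_neg_right, inner_smul_right] at h2
      have h3 := H z hz y hy
      have h4 : ε * (- ⟪p z, y⟫) ≤ ε * Φ z := by gcongr
      linarith
    set q : Euc n → ℝ := fun z => g z + ε * Φ z + G (ε * R) z with hq
    have hqi : Integrable q m := (hg.gi.add (hΦ.const_mul ε)).add hGi
    have hq0 : ∀ᵐ z ∂m, 0 ≤ q z := by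
      filter_upwards [h.ae_S] with z hz
      exact (hg.g0 _).trans (pt z hz y0 hy0)
    have lay1 : ENNReal.ofReal (∫ z, q z ∂m) = ∫⁻ t in Ioi (0:ℝ), m {z | t < q z} := by
      rw [ofReal_integral_eq_lintegral_ofReal hqi hq0]
      exact lintegral_eq_lintegral_meas_lt m hq0 hqi.1.aemeasurable
    have lay2 : ENNReal.ofReal (∫ z, g z ∂m) = ∫⁻ t in Ioo (0:ℝ) 1, m {z | t < g z} := by
      rw [ofReal_integral_eq_lintegral_ofReal hg.gi (Filter.Eventually.of_forall hg.g0)]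
      rw [layer1 m hg.gm.ennreal_ofReal]
      · apply setLIntegral_congr_fun measurableSet_Ioo
        intro t ht
        simp only
        congr 1
        ext x
        simp only [mem_setOf_eq]
        rw [ENNReal.ofReal_lt_ofReal_iff_of_nonneg ht.1.le]
      · intro x
        rw [← ENNReal.ofReal_one]
        exact ENNReal.ofReal_le_ofReal (hg.g1 x)
    have step : ∀ t ∈ Ioo (0:ℝ) 1, m {z | t < g z} + ENNReal.ofReal D * (ENNReal.ofReal ε * (m K) ^ (1/D)) *
        (m {z | t < g z}) ^ ((D-1)/D) ≤ m {z | t < q z} := by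
      intro t ht
      by_cases hz : m {z | t < g z} = 0
      · rw [hz]
        rcases (div_nonneg (by linarith : 0 ≤ D - 1) hD0.le).lt_or_eq with h1 | h1
        · rw [ENNReal.zero_rpow_of_pos h1]; simp
        · exfalso
          have : D = 1 := by
            have := (div_eq_zero_iff.1 h1.symm)
            rcases this with h2 | h2 <;> linarith
          have h5 : (1:ℝ) ≤ n := by exact_mod_cast h.hn
          have := h.hα
          linarith
      · set A := {z | t < g z} ∩ S with hA
        have hAm : MeasurableSet A := (measurableSet_lt measurable_const hg.gm).inter h.op.measurableSet
        have eA : m {z | t < g z} = m A := by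
          apply measure_congr
          filter_upwards [h.ae_S] with z hz
          simp only [hA, eq_iff_iff]
          exact ⟨fun h' => ⟨h', hz⟩, fun h' => h'.1⟩
        rw [eA] at hz ⊢
        refine (bernoulli_enn hD (ENNReal.mul_ne_top ENNReal.ofReal_ne_top
          (ENNReal.rpow_ne_top_of_nonneg (by positivity) hKt)) hz).trans ?_
        have hεK : m (ε • K) ^ (1/D) = ENNReal.ofReal ε * (m K) ^ (1/D) := by
          rw [hm, h.wm_smul hK.measurableSet hε, ENNReal.mul_rpow_of_nonneg _ _ (by positivity),
            ENNReal.ofReal_rpow_of_pos (by positivity), ← Real.rpow_mul hε.le,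
            mul_one_div_cancel hD0.ne', Real.rpow_one]
        rw [← hεK]
        have hεK0 : m (ε • K) ≠ 0 := by
          rw [hm, h.wm_smul hK.measurableSet hε]
          exact mul_ne_zero (by simp; positivity) hK0
        have hεKo : IsOpen (ε • K) := hK.smul₀ hε.ne'
        have hεKS : ε • K ⊆ S := by
          rintro _ ⟨y, hy, rfl⟩
          exact h.cone (hKS hy) hε
        have hsumo : IsOpen (A + ε • K) := hεKo.add_left
        refine (h.bm hAm hεKo.measurableSet hsumo.measurableSet inter_subset_right hεKS hz hεK0
          (fun x hx y hy => add_mem_add hx hy)).trans ?_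
        apply measure_mono
        rintro _ ⟨x, hx, _, ⟨y, hy, rfl⟩, rfl⟩
        simp only [mem_setOf_eq]
        have hzS : x + ε • y ∈ S := h.add hx.2 (h.cone (hKS hy) hε)
        have := pt _ hzS y hy
        rw [add_sub_cancel_right] at this
        exact lt_of_lt_of_le hx.1 this
    have tot : ENNReal.ofReal (∫ z, g z ∂m) + ENNReal.ofReal ε * (ENNReal.ofReal D * (m K) ^ (1/D) *
      ∫⁻ s in Ioo (0:ℝ) 1, (m {x | s < g x}) ^ ((D-1)/D)) ≤ ENNReal.ofReal (∫ z, q z ∂m) := by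
      have meas : Measurable fun t : ℝ => m {z | t < g z} := by
        apply Antitone.measurable
        intro a b hab
        apply measure_mono
        intro x hx
        exact hab.trans_lt hx
      have e : ENNReal.ofReal ε * (ENNReal.ofReal D * (m K) ^ (1/D) *
          ∫⁻ s in Ioo (0:ℝ) 1, (m {x | s < g x}) ^ ((D-1)/D)) =
          ∫⁻ s in Ioo (0:ℝ) 1, ENNReal.ofReal D * (ENNReal.ofReal ε * (m K) ^ (1/D)) *
            (m {x | s < g x}) ^ ((D-1)/D) := by
        rw [lintegral_const_mul _ (meas.pow_const _)]
        ring
      rw [e, lay1, lay2, ← lintegral_add_left meas]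
      refine (setLIntegral_mono' measurableSet_Ioo step).trans ?_
      exact lintegral_mono_set Ioo_subset_Ioi_self
    have iq : ∫ z, q z ∂m = ∫ z, g z ∂m + ε * (∫ z, Φ z ∂m + (∫ z, G (ε * R) z ∂m) / ε) := by
      have i1 : ∫ z, q z ∂m = ∫ z, (g z + ε * Φ z) ∂m + ∫ z, G (ε * R) z ∂m :=
        integral_add (hg.gi.add (hΦ.const_mul ε)) hGi
      have i2 : ∫ z, (g z + ε * Φ z) ∂m = ∫ z, g z ∂m + ∫ z, ε * Φ z ∂m :=
        integral_add hg.gi (hΦ.const_mul ε)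
      rw [i1, i2, integral_const_mul]
      field_simp
      ring
    rw [iq] at tot
    have gnn : 0 ≤ ∫ z, g z ∂m := integral_nonneg hg.g0
    set X := ∫ z, Φ z ∂m + (∫ z, G (ε * R) z ∂m) / ε with hX
    have h9 := tot.trans (ENNReal.ofReal_add_le)
    rw [ENNReal.add_le_add_iff_left ENNReal.ofReal_ne_top, ENNReal.ofReal_mul hε.le] at h9
    rwa [ENNReal.mul_le_mul_iff_right (by simp; positivity) ENNReal.ofReal_ne_top] at h9
  have lim : Filter.Tendsto (fun ε => ENNReal.ofReal (∫ x, Φ x ∂m + (∫ x, G (ε * R) x ∂m) / ε))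
      (𝓝[>] 0) (𝓝 (ENNReal.ofReal (∫ x, Φ x ∂m))) := by
    apply ENNReal.tendsto_ofReal
    have l1 : Filter.Tendsto (fun ε : ℝ => ε * R) (𝓝[>] 0) (𝓝[>] 0) := by
      apply tendsto_nhdsWithin_iff.2 ⟨?_, ?_⟩
      · have : Filter.Tendsto (fun ε : ℝ => ε * R) (𝓝 0) (𝓝 (0 * R)) := by
          apply Continuous.tendsto; fun_prop
        rw [zero_mul] at this
        exact this.mono_left nhdsWithin_le_nhds
      · filter_upwards [self_mem_nhdsWithin] with ε hε
        exact mul_pos hε hR0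
    have l2 := ((Gl.comp l1).mul_const R).const_add (∫ x, Φ x ∂m)
    simp only [zero_mul, add_zero] at l2
    refine l2.congr' ?_
    filter_upwards [self_mem_nhdsWithin] with ε hε
    simp only [Function.comp]
    have : (ε:ℝ) ≠ 0 := ne_of_gt hε
    rw [← hm]
    field_simp
  apply ge_of_tendsto lim
  have : Iic (ε0 / R) ∈ 𝓝[>] (0:ℝ) := nhdsWithin_le_nhds (Iic_mem_nhds (by positivity))
  filter_upwards [self_mem_nhdsWithin, this] with ε hε hε2
  exact main ε hε (by rwa [← le_div_iff₀ hR0])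

/-- real limit form of G -/
lemma Glim (h : Ctx S α w) {g : ℕ → Euc n → ℝ} {p : ℕ → Euc n → Euc n}
    (hg : ∀ j, Tame S w (g j) (p j))
    {K : Set (Euc n)} (hK : IsOpen K) (hKS : K ⊆ S) (hKb : Bornology.IsBounded K)
    (hKn : K.Nonempty) {Φ : ℕ → Euc n → ℝ} (hΦ : ∀ j, Integrable (Φ j) (wm S w))
    (H : ∀ j, ∀ z ∈ S, ∀ y ∈ K, - ⟪p j z, y⟫ ≤ Φ j z)
    {A : Set (Euc n)} (hA : MeasurableSet A) (hAt : wm S w A ≠ ⊤) (hA0 : wm S w A ≠ 0)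
    (hgA : ∀ x ∈ A, Filter.Tendsto (fun j => g j x) Filter.atTop (𝓝 1))
    {κ : ℝ} (hκ : 0 < κ) :
    ∀ᶠ j in Filter.atTop, ((n:ℝ)+α) * (wm S w).real K ^ (1/((n:ℝ)+α)) *
      (wm S w).real A ^ (((n:ℝ)+α-1)/((n:ℝ)+α)) - κ ≤ ∫ x, Φ j x ∂(wm S w) := by
  set D := (n:ℝ) + α with hDdef
  have hD := h.D1
  have hD0 : 0 < D := by linarith
  have hDe : 0 ≤ (D-1)/D := div_nonneg (by linarith) hD0.le
  set m := wm S w with hm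
  have hK0 := h.wm_pos hK hKS hKn
  have hKt := (h.wm_lt_top hKb).ne
  -- liminf
  have l1 : ∀ s ∈ Ioo (0:ℝ) 1, m A ≤ Filter.liminf (fun j => m {x | s < g j x}) Filter.atTop := by
    intro s hs
    calc m A = ∫⁻ x, A.indicator 1 x ∂m := by rw [lintegral_indicator_one hA]
      _ ≤ ∫⁻ x, Filter.liminf (fun j => ({x | s < g j x} : Set (Euc n)).indicator (1 : Euc n → ℝ≥0∞) x) Filter.atTop ∂m := by
          apply lintegral_mono
          intro x
          by_cases hx : x ∈ A
          · have : ∀ᶠ j in Filter.atTop, (1:ℝ≥0∞) = ({x | s < g j x} : Set (Euc n)).indicator (1 : Euc n → ℝ≥0∞) x := by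
              filter_upwards [(hgA x hx).eventually (lt_mem_nhds hs.2)] with j hj
              rw [indicator_of_mem]
              · rfl
              · exact hj
            simp only [hx, indicator_of_mem, Pi.one_apply]
            rw [← Filter.liminf_congr this]
            simp
          · simp [hx]
      _ ≤ Filter.liminf (fun j => ∫⁻ x, ({x | s < g j x} : Set (Euc n)).indicator (1 : Euc n → ℝ≥0∞) x ∂m) Filter.atTop :=
          lintegral_liminf_le fun j => measurable_one.indicator (measurableSet_lt measurable_const (hg j).gm)
      _ = _ := by
          congr 1
          ext j
          rw [lintegral_indicator_one (measurableSet_lt measurable_const (hg j).gm)]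
  have l2 : (m A) ^ ((D-1)/D) ≤ Filter.liminf (fun j => ∫⁻ s in Ioo (0:ℝ) 1, (m {x | s < g j x}) ^ ((D-1)/D)) Filter.atTop := by
    calc (m A) ^ ((D-1)/D) = ∫⁻ s in Ioo (0:ℝ) 1, (m A) ^ ((D-1)/D) := by simp
      _ ≤ ∫⁻ s in Ioo (0:ℝ) 1, Filter.liminf (fun j => (m {x | s < g j x}) ^ ((D-1)/D)) Filter.atTop := by
          apply setLIntegral_mono' measurableSet_Ioo
          intro s hs
          have mono : Monotone (fun x : ℝ≥0∞ => x ^ ((D-1)/D)) := fun a b hab => ENNReal.rpow_le_rpow hab hDe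
          have := mono.map_liminf_of_continuousAt (F := Filter.atTop) (fun j => m {x | s < g j x})
            (ENNReal.continuous_rpow_const.continuousAt)
          simp only [Function.comp_def] at this
          rw [← this]
          exact mono (l1 s hs)
      _ ≤ _ := by
          apply lintegral_liminf_le
          intro j
          refine Measurable.pow_const ?_ _
          apply Antitone.measurable
          intro a b hab
          apply measure_mono
          intro x hx
          exact hab.trans_lt hx
  set c := ENNReal.ofReal D * (m K) ^ (1/D) with hc
  have hc0 : c ≠ 0 := by
    apply mul_ne_zero (by simp; positivity)
    have : m K ≠ 0 := hK0
    simp [ENNReal.rpow_eq_zero_iff, this, hD0.le, hKt]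
  have hct : c ≠ ⊤ := ENNReal.mul_ne_top ENNReal.ofReal_ne_top (ENNReal.rpow_ne_top_of_nonneg (by positivity) hKt)
  set X := D * m.real K ^ (1/D) * m.real A ^ ((D-1)/D) with hX
  have hX0 : 0 ≤ X := by positivity
  have eX : c * (m A) ^ ((D-1)/D) = ENNReal.ofReal X := by
    rw [hX, hc, ENNReal.ofReal_mul (by positivity), ENNReal.ofReal_mul (by positivity),
      ← ENNReal.ofReal_rpow_of_nonneg measureReal_nonneg (by positivity),
      ← ENNReal.ofReal_rpow_of_nonneg measureReal_nonneg hDe, measureReal_def, measureReal_def,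
      ENNReal.ofReal_toReal hKt, ENNReal.ofReal_toReal hAt]
  have hXp : 0 < X := by
    have a1 : 0 < m.real K := ENNReal.toReal_pos hK0 hKt
    have a2 : 0 < m.real A := ENNReal.toReal_pos hA0 hAt
    positivity
  set κ' := min κ (X/2) with hκ'
  have k1 : 0 < κ' := by positivity
  have k2 : κ' ≤ κ := min_le_left _ _
  have k3 : κ' ≤ X/2 := min_le_right _ _
  have lt1 : ENNReal.ofReal (X - κ') / c < Filter.liminf (fun j => ∫⁻ s in Ioo (0:ℝ) 1, (m {x | s < g j x}) ^ ((D-1)/D)) Filter.atTop := by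
    refine lt_of_lt_of_le ?_ l2
    rw [ENNReal.div_lt_iff (Or.inl hc0) (Or.inl hct), mul_comm, eX, ENNReal.ofReal_lt_ofReal_iff hXp]
    linarith
  filter_upwards [Filter.eventually_lt_of_lt_liminf lt1] with j hj
  have h1 := h.G (hg j) hK hKS hKb hKn (hΦ j) (H j)
  rw [← hDdef, ← hm, ← hc] at h1
  rw [ENNReal.div_lt_iff (Or.inl hc0) (Or.inl hct), mul_comm] at hj
  have h2 := hj.trans_le h1
  rw [ENNReal.ofReal_lt_ofReal_iff_of_nonneg (by linarith)] at h2
  linarith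
end Ctx

end

noncomputable section

/-- linear ramp: `1` for `u ≤ t`, `0` for `u ≥ t + η` -/
def rmp (t η u : ℝ) : ℝ := max 0 (min 1 ((t + η - u) / η))
/-- minus its derivative -/
def rmd (t η u : ℝ) : ℝ := (Ioo t (t+η)).indicator (fun _ => 1/η) u

lemma rmp_nonneg (t η u : ℝ) : 0 ≤ rmp t η u := le_max_left _ _
lemma rmp_le (t η u : ℝ) : rmp t η u ≤ 1 := max_le zero_le_one (min_le_left _ _)
lemma rmp_one {t η u : ℝ} (hη : 0 < η) (hu : u ≤ t) : rmp t η u = 1 := by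
  have : 1 ≤ (t + η - u) / η := by rw [le_div_iff₀ hη]; linarith
  rw [rmp, min_eq_left this]; simp
lemma rmp_zero {t η u : ℝ} (hη : 0 < η) (hu : t + η ≤ u) : rmp t η u = 0 := by
  have : (t + η - u) / η ≤ 0 := div_nonpos_of_nonpos_of_nonneg (by linarith) hη.le
  rw [rmp, max_eq_left]
  exact (min_le_right _ _).trans this
lemma rmp_mid {t η u : ℝ} (hη : 0 < η) (h1 : t ≤ u) (h2 : u ≤ t + η) :
    rmp t η u = (t + η - u) / η := by
  have a1 : (t + η - u) / η ≤ 1 := by rw [div_le_iff₀ hη]; linarith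
  have a2 : 0 ≤ (t + η - u) / η := div_nonneg (by linarith) hη.le
  rw [rmp, min_eq_right a1, max_eq_right a2]
lemma rmd_nonneg {t η : ℝ} (hη : 0 < η) (u : ℝ) : 0 ≤ rmd t η u :=
  indicator_nonneg (fun _ _ => by positivity) u
lemma rmd_le {t η : ℝ} (hη : 0 < η) (u : ℝ) : rmd t η u ≤ 1/η := by
  unfold rmd
  by_cases h : u ∈ Ioo t (t+η)
  · simp [h]
  · simp only [h, not_false_eq_true, indicator_of_notMem]; positivity
lemma rmp_meas (t η : ℝ) : Measurable (rmp t η) := by unfold rmp; fun_prop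
lemma rmd_meas (t η : ℝ) : Measurable (rmd t η) := measurable_const.indicator measurableSet_Ioo
lemma rmp_symm {t η : ℝ} (hη : 0 < η) (u : ℝ) : rmp (-t-η) η (-u) = 1 - rmp t η u := by
  rcases le_total u t with h | h
  · rw [rmp_one hη h, rmp_zero hη (by linarith)]; simp
  rcases le_total u (t+η) with h' | h'
  · rw [rmp_mid hη h h', rmp_mid hη (by linarith) (by linarith)]; field_simp; ring
  · rw [rmp_zero hη h', rmp_one hη (by linarith)]; simp
lemma rmd_symm {t η : ℝ} (u : ℝ) : rmd (-t-η) η (-u) = rmd t η u := by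
  unfold rmd
  have : -u ∈ Ioo (-t-η) (-t-η+η) ↔ u ∈ Ioo t (t+η) := by
    simp only [mem_Ioo]; constructor <;> rintro ⟨a, b⟩ <;> constructor <;> linarith
  by_cases h : u ∈ Ioo t (t+η)
  · rw [indicator_of_mem h, indicator_of_mem (this.2 h)]
  · rw [indicator_of_notMem h, indicator_of_notMem (this.not.2 h)]

lemma rmp_lip {t η : ℝ} (hη : 0 < η) (u v : ℝ) : |rmp t η u - rmp t η v| ≤ |u - v| / η := by
  unfold rmp
  refine (abs_max_sub_max_le_max _ _ _ _).trans ?_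
  rw [sub_self, abs_zero, max_eq_right (abs_nonneg _)]
  refine (abs_min_sub_min_le_max _ _ _ _).trans ?_
  rw [sub_self, abs_zero, max_eq_right (abs_nonneg _), ← sub_div, abs_div, abs_of_pos hη]
  rw [show t + η - u - (t + η - v) = -(u - v) by ring, abs_neg]

lemma rmp_err {t η ε : ℝ} (hη : 0 < η) (u d : ℝ) (hd : |d| ≤ ε) :
    |rmp t η (u + d) - rmp t η u + rmd t η u * d| ≤
      ({u : ℝ | |u - t| ≤ ε} ∪ {u | |u - (t+η)| ≤ ε}).indicator (fun _ => 2 * ε / η) u := by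
  have hd' := abs_le.1 hd
  by_cases hb : u ∈ ({u : ℝ | |u - t| ≤ ε} ∪ {u | |u - (t+η)| ≤ ε})
  · rw [indicator_of_mem hb]
    have h1 := rmp_lip hη (t := t) (u+d) u
    rw [add_sub_cancel_left] at h1
    have h2 : |rmd t η u * d| ≤ 1/η * |d| := by
      rw [abs_mul, abs_of_nonneg (rmd_nonneg hη u)]
      gcongr
      exact rmd_le hη u
    calc _ ≤ |rmp t η (u + d) - rmp t η u| + |rmd t η u * d| := abs_add_le _ _
      _ ≤ |d|/η + 1/η * |d| := add_le_add h1 h2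
      _ = 2 * |d| / η := by ring
      _ ≤ _ := by gcongr
  · rw [indicator_of_notMem hb]
    simp only [mem_union, mem_setOf_eq, not_or, not_le, lt_abs] at hb
    obtain ⟨h1, h2⟩ := hb
    rw [abs_nonpos_iff]
    have hεp : 0 ≤ ε := (abs_nonneg d).trans hd
    rcases h1 with h1 | h1
    · rcases h2 with h2 | h2
      · rw [rmp_zero hη (by linarith), rmp_zero hη (by linarith), rmd, indicator_of_notMem]
        · simp
        · simp only [mem_Ioo, not_and, not_lt]; intro; linarith
      · rw [rmp_mid hη (by linarith) (by linarith), rmp_mid hη (by linarith) (by linarith), rmd,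
          indicator_of_mem]
        · field_simp; ring
        · simp only [mem_Ioo]; constructor <;> linarith
    · rw [rmp_one hη (by linarith), rmp_one hη (by linarith), rmd, indicator_of_notMem]
      · simp
      · simp only [mem_Ioo, not_and, not_lt]; intro; linarith

lemma hyper_null {n : ℕ} (e : Euc n) (he : ‖e‖ = 1) (c : ℝ) :
    volume {x : Euc n | ⟪x, e⟫ = c} = 0 := by
  let A : AffineSubspace ℝ (Euc n) := AffineSubspace.mk' (c • e) (LinearMap.ker (innerₛₗ ℝ e))
  have : {x : Euc n | ⟪x, e⟫ = c} = A := by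
    ext x
    simp only [mem_setOf_eq, A, SetLike.mem_coe, AffineSubspace.mem_mk', vsub_eq_sub, LinearMap.mem_ker,
      innerₛₗ_apply_apply, inner_sub_right, inner_smul_right, real_inner_self_eq_norm_sq, he]
    rw [real_inner_comm]
    constructor <;> intro h <;> linarith
  rw [this]
  apply Measure.addHaar_affineSubspace
  intro hA
  have h1 : ((c+1) • e : Euc n) ∈ A := by rw [hA]; trivial
  rw [← SetLike.mem_coe, ← this] at h1
  simp only [mem_setOf_eq, inner_smul_left, real_inner_self_eq_norm_sq, he] at h1
  simp at h1

namespace Ctx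
variable {n : ℕ} {S : Set (Euc n)} {α : ℝ} {w : Euc n → ℝ}

lemma wm_ac (h : Ctx S α w) : wm S w ≪ volume := withDensity_absolutelyContinuous _ _

lemma tame_ramp (h : Ctx S α w) {g : Euc n → ℝ} {p : Euc n → Euc n} (hg : Tame S w g p)
    {e : Euc n} (he : ‖e‖ = 1) {t η : ℝ} (hη : 0 < η) :
    Tame S w (fun x => g x * rmp t η ⟪x, e⟫)
      (fun x => rmp t η ⟪x, e⟫ • p x - (g x * rmd t η ⟪x, e⟫) • e) := by
  have hin : Measurable (fun x : Euc n => ⟪x, e⟫) := by fun_prop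
  have mr : Measurable (fun x : Euc n => rmp t η ⟪x, e⟫) := (rmp_meas t η).comp hin
  have md : Measurable (fun x : Euc n => rmd t η ⟪x, e⟫) := (rmd_meas t η).comp hin
  have hgm := hg.gm
  have hpm := hg.pm
  set m := wm S w with hm
  refine ⟨by fun_prop, fun x => mul_nonneg (hg.g0 x) (rmp_nonneg _ _ _),
    fun x => mul_le_one₀ (hg.g1 x) (rmp_nonneg _ _ _) (rmp_le _ _ _), ?_, by fun_prop, ?_, ?_⟩
  · apply hg.gi.mul_bdd (c := 1) mr.aestronglyMeasurable
    filter_upwards with x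
    rw [Real.norm_of_nonneg (rmp_nonneg _ _ _)]; exact rmp_le _ _ _
  · apply Integrable.sub
    · apply hg.pi.bdd_smul 1 mr.aestronglyMeasurable
      filter_upwards with x
      rw [Real.norm_of_nonneg (rmp_nonneg _ _ _)]; exact rmp_le _ _ _
    · apply Integrable.smul_const
      apply hg.gi.mul_bdd (c := 1/η) md.aestronglyMeasurable
      filter_upwards with x
      rw [Real.norm_of_nonneg (rmd_nonneg hη _)]; exact rmd_le hη _
  · obtain ⟨G, ε0, hε0, Gi, Gl, Ge⟩ := hg.ex
    set bad : ℝ → Set (Euc n) := fun ε => {x | |⟪x, e⟫ - t| ≤ ε} ∪ {x | |⟪x, e⟫ - (t+η)| ≤ ε} with hbad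
    have mbad : ∀ ε, MeasurableSet (bad ε) := fun ε =>
      (measurableSet_le (by fun_prop) measurable_const).union (measurableSet_le (by fun_prop) measurable_const)
    have bi : ∀ ε, Integrable ((bad ε).indicator g) m := fun ε => hg.gi.indicator (mbad ε)
    have blim : Filter.Tendsto (fun ε => ∫ x, (bad ε).indicator g x ∂m) (𝓝[>] 0) (𝓝 0) := by
      have : ∫ x, (fun _ : Euc n => (0:ℝ)) x ∂m = 0 := by simp
      suffices hs : Filter.Tendsto (fun ε => ∫ x, (bad ε).indicator g x ∂m) (𝓝[>] 0)
          (𝓝 (∫ x, (fun _ : Euc n => (0:ℝ)) x ∂m)) by rwa [this] at hs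
      apply tendsto_integral_filter_of_dominated_convergence (fun x => |g x|)
      · filter_upwards with ε using (bi ε).1
      · filter_upwards with ε
        filter_upwards with x
        rw [Real.norm_eq_abs]
        by_cases hx : x ∈ bad ε
        · simp [hx]
        · simp [hx]
      · exact hg.gi.abs
      · have n1 : ∀ c, ∀ᵐ x ∂m, ⟪x, e⟫ ≠ c := by
          intro c
          have := h.wm_ac (hyper_null e he c)
          simpa [ae_iff] using this
        filter_upwards [n1 t, n1 (t+η)] with x hx1 hx2
        apply tendsto_const_nhds.congr'
        have p1 : 0 < |⟪x, e⟫ - t| := abs_pos.2 (sub_ne_zero.2 hx1)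
        have p2 : 0 < |⟪x, e⟫ - (t+η)| := abs_pos.2 (sub_ne_zero.2 hx2)
        filter_upwards [nhdsWithin_le_nhds (Iio_mem_nhds p1), nhdsWithin_le_nhds (Iio_mem_nhds p2)] with ε h1 h2
        rw [indicator_of_notMem]
        simp only [hbad, mem_union, mem_setOf_eq, not_or, not_le]
        exact ⟨h1, h2⟩
    refine ⟨fun ε z => G ε z + (ε^2/η) * ‖p z‖ + (2 * ε/η) * (bad ε).indicator g z, ε0, hε0, ?_, ?_, ?_⟩
    · intro ε h1 h2
      exact ((Gi ε h1 h2).add (hg.pi.norm.const_mul _)).add ((bi ε).const_mul _)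
    · have l : Filter.Tendsto (fun ε => (∫ x, G ε x ∂m) / ε + (ε/η) * ∫ x, ‖p x‖ ∂m +
          2/η * ∫ x, (bad ε).indicator g x ∂m) (𝓝[>] 0) (𝓝 (0 + (0/η) * ∫ x, ‖p x‖ ∂m + 2/η * 0)) := by
        refine (Gl.add ?_).add (blim.const_mul _)
        apply Filter.Tendsto.mul_const
        apply Filter.Tendsto.div_const
        exact nhdsWithin_le_nhds
      simp only [zero_div, zero_mul, mul_zero, add_zero] at l
      refine l.congr' ?_
      filter_upwards [self_mem_nhdsWithin, nhdsWithin_le_nhds (Iic_mem_nhds hε0)] with ε h1 h2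
      have h1 : 0 < ε := h1
      have i1 : ∫ z, (G ε z + (ε^2/η) * ‖p z‖ + (2 * ε/η) * (bad ε).indicator g z) ∂m =
          ∫ z, (G ε z + (ε^2/η) * ‖p z‖) ∂m + ∫ z, (2 * ε/η) * (bad ε).indicator g z ∂m :=
        integral_add ((Gi ε h1 h2).add (hg.pi.norm.const_mul _)) ((bi ε).const_mul _)
      have i2 : ∫ z, (G ε z + (ε^2/η) * ‖p z‖) ∂m = ∫ z, G ε z ∂m + ∫ z, (ε^2/η) * ‖p z‖ ∂m :=
        integral_add (Gi ε h1 h2) (hg.pi.norm.const_mul _)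
      rw [i1, i2, integral_const_mul, integral_const_mul]
      field_simp
    · intro ε h1 h2 z hz v hv
      have a1 := Ge ε h1 h2 z hz v hv
      have hev : |⟪v, e⟫| ≤ ε := by
        refine (abs_real_inner_le_norm v e).trans ?_
        rw [he, mul_one]; exact hv
      have a2 := rmp_err (t := t) hη ⟪z, e⟫ ⟪v, e⟫ hev
      have a3 := rmp_lip (t := t) hη (⟪z, e⟫ + ⟪v, e⟫) ⟪z, e⟫
      rw [add_sub_cancel_left] at a3
      have a4 : |⟪p z, v⟫| ≤ ‖p z‖ * ε := (abs_real_inner_le_norm _ _).trans (by gcongr)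
      simp only [inner_add_left, inner_sub_left, inner_smul_left, RCLike.conj_to_real]
      rw [real_inner_comm v e]
      set X := rmp t η (⟪z, e⟫ + ⟪v, e⟫) with hX
      set Y := rmp t η ⟪z, e⟫ with hY
      have key : g (z + v) * X - g z * Y - (Y * ⟪p z, v⟫ - g z * rmd t η ⟪z, e⟫ * ⟪v, e⟫) =
        X * (g (z + v) - g z - ⟪p z, v⟫) + (X - Y) * ⟪p z, v⟫ +
          g z * (X - Y + rmd t η ⟪z, e⟫ * ⟪v, e⟫) := by ring
      rw [key]
      refine (abs_add_le _ _).trans (add_le_add ((abs_add_le _ _).trans (add_le_add ?_ ?_)) ?_)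
      · rw [abs_mul, abs_of_nonneg (rmp_nonneg _ _ _)]
        calc _ ≤ 1 * |g (z + v) - g z - ⟪p z, v⟫| := by gcongr; exact rmp_le _ _ _
          _ ≤ _ := by rw [one_mul]; exact a1
      · rw [abs_mul]
        calc |X - Y| * |⟪p z, v⟫| ≤ (|⟪v, e⟫|/η) * (‖p z‖ * ε) := by gcongr
          _ ≤ (ε/η) * (‖p z‖ * ε) := by gcongr
          _ = _ := by ring
      · rw [abs_mul, abs_of_nonneg (hg.g0 z)]
        calc _ ≤ g z * _ := mul_le_mul_of_nonneg_left a2 (hg.g0 z)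
          _ = _ := by
            by_cases hb : z ∈ bad ε
            · rw [indicator_of_mem hb, indicator_of_mem (show ⟪z, e⟫ ∈ _ from hb)]; ring
            · rw [indicator_of_notMem hb, indicator_of_notMem (show ⟪z, e⟫ ∉ _ from hb)]; ring
end Ctx

end

noncomputable section

/-- the model set -/
def BS {n : ℕ} (S : Set (Euc n)) : Set (Euc n) := ball 0 1 ∩ S
def VV {n : ℕ} (S : Set (Euc n)) (w : Euc n → ℝ) : ℝ := (wm S w).real (BS S)
def th {n : ℕ} (S : Set (Euc n)) (w : Euc n → ℝ) (E : Set (Euc n)) (e : Euc n) (t : ℝ) : ℝ :=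
  (wm S w).real (E ∩ {x | ⟪x, e⟫ < t})
def sg {n : ℕ} (S : Set (Euc n)) (α : ℝ) (w : Euc n → ℝ) (e : Euc n) (s : ℝ) : ℝ :=
  ((n:ℝ) + α) * (wm S w).real (BS S ∩ {y | ⟪y, e⟫ ≤ s * ‖y‖})
def sgm {n : ℕ} (S : Set (Euc n)) (α : ℝ) (w : Euc n → ℝ) (e : Euc n) (s : ℝ) : ℝ :=
  ((n:ℝ) + α) * (wm S w).real (BS S ∩ {y | ⟪y, e⟫ < s * ‖y‖})

structure GS {n : ℕ} (S : Set (Euc n)) (α : ℝ) (w : Euc n → ℝ) (E : Set (Euc n))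
    (f : ℕ → Euc n → ℝ) (p : ℕ → Euc n → Euc n) : Prop where
  eo : IsOpen E
  es : E ⊆ S
  ev : wm S w E = wm S w (BS S)
  tame : ∀ j, Tame S w (f j) (p j)
  pb : ∀ j, ∫ x, ‖p j x‖ ∂(wm S w) ≤ ((n:ℝ) + α) * VV S w
  fb : ∀ j, ∫ x, f j x ∂(wm S w) ≤ VV S w
  lim : ∀ x ∈ E, Filter.Tendsto (fun j => f j x) Filter.atTop (𝓝 1)

namespace Ctx
variable {n : ℕ} {S : Set (Euc n)} {α : ℝ} {w : Euc n → ℝ}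

lemma BSo (h : Ctx S α w) : IsOpen (BS S) := isOpen_ball.inter h.op
lemma BSs (h : Ctx S α w) : BS S ⊆ S := inter_subset_right
lemma BSb (h : Ctx S α w) : Bornology.IsBounded (BS S) := isBounded_ball.subset inter_subset_left
lemma BSn (h : Ctx S α w) : (BS S).Nonempty := by
  obtain ⟨x, hx⟩ := h.ne
  have hx0 : x ≠ 0 := fun h0 => h.z (h0 ▸ hx)
  have hp : 0 < ‖x‖ := norm_pos_iff.2 hx0
  refine ⟨(1/(2*‖x‖)) • x, ?_, h.cone hx (by positivity)⟩
  rw [mem_ball_zero_iff, norm_smul, Real.norm_of_nonneg (by positivity)]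
  field_simp; norm_num
lemma Vt (h : Ctx S α w) : wm S w (BS S) ≠ ⊤ := (h.wm_lt_top h.BSb).ne
lemma V0 (h : Ctx S α w) : 0 < VV S w := ENNReal.toReal_pos (h.wm_pos h.BSo h.BSs h.BSn) h.Vt
lemma Dlt (h : Ctx S α w) : 1 < (n:ℝ) + α := by
  have := h.hα
  have : (1:ℝ) ≤ n := by exact_mod_cast h.hn
  linarith

lemma fin (h : Ctx S α w) {E : Set (Euc n)} (hE : wm S w E = wm S w (BS S)) (X : Set (Euc n)) :
    wm S w (E ∩ X) ≠ ⊤ :=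
  ne_top_of_le_ne_top (hE ▸ h.Vt) (measure_mono inter_subset_left)

lemma Ereal (h : Ctx S α w) {E : Set (Euc n)} (hE : wm S w E = wm S w (BS S)) :
    (wm S w).real E = VV S w := by rw [measureReal_def, hE]; rfl

/-- L¹ type convergence -/
lemma conv (h : Ctx S α w) {E f p} (g : GS S α w E f p) {ψ : Euc n → ℝ} (hψ : Measurable ψ)
    {C : ℝ} (hC : ∀ x, |ψ x| ≤ C) :
    Filter.Tendsto (fun j => ∫ x, f j x * ψ x ∂(wm S w)) Filter.atTop
      (𝓝 (∫ x in E, ψ x ∂(wm S w))) := by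
  set m := wm S w with hm
  have C0 : 0 ≤ C := (abs_nonneg _).trans (hC 0)
  have hEt : m E ≠ ⊤ := by rw [hm, g.ev]; exact h.Vt
  set c : Euc n → ℝ := E.indicator (fun _ => 1) with hc
  have ci : Integrable c m := by
    rw [hc, integrable_indicator_iff g.eo.measurableSet]
    exact integrableOn_const hEt (by simp)
  have cint : ∫ x, c x ∂m = VV S w := by
    rw [hc, integral_indicator g.eo.measurableSet]
    simp only [setIntegral_const, smul_eq_mul, mul_one]
    exact h.Ereal g.ev
  have cm : Measurable c := measurable_const.indicator g.eo.measurableSet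
  have fi := fun j => (g.tame j).gi
  have l1 : Filter.Tendsto (fun j => ∫ x, max 0 (c x - f j x) ∂m) Filter.atTop (𝓝 0) := by
    have : ∫ x, (fun _ : Euc n => (0:ℝ)) x ∂m = 0 := by simp
    suffices hs : Filter.Tendsto (fun j => ∫ x, max 0 (c x - f j x) ∂m) Filter.atTop
          (𝓝 (∫ x, (fun _ : Euc n => (0:ℝ)) x ∂m)) by rwa [this] at hs
    apply tendsto_integral_of_dominated_convergence c
    · intro j
      have := (g.tame j).gm
      exact (by fun_prop : Measurable fun x => max 0 (c x - f j x)).aestronglyMeasurable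
    · exact ci
    · intro j
      filter_upwards with x
      have h0 : 0 ≤ c x := indicator_nonneg (fun _ _ => zero_le_one) x
      rw [Real.norm_of_nonneg (le_max_left _ _)]
      exact max_le h0 (by linarith [(g.tame j).g0 x])
    · filter_upwards with x
      by_cases hx : x ∈ E
      · have : Filter.Tendsto (fun j => max 0 (c x - f j x)) Filter.atTop (𝓝 (max 0 (c x - 1))) :=
          tendsto_const_nhds.max ((g.lim x hx).const_sub _)
        simpa [hc, hx] using this
      · apply tendsto_const_nhds.congr
        intro j
        have := (g.tame j).g0 x
        simp only [hc, hx, not_false_eq_true, indicator_of_notMem]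
        rw [max_eq_left]; linarith
  have mi : ∀ j, Integrable (fun x => max 0 (c x - f j x)) m := fun j =>
    ((integrable_zero _ _ _).sup (ci.sub (fi j)))
  have l2 : ∀ j, ∫ x, |f j x - c x| ∂m ≤ 2 * ∫ x, max 0 (c x - f j x) ∂m := by
    intro j
    have e : ∀ x, |f j x - c x| = (f j x - c x) + 2 * max 0 (c x - f j x) := by
      intro x
      rcases le_total (f j x) (c x) with hh | hh
      · rw [max_eq_right (by linarith), abs_of_nonpos (by linarith)]; ring
      · rw [max_eq_left (by linarith), abs_of_nonneg (by linarith)]; ring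
    simp only [e]
    have i1 : ∫ x, ((f j x - c x) + 2 * max 0 (c x - f j x)) ∂m =
      ∫ x, (f j x - c x) ∂m + ∫ x, 2 * max 0 (c x - f j x) ∂m :=
      integral_add ((fi j).sub ci) ((mi j).const_mul 2)
    rw [i1, integral_sub (fi j) ci, integral_const_mul, cint]
    linarith [g.fb j]
  have e2 : ∫ x in E, ψ x ∂m = ∫ x, c x * ψ x ∂m := by
    rw [← integral_indicator g.eo.measurableSet]
    congr 1
    ext x
    by_cases hx : x ∈ E <;> simp [hc, hx]
  have bm : ∀ {k : Euc n → ℝ}, Integrable k m → Integrable (fun x => k x * ψ x) m := by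
    intro k hk
    exact hk.mul_bdd (c := C) hψ.aestronglyMeasurable (Filter.Eventually.of_forall hC)
  rw [e2, tendsto_iff_dist_tendsto_zero]
  have l3 := l1.const_mul (C * 2)
  rw [mul_zero] at l3
  refine squeeze_zero (fun _ => dist_nonneg) ?_ l3
  intro j
  rw [Real.dist_eq, ← integral_sub (bm (fi j)) (bm ci)]
  calc |∫ x, (f j x * ψ x - c x * ψ x) ∂m| ≤ ∫ x, |f j x * ψ x - c x * ψ x| ∂m := abs_integral_le_integral_abs
    _ ≤ ∫ x, C * |f j x - c x| ∂m := by
      apply integral_mono ((bm (fi j)).sub (bm ci)).abs (((fi j).sub ci).abs.const_mul C)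
      intro x
      show |f j x * ψ x - c x * ψ x| ≤ C * |f j x - c x|
      rw [← sub_mul, abs_mul, mul_comm]
      gcongr
      exact hC x
    _ = C * ∫ x, |f j x - c x| ∂m := integral_const_mul _ _
    _ ≤ C * (2 * ∫ x, max 0 (c x - f j x) ∂m) := by gcongr; exact l2 j
    _ = _ := by ring

/-- splitting a norm integral -/
lemma pnorm_int (h : Ctx S α w) {E f p} (g : GS S α w E f p) (j : ℕ) :
    Integrable (fun x => ‖p j x‖) (wm S w) := (g.tame j).pi.norm

lemma angle {P u e : Euc n} (he : ‖e‖ = 1) {s κ : ℝ} (hκ : 0 < κ) (h1 : ⟪P, e⟫ < (s - κ) * ‖P‖)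
    (h2 : s * ‖u‖ < ⟪u, e⟫) : ⟪P, u⟫ ≤ (1 - κ^2/2) * (‖P‖ * ‖u‖) := by
  have hP : 0 < ‖P‖ := by
    rw [norm_pos_iff]; rintro rfl; simp at h1
  have hu : 0 < ‖u‖ := by
    rw [norm_pos_iff]; rintro rfl; simp at h2
  set v := ‖P‖ • u - ‖u‖ • P with hv
  have h3 : κ * (‖P‖ * ‖u‖) ≤ ⟪v, e⟫ := by
    rw [hv, inner_sub_left, real_inner_smul_left, real_inner_smul_left]
    nlinarith [mul_lt_mul_of_pos_left h2 hP, mul_lt_mul_of_pos_left h1 hu]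
  have h4 : ⟪v, e⟫ ≤ ‖v‖ := by simpa [he] using real_inner_le_norm v e
  have h5 : ‖v‖^2 = 2 * ‖P‖^2*‖u‖^2 - 2 * ‖P‖ * ‖u‖ * ⟪P, u⟫ := by
    rw [hv, norm_sub_sq_real, norm_smul, norm_smul, real_inner_smul_left, real_inner_smul_right,
      norm_norm, norm_norm, real_inner_comm]
    ring
  have h6 : (κ * (‖P‖ * ‖u‖))^2 ≤ ‖v‖^2 := by
    apply pow_le_pow_left₀ (by positivity); linarith
  have hPu : 0 < ‖P‖ * ‖u‖ := by positivity
  rw [h5] at h6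
  have : (‖P‖ * ‖u‖) * (κ^2 * (‖P‖*‖u‖)) ≤ (‖P‖ * ‖u‖) * (2 * (‖P‖*‖u‖) - 2 * ⟪P,u⟫) := by nlinarith
  have := le_of_mul_le_mul_left this hPu
  nlinarith

lemma jens {D a b η V : ℝ} (hD : 1 ≤ D) (ha : 0 ≤ a) (hb : 0 ≤ b) (hV : V = a + b) (V0 : 0 < V)
    (hη : 0 ≤ η) {M : ℝ} (hM : a + (1+η)^D * b ≤ M) :
    V + η * b ≤ M ^ (1/D) * V ^ ((D-1)/D) := by
  have hD0 : 0 < D := by linarith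
  have hc := (convexOn_rpow hD).2 (show (1:ℝ) ∈ Ici 0 by simp) (show (1+η) ∈ Ici 0 by simp; linarith)
    (show 0 ≤ a/V by positivity) (show 0 ≤ b/V by positivity) (by rw [← add_div, ← hV, div_self V0.ne'])
  simp only [smul_eq_mul, Real.one_rpow] at hc
  have e1 : a/V*1 + b/V*(1+η) = (V+η*b)/V := by rw [hV]; ring
  rw [e1] at hc
  have h2 : V * ((V+η*b)/V)^D ≤ M := by
    refine le_trans ?_ hM
    calc V * ((V+η*b)/V)^D ≤ V * (a/V*1 + b/V*(1+η)^D) := by gcongr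
      _ = _ := by field_simp
  have h3 : V^(1/D) * ((V+η*b)/V) ≤ M^(1/D) := by
    have := Real.rpow_le_rpow (by positivity) h2 (by positivity : 0 ≤ 1/D)
    rwa [Real.mul_rpow V0.le (by positivity), ← Real.rpow_mul (by positivity), mul_one_div_cancel hD0.ne',
      Real.rpow_one] at this
  calc V + η*b = (V^(1/D) * V^((D-1)/D)) * ((V+η*b)/V) := by
        rw [← Real.rpow_add V0, ← add_div, show (1 + (D-1))/D = 1 by field_simp; ring, Real.rpow_one]
        field_simp
    _ = V^(1/D) * ((V+η*b)/V) * V^((D-1)/D) := by ring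
    _ ≤ _ := by gcongr

open scoped Pointwise in
/-- R1 -/
lemma R1 (h : Ctx S α w) {E f p} (g : GS S α w E f p) {e : Euc n} (he : ‖e‖ = 1) (s : ℝ)
    {κ ι : ℝ} (hκ : 0 < κ) (hι : 0 < ι) :
    ∀ᶠ j in Filter.atTop, ((n:ℝ)+α) * VV S w - sg S α w e s - ι ≤
      ∫ x in {x | (s - κ) * ‖p j x‖ ≤ - ⟪p j x, e⟫}, ‖p j x‖ ∂(wm S w) := by
  set D := (n:ℝ) + α with hDdef
  have hD := h.D1
  have hD0 : 0 < D := by linarith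
  set m := wm S w with hm
  set η := κ^2/2 with hη
  have hη0 : 0 < η := by positivity
  set V := VV S w with hV
  have V0 : 0 < V := h.V0
  -- sets
  set B1 : Set (Euc n) := BS S ∩ {y | ⟪y, e⟫ ≤ s * ‖y‖} with hB1
  set U : Set (Euc n) := BS S ∩ {y | s * ‖y‖ < ⟪y, e⟫} with hU
  have hUo : IsOpen U := h.BSo.inter (isOpen_lt (by fun_prop) (by fun_prop))
  have mB1 : MeasurableSet B1 := h.BSo.measurableSet.inter (measurableSet_le (by fun_prop) (by fun_prop))
  have hBU : BS S = B1 ∪ U := by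
    rw [hB1, hU, ← inter_union_distrib_left]
    ext y; simp only [mem_inter_iff, mem_union, mem_setOf_eq]
    constructor
    · intro hy; exact ⟨hy, le_or_gt _ _⟩
    · intro hy; exact hy.1
  have dBU : Disjoint B1 U := by
    rw [Set.disjoint_left]; rintro y ⟨_, h1⟩ ⟨_, h2⟩
    simp only [mem_setOf_eq] at h1 h2; linarith
  set a := m.real B1 with ha
  set b := m.real U with hb
  have b1t : m B1 ≠ ⊤ := (h.wm_lt_top (h.BSb.subset inter_subset_left)).ne
  have ut : m U ≠ ⊤ := (h.wm_lt_top (h.BSb.subset inter_subset_left)).ne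
  have hab : V = a + b := by
    rw [hV, VV, hBU, measureReal_union dBU hUo.measurableSet b1t ut]
  have hsg : sg S α w e s = D * a := rfl
  set K : Set (Euc n) := BS S ∪ (1+η) • U with hK
  have hKo : IsOpen K := h.BSo.union (hUo.smul₀ (by positivity))
  have hUS : U ⊆ S := inter_subset_left.trans h.BSs
  have hUb : Bornology.IsBounded U := h.BSb.subset inter_subset_left
  have hKS : K ⊆ S := by
    apply union_subset h.BSs
    rintro _ ⟨u, hu, rfl⟩
    exact h.cone (hUS hu) (by positivity)
  have hKb : Bornology.IsBounded K := h.BSb.union (hUb.smul₀ _)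
  have hKn : K.Nonempty := h.BSn.mono subset_union_left
  have hM : a + (1+η)^D * b ≤ m.real K := by
    have hd : Disjoint B1 ((1+η) • U) := by
      rw [Set.disjoint_left]
      rintro y ⟨_, h1⟩ ⟨u, ⟨_, h2⟩, rfl⟩
      simp only [mem_setOf_eq] at h1 h2
      rw [real_inner_smul_left, norm_smul, Real.norm_of_nonneg (by positivity)] at h1
      nlinarith
    have h1 : m.real ((1+η) • U) = (1+η)^D * b := by
      rw [measureReal_def, hm, h.wm_smul hUo.measurableSet (by positivity), ENNReal.toReal_mul,
        ENNReal.toReal_ofReal (by positivity)]; rfl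
    rw [← h1, ha, ← measureReal_union hd (hUo.smul₀ (by positivity)).measurableSet b1t
      (h.wm_lt_top (hUb.smul₀ _)).ne]
    apply measureReal_mono
    · exact union_subset_union_left _ inter_subset_left
    · exact (h.wm_lt_top hKb).ne
  have hj := jens hD measureReal_nonneg measureReal_nonneg hab V0 hη0.le hM
  set X : ℕ → Set (Euc n) := fun j => {x | (s - κ) * ‖p j x‖ ≤ - ⟪p j x, e⟫} with hX
  have mX : ∀ j, MeasurableSet (X j) := fun j => by
    have := (g.tame j).pm
    exact measurableSet_le (by fun_prop) (by fun_prop)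
  have pI := h.pnorm_int g
  have hG := h.Glim g.tame hKo hKS hKb hKn (Φ := fun j x => ‖p j x‖ + η * (X j).indicator (fun x => ‖p j x‖) x)
    (fun j => (pI j).add (((pI j).indicator (mX j)).const_mul η)) (by
      intro j z hz y hy
      have hi : 0 ≤ (X j).indicator (fun x => ‖p j x‖) z := indicator_nonneg (fun _ _ => norm_nonneg _) z
      rcases hy with hy | ⟨u, hu, rfl⟩
      · have h1 : - ⟪p j z, y⟫ ≤ ‖p j z‖ * ‖y‖ := by
          rw [← inner_neg_left]; simpa using real_inner_le_norm (-p j z) y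
        have h2 : ‖y‖ ≤ 1 := by simpa using (mem_ball.1 hy.1).le
        nlinarith [norm_nonneg (p j z)]
      · have h1 : - ⟪p j z, u⟫ ≤ ‖p j z‖ * ‖u‖ := by
          rw [← inner_neg_left]; simpa using real_inner_le_norm (-p j z) u
        have h2 : ‖u‖ ≤ 1 := by simpa using (mem_ball.1 hu.1.1).le
        have h3 : ‖p j z‖ * ‖u‖ ≤ ‖p j z‖ := mul_le_of_le_one_right (norm_nonneg _) h2
        simp only [real_inner_smul_right]
        by_cases hzX : z ∈ X j
        · rw [indicator_of_mem hzX]; nlinarith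
        · have hzX' : ⟪-p j z, e⟫ < (s-κ) * ‖-p j z‖ := by
            simpa [hX, inner_neg_left] using hzX
          have := angle he hκ hzX' hu.2
          rw [norm_neg, inner_neg_left, ← hη] at this
          have h0 : 0 ≤ ‖p j z‖ * ‖u‖ := by positivity
          nlinarith)
    g.eo.measurableSet (by rw [g.ev]; exact h.Vt) (by rw [g.ev]; exact h.wm_pos h.BSo h.BSs h.BSn) g.lim
    (κ := η * ι) (by positivity)
  filter_upwards [hG] with j hGj
  rw [integral_add (pI j) (((pI j).indicator (mX j)).const_mul η), integral_const_mul,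
    integral_indicator (mX j), h.Ereal g.ev] at hGj
  have pb := g.pb j
  rw [hsg]
  have h5 : D * (V + η * b) ≤ D * (m.real K ^ (1/D) * V ^ ((D-1)/D)) := by gcongr
  have h6 : η * (D * b - ι) ≤ η * ∫ x in X j, ‖p j x‖ ∂m := by linarith
  have := le_of_mul_le_mul_left h6 hη0
  have : D * V = D * a + D * b := by rw [hab]; ring
  linarith
end Ctx

end

noncomputable section

namespace Ctx
variable {n : ℕ} {S : Set (Euc n)} {α : ℝ} {w : Euc n → ℝ}

lemma mhalf (e : Euc n) (t : ℝ) : MeasurableSet {x : Euc n | ⟪x, e⟫ < t} :=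
  measurableSet_lt (by fun_prop) (by fun_prop)

lemma thmono (h : Ctx S α w) {E : Set (Euc n)} (hE : wm S w E = wm S w (BS S)) (e : Euc n) :
    Monotone (th S w E e) := by
  intro a b hab
  apply measureReal_mono _ (h.fin hE _)
  apply inter_subset_inter_right
  intro x hx; exact lt_of_lt_of_le hx hab

lemma thnn {E : Set (Euc n)} (e : Euc n) (t : ℝ) : 0 ≤ th S w E e t := measureReal_nonneg

lemma hnull (h : Ctx S α w) {e : Euc n} (he : ‖e‖ = 1) (c : ℝ) : wm S w {x | ⟪x, e⟫ = c} = 0 :=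
  h.wm_ac (hyper_null e he c)

lemma thneg (h : Ctx S α w) {E : Set (Euc n)} (hE : wm S w E = wm S w (BS S)) {e : Euc n} (he : ‖e‖ = 1)
    (t : ℝ) : th S w E (-e) (-t) = VV S w - th S w E e t := by
  rw [← h.Ereal hE, ← measureReal_inter_add_diff (μ := wm S w) (s := E) (mhalf e t)
    (by rw [hE]; exact h.Vt)]
  unfold th
  rw [add_sub_cancel_left]
  apply measureReal_congr
  have : ∀ᵐ x ∂(wm S w), ⟪x, e⟫ ≠ t := by
    rw [ae_iff]; simpa using h.hnull he t
  filter_upwards [this] with x hx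
  apply propext
  show (x ∈ E ∧ ⟪x, -e⟫ < -t) ↔ (x ∈ E ∧ ¬ (⟪x, e⟫ < t))
  rw [inner_neg_right, neg_lt_neg_iff, not_lt]
  constructor
  · rintro ⟨a, b⟩; exact ⟨a, b.le⟩
  · rintro ⟨a, b⟩; exact ⟨a, lt_of_le_of_ne b (Ne.symm hx)⟩

lemma thcont (h : Ctx S α w) {E : Set (Euc n)} (hEm : MeasurableSet E) (hE : wm S w E = wm S w (BS S))
    {e : Euc n} (he : ‖e‖ = 1) : Continuous (th S w E e) := by
  have hfin : IsFiniteMeasure ((wm S w).restrict E) := ⟨by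
    rw [Measure.restrict_apply_univ, hE]; exact h.Vt.lt_top⟩
  have e1 : th S w E e = fun t => ∫ x in E, {x : Euc n | ⟪x, e⟫ < t}.indicator (fun _ => (1:ℝ)) x ∂(wm S w) := by
    ext t
    rw [integral_indicator (mhalf e t)]
    simp only [setIntegral_const, smul_eq_mul, mul_one]
    rw [measureReal_restrict_apply (mhalf e t), inter_comm]; rfl
  rw [e1, continuous_iff_continuousAt]
  intro t0
  apply continuousAt_of_dominated (bound := fun _ => 1)
  · exact Filter.Eventually.of_forall fun t => (measurable_const.indicator (mhalf e t)).aestronglyMeasurable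
  · refine Filter.Eventually.of_forall fun t => Filter.Eventually.of_forall fun x => ?_
    by_cases hx : x ∈ {x : Euc n | ⟪x, e⟫ < t} <;> simp [indicator, hx]
  · exact integrable_const _
  · have : ∀ᵐ x ∂(wm S w), ⟪x, e⟫ ≠ t0 := by
      rw [ae_iff]; simpa using h.hnull he t0
    filter_upwards [ae_restrict_of_ae this] with x hx
    rcases lt_or_gt_of_ne hx with hx | hx
    · apply (continuousAt_const (y := (1:ℝ))).congr
      filter_upwards [lt_mem_nhds hx] with t ht
      simp [indicator, ht]
    · apply (continuousAt_const (y := (0:ℝ))).congr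
      filter_upwards [gt_mem_nhds hx] with t ht
      simp [indicator, not_lt.2 ht.le]

lemma rmi (h : Ctx S α w) {E f p} (g : GS S α w E f p) (e : Euc n) (t : ℝ) {η : ℝ} (hη : 0 < η) (j : ℕ) :
    Integrable (fun x => f j x * rmd t η ⟪x, e⟫) (wm S w) := by
  refine (g.tame j).gi.mul_bdd (c := 1/η) ?_ (Filter.Eventually.of_forall fun x => ?_)
  · exact ((rmd_meas t η).comp (by fun_prop)).aestronglyMeasurable
  · rw [Real.norm_of_nonneg (rmd_nonneg hη _)]; exact rmd_le hη _

lemma rpi (h : Ctx S α w) {E f p} (g : GS S α w E f p) (e : Euc n) (t : ℝ) {η : ℝ} (hη : 0 < η) (j : ℕ) :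
    Integrable (fun x => rmp t η ⟪x, e⟫ * ‖p j x‖) (wm S w) := by
  refine (h.pnorm_int g j).bdd_mul (c := 1) ?_ (Filter.Eventually.of_forall fun x => ?_)
  · exact ((rmp_meas t η).comp (by fun_prop)).aestronglyMeasurable
  · rw [Real.norm_of_nonneg (rmp_nonneg _ _ _)]; exact rmp_le _ _ _

lemma angle2 {P y e : Euc n} (he : ‖e‖ = 1) {s κ' : ℝ} (hκ' : 0 ≤ κ') (hyn : ‖y‖ ≤ 1) (hy : ⟪y, e⟫ ≤ s)
    (hz1 : (s + κ') * ‖P‖ ≤ - ⟪P, e⟫) : - ⟪P, y⟫ ≤ (1 - κ'^2/2) * ‖P‖ := by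
  rcases (norm_nonneg P).eq_or_lt with hP0 | hP0
  · have : P = 0 := norm_eq_zero.1 hP0.symm
    rw [this]; simp
  have a1 : ⟪P + ‖P‖ • y, e⟫ ≤ -κ' * ‖P‖ := by
    rw [inner_add_left, real_inner_smul_left]
    nlinarith
  have a2 : -⟪P + ‖P‖ • y, e⟫ ≤ ‖P + ‖P‖ • y‖ := by
    have := real_inner_le_norm (-(P + ‖P‖ • y)) e
    rwa [he, mul_one, inner_neg_left, norm_neg] at this
  have a3 : (κ' * ‖P‖)^2 ≤ ‖P + ‖P‖ • y‖^2 := pow_le_pow_left₀ (by positivity) (by linarith) 2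
  rw [norm_add_sq_real, norm_smul, norm_norm, real_inner_smul_right] at a3
  have a4 : (‖P‖ * ‖y‖)^2 ≤ ‖P‖^2 := pow_le_pow_left₀ (by positivity) (by nlinarith) 2
  have a5 : ‖P‖ * (κ'^2 * ‖P‖) ≤ ‖P‖ * (2 * ‖P‖ + 2 * ⟪P, y⟫) := by nlinarith
  have := le_of_mul_le_mul_left a5 hP0
  linarith

/-- the cut lemma -/
lemma cut (h : Ctx S α w) {E f p} (g : GS S α w E f p) {e : Euc n} (he : ‖e‖ = 1) {t η s κ' κ : ℝ}
    (hη : 0 < η) (hκ' : 0 ≤ κ') (hκ : 0 < κ) (hs : 0 < th S w (BS S) e s) (hA : 0 < th S w E e t) :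
    ∀ᶠ j in Filter.atTop, ((n:ℝ)+α) * th S w (BS S) e s ^ (1/((n:ℝ)+α)) *
      th S w E e t ^ (((n:ℝ)+α-1)/((n:ℝ)+α)) - κ ≤
      ∫ x, rmp t η ⟪x, e⟫ * ‖p j x‖ ∂(wm S w) + s * ∫ x, f j x * rmd t η ⟪x, e⟫ ∂(wm S w)
       - κ'^2/2 * ∫ x in {x | (s + κ') * ‖p j x‖ ≤ - ⟪p j x, e⟫ ∧ ⟪x, e⟫ < t}, ‖p j x‖ ∂(wm S w) := by
  set D := (n:ℝ) + α with hDdef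
  set m := wm S w with hm
  set X : ℕ → Set (Euc n) := fun j => {x | (s + κ') * ‖p j x‖ ≤ - ⟪p j x, e⟫ ∧ ⟪x, e⟫ < t} with hX
  have mX : ∀ j, MeasurableSet (X j) := fun j => by
    have := (g.tame j).pm
    have h1 : MeasurableSet {x | (s + κ') * ‖p j x‖ ≤ - ⟪p j x, e⟫} := measurableSet_le (by fun_prop) (by fun_prop)
    exact h1.inter (mhalf e t)
  set K := BS S ∩ {y | ⟪y, e⟫ < s} with hK
  have hKo : IsOpen K := h.BSo.inter (isOpen_lt (by fun_prop) (by fun_prop))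
  have hKn : K.Nonempty := by
    rw [nonempty_iff_ne_empty]; intro h0
    have : th S w (BS S) e s = 0 := by
      show m.real K = 0
      rw [h0]; simp
    linarith
  have mA : MeasurableSet (E ∩ {x | ⟪x, e⟫ < t}) := g.eo.measurableSet.inter (mhalf e t)
  have pI := h.pnorm_int g
  have I1 := h.rpi g e t hη
  have I2 := h.rmi g e t hη
  have I3 : ∀ j, Integrable (fun x => κ'^2/2 * (X j).indicator (fun x => ‖p j x‖) x) m :=
    fun j => ((pI j).indicator (mX j)).const_mul _
  have A0 : wm S w (E ∩ {x | ⟪x, e⟫ < t}) ≠ 0 := fun h0 => by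
      have : th S w E e t = 0 := by show (wm S w (E ∩ {x | ⟪x, e⟫ < t})).toReal = 0; rw [h0]; rfl
      linarith
  have HL : ∀ x ∈ E ∩ {x | ⟪x, e⟫ < t}, Filter.Tendsto (fun j => f j x * rmp t η ⟪x, e⟫) Filter.atTop (𝓝 1) := by
      rintro x ⟨hxE, hxt⟩
      simp only [rmp_one hη (le_of_lt hxt), mul_one]
      exact g.lim x hxE
  have HH : ∀ j, ∀ z ∈ S, ∀ y ∈ K, - ⟪rmp t η ⟪z, e⟫ • p j z - (f j z * rmd t η ⟪z, e⟫) • e, y⟫ ≤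
      rmp t η ⟪z, e⟫ * ‖p j z‖ + s * (f j z * rmd t η ⟪z, e⟫) -
      κ'^2/2 * (X j).indicator (fun x => ‖p j x‖) z := by
      intro j z hz y hy
      have hyn : ‖y‖ ≤ 1 := by simpa using (mem_ball.1 hy.1.1).le
      have hys : ⟪e, y⟫ ≤ s := by rw [real_inner_comm]; exact le_of_lt hy.2
      have f0 : 0 ≤ f j z * rmd t η ⟪z, e⟫ := mul_nonneg ((g.tame j).g0 z) (rmd_nonneg hη _)
      have h1 : - ⟪p j z, y⟫ ≤ ‖p j z‖ := by
        have : - ⟪p j z, y⟫ ≤ ‖p j z‖ * ‖y‖ := by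
          have := real_inner_le_norm (-p j z) y
          rwa [inner_neg_left, norm_neg] at this
        exact this.trans (mul_le_of_le_one_right (norm_nonneg _) hyn)
      rw [inner_sub_left, real_inner_smul_left, real_inner_smul_left]
      have h3 : f j z * rmd t η ⟪z, e⟫ * ⟪e, y⟫ ≤ f j z * rmd t η ⟪z, e⟫ * s :=
        mul_le_mul_of_nonneg_left hys f0
      by_cases hzX : z ∈ X j
      · rw [indicator_of_mem hzX, rmp_one hη (le_of_lt hzX.2)]
        have h4 : - ⟪p j z, y⟫ ≤ (1 - κ'^2/2) * ‖p j z‖ := angle2 he hκ' hyn (le_of_lt hy.2) hzX.1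
        linarith
      · rw [indicator_of_notMem hzX]
        have h5 := mul_le_mul_of_nonneg_left h1 (rmp_nonneg t η ⟪z, e⟫)
        linarith
  have HI : ∀ j, Integrable (fun x => rmp t η ⟪x, e⟫ * ‖p j x‖ + s * (f j x * rmd t η ⟪x, e⟫) -
      κ'^2/2 * (X j).indicator (fun x => ‖p j x‖) x) m := fun j => ((I1 j).add ((I2 j).const_mul s)).sub (I3 j)
  have hG := h.Glim (fun j => h.tame_ramp (g.tame j) he (t := t) hη) hKo (inter_subset_left.trans h.BSs)
    (h.BSb.subset inter_subset_left) hKn HI HH mA (h.fin g.ev _) A0 HL hκ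
  filter_upwards [hG] with j hGj
  have e1 : ∫ x, (rmp t η ⟪x, e⟫ * ‖p j x‖ + s * (f j x * rmd t η ⟪x, e⟫) -
      κ'^2/2 * (X j).indicator (fun x => ‖p j x‖) x) ∂m = ∫ x, rmp t η ⟪x, e⟫ * ‖p j x‖ ∂m +
      s * ∫ x, f j x * rmd t η ⟪x, e⟫ ∂m - κ'^2/2 * ∫ x in X j, ‖p j x‖ ∂m := by
    rw [integral_sub (by exact (I1 j).add ((I2 j).const_mul s)) (I3 j), integral_add (I1 j) ((I2 j).const_mul s),
      integral_const_mul, integral_const_mul, integral_indicator (mX j)]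
  rw [e1] at hGj
  exact hGj

lemma rpow_id {D a : ℝ} (hD : 0 < D) (ha : 0 < a) : a^(1/D) * a^((D-1)/D) = a := by
  rw [← Real.rpow_add ha, ← add_div, show (1 + (D-1))/D = 1 by field_simp; ring, Real.rpow_one]

/-- complementary cut -/
lemma rp_sum (h : Ctx S α w) {E f p} (g : GS S α w E f p) (e : Euc n) (t : ℝ) {η : ℝ} (hη : 0 < η) (j : ℕ) :
    ∫ x, rmp t η ⟪x, e⟫ * ‖p j x‖ ∂(wm S w) + ∫ x, rmp (-t-η) η ⟪x, -e⟫ * ‖p j x‖ ∂(wm S w) ≤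
      ((n:ℝ)+α) * VV S w := by
  rw [← integral_add (h.rpi g e t hη j) (h.rpi g (-e) (-t-η) hη j)]
  refine le_trans (le_of_eq ?_) (g.pb j)
  congr 1; ext x
  rw [inner_neg_right, rmp_symm hη]; ring

lemma R2 (h : Ctx S α w) {E f p} (g : GS S α w E f p) {e : Euc n} (he : ‖e‖ = 1) {t s κ' ι : ℝ}
    (hκ' : 0 < κ') (hι : 0 < ι) (hs : th S w (BS S) e s = th S w E e t) (h0 : 0 < th S w E e t)
    (h1 : th S w E e t < VV S w) :
    ∀ᶠ j in Filter.atTop,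
      ∫ x in {x | (s + κ') * ‖p j x‖ ≤ - ⟪p j x, e⟫ ∧ ⟪x, e⟫ < t}, ‖p j x‖ ∂(wm S w) ≤ ι := by
  set D := (n:ℝ) + α with hDdef
  have hD := h.D1
  have hD0 : 0 < D := by linarith
  set m := wm S w with hm
  have he' : ‖-e‖ = 1 := by rwa [norm_neg]
  set V := VV S w with hV
  set v := th S w E e t with hv
  set c := κ'^2/2 with hc
  have c0 : 0 < c := by positivity
  -- choose η
  have hcont : Filter.Tendsto (fun η => D * (V - v)^(1/D) * (V - th S w E e (t+η)) ^ ((D-1)/D)) (𝓝[>] 0)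
      (𝓝 (D * (V - v))) := by
    have e1 : D * (V - v) = D * (V - v)^(1/D) * (V - th S w E e (t+0)) ^ ((D-1)/D) := by
      rw [add_zero, mul_assoc, rpow_id hD0 (by linarith)]
    rw [e1]
    apply Filter.Tendsto.mono_left _ nhdsWithin_le_nhds
    apply ContinuousAt.tendsto (f := fun η => D * (V - v)^(1/D) * (V - th S w E e (t+η)) ^ ((D-1)/D))
    have := (h.thcont g.eo.measurableSet g.ev he)
    refine continuousAt_const.mul (ContinuousAt.rpow_const ?_ (Or.inr (div_nonneg (by linarith) hD0.le)))
    exact (continuous_const.sub (this.comp (continuous_const.add continuous_id))).continuousAt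
  have hth : Filter.Tendsto (fun η => th S w E e (t+η)) (𝓝[>] 0) (𝓝 v) := by
    have := (h.thcont g.eo.measurableSet g.ev he)
    have h2 : ContinuousAt (fun η => th S w E e (t+η)) 0 :=
      (this.comp (continuous_const.add continuous_id)).continuousAt
    have := h2.tendsto.mono_left (nhdsWithin_le_nhds (s := Ioi 0))
    simpa using this
  obtain ⟨η, ⟨hη1, hη2⟩, hη⟩ := (((hcont.eventually (lt_mem_nhds (show D * (V-v) - c*ι/3 < D*(V-v) by
    have : 0 < c * ι := by positivity
    linarith))).and (hth.eventually (gt_mem_nhds h1))).and self_mem_nhdsWithin).exists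
  have hη : 0 < η := hη
  have hG1 : th S w (BS S) (-e) (-s) = V - v := by rw [h.thneg rfl he, hs]
  have hG2 : th S w E (-e) (-t-η) = V - th S w E e (t+η) := by
    rw [← h.thneg g.ev he]; congr 1; ring
  have q1 := h.cut g he (t := t) (s := s) hη hκ'.le (show 0 < c * ι / 3 by positivity) (by rw [hs]; exact h0) h0
  have q2 := h.cut g he' (t := -t-η) (s := -s) hη le_rfl (show 0 < c * ι / 3 by positivity)
    (by rw [hG1]; linarith) (by rw [hG2]; linarith)
  filter_upwards [q1, q2] with j h1 h2
  have h3 := h.rp_sum g e t hη j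
  have e2 : ∫ x, f j x * rmd (-t-η) η ⟪x, -e⟫ ∂m = ∫ x, f j x * rmd t η ⟪x, e⟫ ∂m := by
    congr 1; ext x; rw [inner_neg_right, rmd_symm]
  rw [e2, hG1, hG2] at h2
  rw [hs, mul_assoc, rpow_id hD0 h0] at h1
  have : c * ∫ x in {x | (s + κ') * ‖p j x‖ ≤ - ⟪p j x, e⟫ ∧ ⟪x, e⟫ < t}, ‖p j x‖ ∂m ≤ c * ι := by
    simp only [ne_eq, OfNat.ofNat_ne_zero, not_false_eq_true, zero_pow, zero_div, zero_mul, sub_zero] at h2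
    simp only [← hDdef, ← hm, ← hV, ← hc] at h1 h2 h3 ⊢
    linarith
  exact le_of_mul_le_mul_left this c0

lemma R3 (h : Ctx S α w) {E f p} (g : GS S α w E f p) {e : Euc n} (he : ‖e‖ = 1) {t s s' ι : ℝ}
    (hss : s < s') (hι : 0 < ι) (hs : th S w (BS S) e s = th S w E e t) (h0 : 0 < th S w E e t)
    (h1 : th S w E e t < VV S w) :
    ∀ᶠ j in Filter.atTop,
      ∫ x in {x | ⟪x, e⟫ < t}, ‖p j x‖ ∂(wm S w) ≤ sg S α w e s' + ι := by
  set m := wm S w with hm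
  set k := (s'-s)/2 with hk
  have k0 : 0 < k := by rw [hk]; linarith
  filter_upwards [h.R2 g he k0 (half_pos hι) hs h0 h1, h.R1 g he s' k0 (half_pos hι)] with j q1 q2
  have e1 : s' - k = s + k := by rw [hk]; ring
  rw [e1] at q2
  set Z := {x | (s + k) * ‖p j x‖ ≤ -⟪p j x, e⟫} with hZ
  have mZ : MeasurableSet Z := by
    have := (g.tame j).pm
    exact measurableSet_le (by fun_prop) (by fun_prop)
  have pI := h.pnorm_int g j
  have a1 := integral_inter_add_sdiff (s := {x | ⟪x, e⟫ < t}) mZ (pI.integrableOn (s := {x | ⟪x, e⟫ < t}))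
  have a2 := integral_add_compl mZ pI
  have a3 : ∫ x in {x | ⟪x, e⟫ < t} \ Z, ‖p j x‖ ∂m ≤ ∫ x in Zᶜ, ‖p j x‖ ∂m :=
    setIntegral_mono_set pI.integrableOn (Filter.Eventually.of_forall fun _ => norm_nonneg _)
      (Filter.Eventually.of_forall (fun x hx => hx.2))
  have a4 : {x | (s + k) * ‖p j x‖ ≤ - ⟪p j x, e⟫ ∧ ⟪x, e⟫ < t} = {x | ⟪x, e⟫ < t} ∩ Z := by
    ext x; exact and_comm
  rw [a4] at q1
  have := g.pb j
  linarith

lemma rmd_int (h : Ctx S α w) {E f p} (g : GS S α w E f p) {e : Euc n} (he : ‖e‖ = 1) (t : ℝ) {η : ℝ}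
    (hη : 0 < η) : ∫ x in E, rmd t η ⟪x, e⟫ ∂(wm S w) = (th S w E e (t+η) - th S w E e t)/η := by
  have m1 : MeasurableSet {x : Euc n | ⟪x, e⟫ ∈ Ioo t (t+η)} :=
    (measurable_id.inner measurable_const) measurableSet_Ioo
  have e1 : ∀ x : Euc n, rmd t η ⟪x, e⟫ = {x : Euc n | ⟪x, e⟫ ∈ Ioo t (t+η)}.indicator (fun _ => 1/η) x := by
    intro x; rfl
  simp_rw [e1]
  rw [integral_indicator m1]
  simp only [setIntegral_const, smul_eq_mul]
  rw [measureReal_restrict_apply m1]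
  have e2 : th S w E e (t+η) = th S w E e t + (wm S w).real ({x | ⟪x, e⟫ ∈ Ioo t (t+η)} ∩ E) := by
    unfold th
    rw [← measureReal_inter_add_diff (μ := wm S w) (s := E ∩ {x | ⟪x, e⟫ < t+η}) (mhalf e t) (h.fin g.ev _)]
    congr 1
    · congr 1; ext x; simp only [mem_inter_iff, mem_setOf_eq]
      constructor
      · rintro ⟨⟨a, b⟩, c⟩; exact ⟨a, c⟩
      · rintro ⟨a, b⟩; exact ⟨⟨a, by linarith⟩, b⟩
    · apply measureReal_congr
      have : ∀ᵐ x ∂(wm S w), ⟪x, e⟫ ≠ t := by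
        rw [ae_iff]; simpa using h.hnull he t
      filter_upwards [this] with x hx
      apply propext
      show ((x ∈ E ∧ ⟪x, e⟫ < t+η) ∧ ¬ (⟪x, e⟫ < t)) ↔ ((t < ⟪x, e⟫ ∧ ⟪x,e⟫ < t+η) ∧ x ∈ E)
      rw [not_lt]
      constructor
      · rintro ⟨⟨a, b⟩, c⟩; exact ⟨⟨lt_of_le_of_ne c (Ne.symm hx), b⟩, a⟩
      · rintro ⟨⟨a, b⟩, c⟩; exact ⟨⟨c, b⟩, a.le⟩
  rw [e2]; field_simp; ring

lemma rmd_lim (h : Ctx S α w) {E f p} (g : GS S α w E f p) {e : Euc n} (he : ‖e‖ = 1) (t : ℝ) {η : ℝ}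
    (hη : 0 < η) : Filter.Tendsto (fun j => ∫ x, f j x * rmd t η ⟪x, e⟫ ∂(wm S w)) Filter.atTop
      (𝓝 ((th S w E e (t+η) - th S w E e t)/η)) := by
  rw [← h.rmd_int g he t hη]
  apply h.conv g (C := 1/η)
  · exact (rmd_meas t η).comp (by fun_prop)
  · intro x; rw [abs_of_nonneg (rmd_nonneg hη _)]; exact rmd_le hη _

lemma sg_rc (h : Ctx S α w) (e : Euc n) {s a : ℝ} (ha : ∀ s' > s, a ≤ sg S α w e s') : a ≤ sg S α w e s := by
  have hD := h.D1
  have hD0 : 0 < (n:ℝ)+α := by linarith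
  have key : Filter.Tendsto (fun k : ℕ => wm S w (BS S ∩ {y | ⟪y, e⟫ ≤ (s + 1/((k:ℝ)+1)) * ‖y‖})) Filter.atTop
      (𝓝 (wm S w (⋂ k : ℕ, BS S ∩ {y | ⟪y, e⟫ ≤ (s + 1/((k:ℝ)+1)) * ‖y‖}))) := by
    apply tendsto_measure_iInter_atTop
    · intro k
      exact (h.BSo.measurableSet.inter (measurableSet_le (by fun_prop) (by fun_prop))).nullMeasurableSet
    · intro a b hab
      apply inter_subset_inter_right
      intro y hy
      refine le_trans hy (mul_le_mul_of_nonneg_right ?_ (norm_nonneg _))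
      have : 1/((b:ℝ)+1) ≤ 1/((a:ℝ)+1) := one_div_le_one_div_of_le (by positivity) (by
        have : (a:ℝ) ≤ b := by exact_mod_cast hab
        linarith)
      linarith
    · exact ⟨0, h.fin rfl _⟩
  have e1 : (⋂ k : ℕ, BS S ∩ {y | ⟪y, e⟫ ≤ (s + 1/((k:ℝ)+1)) * ‖y‖}) = BS S ∩ {y | ⟪y, e⟫ ≤ s * ‖y‖} := by
    ext y
    simp only [mem_iInter, mem_inter_iff, mem_setOf_eq]
    constructor
    · intro hy
      refine ⟨(hy 0).1, ?_⟩
      have : Filter.Tendsto (fun k : ℕ => (s + 1/((k:ℝ)+1)) * ‖y‖) Filter.atTop (𝓝 ((s+0)*‖y‖)) :=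
        (tendsto_const_nhds.add tendsto_one_div_add_atTop_nhds_zero_nat).mul_const _
      rw [add_zero] at this
      exact ge_of_tendsto' this fun k => (hy k).2
    · intro hy k
      refine ⟨hy.1, hy.2.trans (mul_le_mul_of_nonneg_right ?_ (norm_nonneg _))⟩
      have : 0 < 1/((k:ℝ)+1) := by positivity
      linarith
  rw [e1] at key
  have k2 := ((ENNReal.tendsto_toReal (h.fin rfl _)).comp key).const_mul ((n:ℝ)+α)
  refine ge_of_tendsto' k2 fun k => ?_
  apply ha
  have : 0 < 1/((k:ℝ)+1) := by positivity
  linarith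

lemma I1 (h : Ctx S α w) {E f p} (g : GS S α w E f p) {e : Euc n} (he : ‖e‖ = 1) {t1 t2 s1 s2 : ℝ}
    (ht : t1 < t2) (hs1 : th S w (BS S) e s1 = th S w E e t1) (hs2 : th S w (BS S) e s2 = th S w E e t2)
    (h0 : 0 < th S w E e t1) (h1 : th S w E e t2 < VV S w) :
    ((n:ℝ)+α) * th S w E e t1 ≤ sg S α w e s2 + s1 * ((th S w E e t2 - th S w E e t1)/(t2-t1)) := by
  set D := (n:ℝ) + α with hDdef
  have hD := h.D1
  have hD0 : 0 < D := by linarith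
  set m := wm S w with hm
  have hη : 0 < t2 - t1 := by linarith
  have hmono := h.thmono g.ev e ht.le
  suffices D * th S w E e t1 - s1 * ((th S w E e t2 - th S w E e t1)/(t2-t1)) ≤ sg S α w e s2 by linarith
  apply h.sg_rc e
  intro s' hs'
  apply le_of_forall_pos_le_add
  intro ι hι
  have L := (h.rmd_lim g he t1 hη).const_mul s1
  rw [show t1 + (t2 - t1) = t2 by ring] at L
  have q1 := h.cut g he (t := t1) (s := s1) hη le_rfl (show 0 < ι/3 by positivity) (by rw [hs1]; exact h0) h0
  have q2 := h.R3 g he hs' (show 0 < ι/3 by positivity) hs2 (by linarith) h1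
  obtain ⟨j, h2, h3, h4⟩ := (q1.and (q2.and (L.eventually (gt_mem_nhds (lt_add_of_pos_right _ (show 0 < ι/3 by positivity)))))).exists
  rw [hs1, mul_assoc, rpow_id hD0 h0] at h2
  simp only [ne_eq, OfNat.ofNat_ne_zero, not_false_eq_true, zero_pow, zero_div, zero_mul, sub_zero] at h2
  have h5 : ∫ x, rmp t1 (t2-t1) ⟪x, e⟫ * ‖p j x‖ ∂m ≤ ∫ x in {x | ⟪x, e⟫ < t2}, ‖p j x‖ ∂m := by
    rw [← integral_indicator (mhalf e t2)]
    apply integral_mono (h.rpi g e t1 hη j) ((h.pnorm_int g j).indicator (mhalf e t2))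
    intro x
    by_cases hx : ⟪x, e⟫ < t2
    · simp only [indicator, mem_setOf_eq, hx, if_true]
      exact mul_le_of_le_one_left (norm_nonneg _) (rmp_le _ _ _)
    · simp only [indicator, mem_setOf_eq, hx, if_false]
      rw [rmp_zero hη (by linarith), zero_mul]
  simp only [← hDdef, ← hm] at h2 h3 h4 h5 ⊢
  linarith

lemma sgneg (h : Ctx S α w) (e : Euc n) (s : ℝ) :
    sg S α w (-e) (-s) = ((n:ℝ)+α) * VV S w - sgm S α w e s := by
  have : VV S w = (wm S w).real (BS S ∩ {y | ⟪y, e⟫ < s * ‖y‖}) + (wm S w).real (BS S \ {y | ⟪y, e⟫ < s * ‖y‖}) :=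
    (measureReal_inter_add_diff (μ := wm S w) (s := BS S) (measurableSet_lt (by fun_prop) (by fun_prop)) h.Vt).symm
  have e1 : BS S ∩ {y | ⟪y, -e⟫ ≤ -s * ‖y‖} = BS S \ {y | ⟪y, e⟫ < s * ‖y‖} := by
    ext y; simp [inner_neg_right, not_lt]
  unfold sg sgm
  rw [this, e1]; ring

lemma I2 (h : Ctx S α w) {E f p} (g : GS S α w E f p) {e : Euc n} (he : ‖e‖ = 1) {t1 t2 s1 s2 : ℝ}
    (ht : t1 < t2) (hs1 : th S w (BS S) e s1 = th S w E e t1) (hs2 : th S w (BS S) e s2 = th S w E e t2)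
    (h0 : 0 < th S w E e t1) (h1 : th S w E e t2 < VV S w) :
    s2 * ((th S w E e t2 - th S w E e t1)/(t2-t1)) ≤ ((n:ℝ)+α) * th S w E e t2 - sgm S α w e s1 := by
  have he' : ‖-e‖ = 1 := by rwa [norm_neg]
  have := h.I1 g he' (t1 := -t2) (t2 := -t1) (s1 := -s2) (s2 := -s1) (by linarith)
    (by rw [h.thneg rfl he, h.thneg g.ev he, hs2]) (by rw [h.thneg rfl he, h.thneg g.ev he, hs1])
    (by rw [h.thneg g.ev he]; linarith) (by rw [h.thneg g.ev he]; linarith)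
  rw [h.thneg g.ev he, h.thneg g.ev he, h.sgneg] at this
  have e1 : (VV S w - th S w E e t1 - (VV S w - th S w E e t2)) / (-t1 - -t2) =
    (th S w E e t2 - th S w E e t1)/(t2-t1) := by congr 1 <;> ring
  rw [e1] at this
  linarith

lemma th_one (h : Ctx S α w) {e : Euc n} (he : ‖e‖ = 1) : th S w (BS S) e 1 = VV S w := by
  unfold th VV
  congr 1
  apply inter_eq_left.2
  intro y hy
  have h1 : ‖y‖ < 1 := by simpa using hy.1
  have := real_inner_le_norm y e
  rw [he, mul_one] at this
  exact lt_of_le_of_lt this h1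

lemma NG (h : Ctx S α w) {E f p} (g : GS S α w E f p) {e : Euc n} (he : ‖e‖ = 1) {t1 t2 : ℝ}
    (ht : t1 < t2) (h0 : 0 < th S w E e t1) (h1 : th S w E e t2 < VV S w) :
    th S w E e t1 < th S w E e t2 := by
  refine lt_of_le_of_ne (h.thmono g.ev e ht.le) fun heq => ?_
  set D := (n:ℝ) + α with hDdef
  have hD := h.Dlt
  have hD0 : 0 < D := by linarith
  have he' : ‖-e‖ = 1 := by rwa [norm_neg]
  set V := VV S w with hV
  set v := th S w E e t1 with hv
  have V0 : 0 < V := h.V0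
  have hη : 0 < t2 - t1 := by linarith
  have key : ∀ v, 0 < v → v < V → v < V^(1/D) * v ^((D-1)/D) := by
    intro v v0 v1
    calc v = v^(1/D) * v^((D-1)/D) := (rpow_id hD0 v0).symm
      _ < _ := by
        apply mul_lt_mul_of_pos_right _ (by positivity)
        exact Real.rpow_lt_rpow v0.le v1 (by positivity)
  have k1 := key v h0 (by linarith)
  have k2 := key (V - v) (by linarith) (by linarith)
  set κ := (D * (V^(1/D) * v ^((D-1)/D)) + D * (V^(1/D) * (V-v) ^((D-1)/D)) - D * V)/4 with hκ
  have κ0 : 0 < κ := by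
    have := mul_lt_mul_of_pos_left (add_lt_add k1 k2) hD0
    rw [hκ]; linarith
  have e2 : th S w E (-e) (-t1-(t2-t1)) = V - v := by
    rw [show -t1-(t2-t1) = -t2 by ring, h.thneg g.ev he, ← heq]
  have q1 := h.cut g he (t := t1) (s := 1) hη le_rfl κ0 (by rw [h.th_one he]; exact V0) h0
  have q2 := h.cut g he' (t := -t1-(t2-t1)) (s := 1) hη le_rfl κ0 (by rw [h.th_one he']; exact V0)
    (by rw [e2]; linarith)
  have L := h.rmd_lim g he t1 hη
  rw [show t1 + (t2 - t1) = t2 by ring, ← heq, hv, sub_self, zero_div] at L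
  obtain ⟨j, h2, h3, h4⟩ := (q1.and (q2.and (L.eventually (gt_mem_nhds (show 0 < κ/2 by linarith))))).exists
  have h5 := h.rp_sum g e t1 hη j
  have e3 : ∫ x, f j x * rmd (-t1-(t2-t1)) (t2-t1) ⟪x, -e⟫ ∂(wm S w) = ∫ x, f j x * rmd t1 (t2-t1) ⟪x, e⟫ ∂(wm S w) := by
    congr 1; ext x; rw [inner_neg_right, rmd_symm]
  rw [e3, e2, h.th_one he'] at h3
  rw [h.th_one he] at h2
  simp only [ne_eq, OfNat.ofNat_ne_zero, not_false_eq_true, zero_pow, zero_div, zero_mul, sub_zero] at h2 h3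
  rw [mul_assoc] at h2 h3
  simp only [← hDdef, ← hV] at h2 h3 h5
  linarith
end Ctx

end

noncomputable section

namespace Ctx
variable {n : ℕ} {S : Set (Euc n)} {α : ℝ} {w : Euc n → ℝ}

lemma cone_null {e : Euc n} (he : ‖e‖ = 1) {s : ℝ} (h0 : 0 ≤ s) (h1 : s < 1) :
    volume {y : Euc n | ⟪y, e⟫ = s * ‖y‖} = 0 := by
  set C : Set (Euc n) := {y | s * ‖y‖ ≤ ⟪y, e⟫} with hC
  have hconv : Convex ℝ C := by
    have := (ConvexOn.smul h0 (convexOn_univ_norm (E := Euc n)))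
    have h2 : ConvexOn ℝ univ (fun y : Euc n => s * ‖y‖ - ⟪y, e⟫) := by
      apply ConvexOn.sub this
      exact (LinearMap.concaveOn (innerₛₗ ℝ e) convex_univ).congr (fun y _ => by simp [real_inner_comm])
    have h3 := h2.convex_le 0
    convert h3 using 1
    ext y; simp [hC]
  refine measure_mono_null ?_ (hconv.addHaar_frontier volume)
  intro y hy
  have hy' : ⟪y, e⟫ = s * ‖y‖ := hy
  refine ⟨subset_closure (by rw [hC]; exact hy'.ge), fun hinq => ?_⟩
  have hcont : ContinuousAt (fun ε : ℝ => y - ε • e) 0 := by fun_prop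
  have : ∀ᶠ ε in 𝓝[>] (0:ℝ), y - ε • e ∈ C := by
    apply nhdsWithin_le_nhds
    apply hcont
    simp only [zero_smul, sub_zero]
    exact mem_interior_iff_mem_nhds.1 hinq
  obtain ⟨ε, hε, hε0⟩ := (this.and self_mem_nhdsWithin).exists
  have hε0 : 0 < ε := hε0
  have q : s * ‖y - ε • e‖ ≤ ⟪y - ε • e, e⟫ := hε
  rw [inner_sub_left, real_inner_smul_left, real_inner_self_eq_norm_sq, he, hy'] at q
  have : ‖y‖ - ε ≤ ‖y - ε • e‖ := by
    have := norm_sub_norm_le y (ε • e)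
    rwa [norm_smul, he, mul_one, Real.norm_of_nonneg hε0.le] at this
  nlinarith

lemma sg_contAt (h : Ctx S α w) {e : Euc n} (he : ‖e‖ = 1) {s : ℝ} (h0 : 0 ≤ s) (h1 : s < 1) :
    ContinuousAt (sg S α w e) s := by
  have mm : ∀ t : ℝ, MeasurableSet {y : Euc n | ⟪y, e⟫ ≤ t * ‖y‖} := fun t =>
    measurableSet_le (by fun_prop) (by fun_prop)
  have hfin : IsFiniteMeasure ((wm S w).restrict (BS S)) := ⟨by
    rw [Measure.restrict_apply_univ]; exact h.Vt.lt_top⟩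
  have e1 : sg S α w e = fun t => ((n:ℝ)+α) *
      ∫ x in BS S, {y : Euc n | ⟪y, e⟫ ≤ t * ‖y‖}.indicator (fun _ => (1:ℝ)) x ∂(wm S w) := by
    ext t
    rw [integral_indicator (mm t)]
    simp only [setIntegral_const, smul_eq_mul, mul_one]
    rw [measureReal_restrict_apply (mm t), inter_comm]; rfl
  rw [e1]
  apply ContinuousAt.mul continuousAt_const
  apply continuousAt_of_dominated (bound := fun _ => 1)
  · exact Filter.Eventually.of_forall fun t => (measurable_const.indicator (mm t)).aestronglyMeasurable
  · refine Filter.Eventually.of_forall fun t => Filter.Eventually.of_forall fun x => ?_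
    by_cases hx : x ∈ {y : Euc n | ⟪y, e⟫ ≤ t * ‖y‖} <;> simp [indicator, hx]
  · exact integrable_const _
  · have : ∀ᵐ x ∂(wm S w), ⟪x, e⟫ ≠ s * ‖x‖ := by
      rw [ae_iff]; simpa using h.wm_ac (cone_null he h0 h1)
    filter_upwards [ae_restrict_of_ae this] with x hx
    have hc : ContinuousAt (fun t : ℝ => t * ‖x‖) s := by fun_prop
    rcases lt_or_gt_of_ne hx with hx | hx
    · apply (continuousAt_const (y := (1:ℝ))).congr
      filter_upwards [hc.eventually (lt_mem_nhds hx)] with t ht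
      simp [indicator, ht.le]
    · apply (continuousAt_const (y := (0:ℝ))).congr
      filter_upwards [hc.eventually (gt_mem_nhds hx)] with t ht
      simp [indicator, not_le.2 ht]

lemma sgm_eq (h : Ctx S α w) {e : Euc n} (he : ‖e‖ = 1) {s : ℝ} (h0 : 0 ≤ s) (h1 : s < 1) :
    sgm S α w e s = sg S α w e s := by
  unfold sgm sg
  congr 1
  apply measureReal_congr
  have : ∀ᵐ x ∂(wm S w), ⟪x, e⟫ ≠ s * ‖x‖ := by
    rw [ae_iff]; simpa using h.wm_ac (cone_null he h0 h1)
  filter_upwards [this] with x hx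
  apply propext
  show (x ∈ BS S ∧ ⟪x, e⟫ < s * ‖x‖) ↔ (x ∈ BS S ∧ ⟪x, e⟫ ≤ s * ‖x‖)
  rw [lt_iff_le_and_ne]; tauto

lemma Gsig (h : Ctx S α w) {e : Euc n} (he : ‖e‖ = 1) {s : ℝ} (h0 : 0 < s)
    (h1 : th S w (BS S) e s < VV S w) : 0 < ((n:ℝ)+α) * th S w (BS S) e s - sg S α w e s := by
  have hD : 0 < (n:ℝ)+α := by linarith [h.D1]
  suffices hs : (wm S w).real (BS S ∩ {y | ⟪y, e⟫ ≤ s * ‖y‖}) < th S w (BS S) e s by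
    unfold sg; nlinarith
  have h2 : 0 < th S w (BS S) (-e) (-s) := by rw [h.thneg rfl he]; linarith
  have hne : (BS S ∩ {x | ⟪x, -e⟫ < -s}).Nonempty := by
    rw [nonempty_iff_ne_empty]; intro h0
    unfold th at h2; rw [h0] at h2; simp at h2
  obtain ⟨y, hy, hys⟩ := hne
  have hys : s < ⟪y, e⟫ := by simpa [inner_neg_right] using hys
  have hyn : ‖y‖ < 1 := by simpa using hy.1
  set l := s / (2 * ⟪y, e⟫) with hl
  have l0 : 0 < l := by rw [hl]; apply div_pos h0; linarith
  have l1 : l < 1 := by rw [hl, div_lt_one (by linarith)]; linarith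
  set U := BS S ∩ ({z | s * ‖z‖ < ⟪z, e⟫} ∩ {z | ⟪z, e⟫ < s}) with hU
  have hUo : IsOpen U := h.BSo.inter ((isOpen_lt (by fun_prop) (by fun_prop)).inter (isOpen_lt (by fun_prop) (by fun_prop)))
  have hUn : U.Nonempty := by
    refine ⟨l • y, ⟨?_, h.cone hy.2 l0⟩, ?_, ?_⟩
    · rw [mem_ball_zero_iff, norm_smul, Real.norm_of_nonneg l0.le]; nlinarith [norm_nonneg y]
    · show s * ‖l • y‖ < ⟪l • y, e⟫
      rw [norm_smul, Real.norm_of_nonneg l0.le, real_inner_smul_left]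
      have : s * ‖y‖ < ⟪y, e⟫ := by nlinarith [norm_nonneg y]
      nlinarith
    · show ⟪l • y, e⟫ < s
      rw [real_inner_smul_left, hl]
      have : ⟪y, e⟫ ≠ 0 := by linarith
      field_simp; linarith
  have hUp : 0 < (wm S w).real U := ENNReal.toReal_pos (h.wm_pos hUo (inter_subset_left.trans h.BSs) hUn) (h.fin rfl _)
  have hd : Disjoint (BS S ∩ {y | ⟪y, e⟫ ≤ s * ‖y‖}) U := by
    rw [Set.disjoint_left]; rintro z ⟨_, a⟩ ⟨_, b, _⟩
    simp only [mem_setOf_eq] at a b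
    linarith
  have := measureReal_union hd hUo.measurableSet (μ := wm S w) (h.fin rfl _) (h.fin rfl _)
  have h5 : (wm S w).real ((BS S ∩ {y | ⟪y, e⟫ ≤ s * ‖y‖}) ∪ U) ≤ th S w (BS S) e s := by
    apply measureReal_mono _ (h.fin rfl _)
    rintro z (⟨a, b⟩ | ⟨a, _, b⟩)
    · refine ⟨a, ?_⟩
      simp only [mem_setOf_eq] at b ⊢
      refine lt_of_le_of_lt b ?_
      have : ‖z‖ < 1 := by simpa using a.1
      nlinarith
    · exact ⟨a, b⟩
  linarith

lemma der (h : Ctx S α w) {E f p f' p'} (g : GS S α w E f p) (gb : GS S α w (BS S) f' p') {e : Euc n}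
    (he : ‖e‖ = 1) {s ε : ℝ} (s0 : 0 < s) (h0 : 0 < th S w (BS S) e s) (h1 : th S w (BS S) e s < VV S w)
    (hε : 0 < ε) : ∃ δ > 0, ∀ s1 s2 t1 t2, s - δ < s1 → s1 < s2 → s2 < s + δ →
      th S w (BS S) e s1 = th S w E e t1 → th S w (BS S) e s2 = th S w E e t2 →
      |(t2 - t1) - (s2 - s1)| ≤ ε * (s2 - s1) := by
  set G := th S w (BS S) e with hG
  set D := (n:ℝ)+α with hD
  have hGc : Continuous G := h.thcont h.BSo.measurableSet rfl he
  have hlt : s < 1 := by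
    by_contra hc
    have := h.thmono (E := BS S) rfl e (not_lt.1 hc)
    rw [h.th_one he] at this
    exact absurd h1 (not_lt.2 this)
  have hsc := h.sg_contAt he s0.le hlt
  have hq := h.Gsig he s0 h1
  set σ := sg S α w e with hσ
  have c1 : ContinuousAt (fun z : ℝ × ℝ => G z.1) (s,s) := (hGc.comp continuous_fst).continuousAt
  have c2 : ContinuousAt (fun z : ℝ × ℝ => G z.2) (s,s) := (hGc.comp continuous_snd).continuousAt
  have c3 : ContinuousAt (fun z : ℝ × ℝ => σ z.1) (s,s) := ContinuousAt.comp (f := Prod.fst) (g := σ) hsc continuousAt_fst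
  have c4 : ContinuousAt (fun z : ℝ × ℝ => σ z.2) (s,s) := ContinuousAt.comp (f := Prod.snd) (g := σ) hsc continuousAt_snd
  have cQ : ContinuousAt (fun z : ℝ × ℝ => D * G z.1 - σ z.2) (s,s) := (continuousAt_const.mul c1).sub c4
  have cR : ContinuousAt (fun z : ℝ × ℝ => D * G z.2 - σ z.1) (s,s) := (continuousAt_const.mul c2).sub c3
  have hq' : 0 < D * G s - σ s := hq
  have ev1 := cQ.eventually (lt_mem_nhds hq')
  have ev2 := cR.eventually (lt_mem_nhds hq')
  have ev3 := (cR.sub (continuousAt_const (y := 1+ε) |>.mul cQ)).eventually (gt_mem_nhds (show (D * G s - σ s) - (1+ε) * (D * G s - σ s) < 0 by nlinarith))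
  have ev4 := ((continuousAt_const (y := 1-ε) |>.mul cR).sub cQ).eventually (gt_mem_nhds (show (1-ε) * (D * G s - σ s) - (D * G s - σ s) < 0 by nlinarith))
  have ev5 := c1.eventually (lt_mem_nhds h0)
  have ev6 := c2.eventually (gt_mem_nhds h1)
  have ev7 := (continuousAt_fst (p := (s,s))).eventually (lt_mem_nhds s0)
  have ev8 := (continuousAt_fst (p := (s,s))).eventually (gt_mem_nhds hlt)
  obtain ⟨δ, δ0, hδ⟩ := Metric.eventually_nhds_iff.1 (ev1.and (ev2.and (ev3.and (ev4.and (ev5.and (ev6.and (ev7.and ev8)))))))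
  refine ⟨δ, δ0, fun s1 s2 t1 t2 a1 a2 a3 b1 b2 => ?_⟩
  obtain ⟨k1, k2, k3, k4, k5, k6, k7, k8⟩ := hδ (y := (s1, s2)) (by
    rw [Prod.dist_eq, max_lt_iff, Real.dist_eq, Real.dist_eq, abs_lt, abs_lt]
    refine ⟨⟨?_, ?_⟩, ?_, ?_⟩ <;> simp only <;> linarith)
  simp only [Pi.sub_apply, Pi.mul_apply] at k1 k2 k3 k4 k5 k6 k7 k8
  have hng := h.NG gb he a2 k5 k6
  have htt : t1 < t2 := by
    by_contra hc
    have := h.thmono g.ev e (not_lt.1 hc)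
    rw [← b1, ← b2] at this
    linarith
  have i1 := h.I1 g he htt b1 b2 (by rw [← b1]; exact k5) (by rw [← b2]; exact k6)
  have i2 := h.I2 g he htt b1 b2 (by rw [← b1]; exact k5) (by rw [← b2]; exact k6)
  have i3 := h.I1 gb he a2 rfl rfl k5 k6
  have i4 := h.I2 gb he a2 rfl rfl k5 k6
  rw [h.sgm_eq he k7.le k8] at i2 i4
  rw [← b1, ← b2] at i1 i2
  set d := G s2 - G s1 with hd
  have d0 : 0 < d := by rw [hd]; linarith
  have et : 0 < t2 - t1 := by linarith
  have es : 0 < s2 - s1 := by linarith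
  have j1 : (t2 - t1) * (D * G s1 - σ s2) ≤ s1 * d := by
    have : D * G s1 - σ s2 ≤ s1 * (d/(t2-t1)) := by linarith
    calc _ ≤ (t2 - t1) * (s1 * (d/(t2-t1))) := by gcongr
      _ = _ := by field_simp
  have j3 : (s2 - s1) * (D * G s1 - σ s2) ≤ s1 * d := by
    have : D * G s1 - σ s2 ≤ s1 * (d/(s2-s1)) := by linarith
    calc _ ≤ (s2 - s1) * (s1 * (d/(s2-s1))) := by gcongr
      _ = _ := by field_simp
  have j2 : s2 * d ≤ (t2 - t1) * (D * G s2 - σ s1) := by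
    have : s2 * (d/(t2-t1)) ≤ D * G s2 - σ s1 := i2
    calc _ = (t2 - t1) * (s2 * (d/(t2-t1))) := by field_simp
      _ ≤ _ := by gcongr
  have j4 : s2 * d ≤ (s2 - s1) * (D * G s2 - σ s1) := by
    have : s2 * (d/(s2-s1)) ≤ D * G s2 - σ s1 := i4
    calc _ = (s2 - s1) * (s2 * (d/(s2-s1))) := by field_simp
      _ ≤ _ := by gcongr
  set Q := D * G s1 - σ s2 with hQ
  set R := D * G s2 - σ s1 with hR
  have js : s1 * d ≤ s2 * d := by gcongr
  have u1 : (t2 - t1) * Q ≤ (s2 - s1) * ((1+ε) * Q) := by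
    have : (s2 - s1) * R ≤ (s2 - s1) * ((1+ε)*Q) := by gcongr; linarith
    linarith
  have u2 : (s2 - s1) * ((1-ε) * R) ≤ (t2 - t1) * R := by
    have : (s2 - s1) * ((1-ε) * R) ≤ (s2 - s1) * Q := by gcongr; linarith
    linarith
  have v1 : t2 - t1 ≤ (s2 - s1) * (1+ε) := le_of_mul_le_mul_right (by linarith : (t2-t1) * Q ≤ (s2-s1)*(1+ε) * Q) k1
  have v2 : (s2 - s1) * (1-ε) ≤ t2 - t1 := le_of_mul_le_mul_right (by linarith : (s2-s1)*(1-ε) * R ≤ (t2-t1) * R) k2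
  rw [abs_le]; constructor <;> linarith

lemma th_big (h : Ctx S α w) {E : Set (Euc n)} (hE : wm S w E = wm S w (BS S)) (e : Euc n) {c : ℝ}
    (hc : c < VV S w) : ∃ t, c < th S w E e t := by
  have key : Filter.Tendsto (fun k : ℕ => wm S w (E ∩ {x | ⟪x, e⟫ < k})) Filter.atTop
      (𝓝 (wm S w (⋃ k : ℕ, E ∩ {x | ⟪x, e⟫ < k}))) := by
    apply tendsto_measure_iUnion_atTop
    intro a b hab
    apply inter_subset_inter_right
    intro y (hy : ⟪y, e⟫ < a)
    have : (a:ℝ) ≤ b := by exact_mod_cast hab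
    exact lt_of_lt_of_le hy this
  have e1 : (⋃ k : ℕ, E ∩ {x | ⟪x, e⟫ < k}) = E := by
    rw [← inter_iUnion, inter_eq_left]
    intro x _
    obtain ⟨k, hk⟩ := exists_nat_gt ⟪x, e⟫
    exact mem_iUnion.2 ⟨k, hk⟩
  rw [e1, hE] at key
  have k2 := (ENNReal.tendsto_toReal h.Vt).comp key
  obtain ⟨k, hk⟩ := (k2.eventually (lt_mem_nhds hc)).exists
  exact ⟨k, hk⟩

lemma th_small (h : Ctx S α w) {E : Set (Euc n)} (hE : wm S w E = wm S w (BS S)) {e : Euc n} (he : ‖e‖ = 1) {c : ℝ}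
    (hc : 0 < c) : ∃ t, th S w E e t < c := by
  obtain ⟨t, ht⟩ := h.th_big hE (-e) (c := VV S w - c) (by linarith)
  refine ⟨-t, ?_⟩
  have := h.thneg hE he (-t)
  rw [neg_neg] at this
  linarith

lemma th_ivt (h : Ctx S α w) {E : Set (Euc n)} (hEm : MeasurableSet E) (hE : wm S w E = wm S w (BS S)) {e : Euc n} (he : ‖e‖ = 1) {c : ℝ}
    (hc : 0 < c) (hc' : c < VV S w) : ∃ t, th S w E e t = c := by
  obtain ⟨a, ha⟩ := h.th_small hE he hc
  obtain ⟨b, hb⟩ := h.th_big hE e hc'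
  exact mem_range_of_exists_le_of_exists_ge (h.thcont hEm hE he) ⟨a, ha.le⟩ ⟨b, hb.le⟩

def Rel (S : Set (Euc n)) (w : Euc n → ℝ) (E : Set (Euc n)) (e : Euc n) (s t : ℝ) : Prop :=
  th S w (BS S) e s = th S w E e t ∧ 0 < th S w (BS S) e s ∧ th S w (BS S) e s < VV S w

lemma P1 (h : Ctx S α w) {E f p f' p'} (g : GS S α w E f p) (gb : GS S α w (BS S) f' p') {e : Euc n}
    (he : ‖e‖ = 1) {s1 s2 t1 t2 : ℝ} (s0 : 0 < s1) (hs : s1 < s2) (r1 : Rel S w E e s1 t1)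
    (r2 : Rel S w E e s2 t2) : t2 - t1 = s2 - s1 := by
  have hr : ∀ s, s ∈ Icc s1 s2 → 0 < th S w (BS S) e s ∧ th S w (BS S) e s < VV S w := fun s hs =>
    ⟨lt_of_lt_of_le r1.2.1 (h.thmono rfl e hs.1), lt_of_le_of_lt (h.thmono rfl e hs.2) r2.2.2⟩
  have hex : ∀ s, ∃ t, s ∈ Icc s1 s2 → th S w (BS S) e s = th S w E e t := by
    intro s
    by_cases hs : s ∈ Icc s1 s2
    · obtain ⟨t, ht⟩ := h.th_ivt g.eo.measurableSet g.ev he (hr s hs).1 (hr s hs).2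
      exact ⟨t, fun _ => ht.symm⟩
    · exact ⟨0, fun h => absurd h hs⟩
  choose τ hτ using hex
  have inj : ∀ {a b}, th S w E e a = th S w E e b → 0 < th S w E e a → th S w E e a < VV S w → a = b := by
    intro a b hab h0 h1
    rcases lt_trichotomy a b with hl | hl | hl
    · have := h.NG g he hl h0 (by rw [← hab]; exact h1); linarith
    · exact hl
    · have := h.NG g he hl (by rw [← hab]; exact h0) h1; linarith
  have m1 : s1 ∈ Icc s1 s2 := ⟨le_rfl, hs.le⟩
  have m2 : s2 ∈ Icc s1 s2 := ⟨hs.le, le_rfl⟩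
  have e1 : τ s1 = t1 := by
    have := hτ s1 m1
    apply inj (by rw [← this, r1.1]) <;> rw [← this]; exacts [r1.2.1, r1.2.2]
  have e2 : τ s2 = t2 := by
    have := hτ s2 m2
    apply inj (by rw [← this, r2.1]) <;> rw [← this]; exacts [r2.2.1, r2.2.2]
  have hder : ∀ s ∈ Icc s1 s2, HasDerivWithinAt (fun s => τ s - s) 0 (Icc s1 s2) s := by
    intro s hs
    rw [hasDerivWithinAt_iff_isLittleO, Asymptotics.isLittleO_iff]
    intro c hc
    obtain ⟨δ, δ0, hδ⟩ := h.der g gb he (lt_of_lt_of_le s0 hs.1) (hr s hs).1 (hr s hs).2 hc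
    have hb : ∀ᶠ x in 𝓝[Icc s1 s2] s, x ∈ ball s δ := nhdsWithin_le_nhds (ball_mem_nhds s δ0)
    filter_upwards [hb, self_mem_nhdsWithin] with x hx hxI
    rw [mem_ball, Real.dist_eq, abs_lt] at hx
    simp only [smul_zero, sub_zero]
    rw [Real.norm_eq_abs, Real.norm_eq_abs]
    rcases lt_trichotomy x s with hl | hl | hl
    · have := hδ x s (τ x) (τ s) (by linarith) hl (by linarith) (hτ x hxI) (hτ s hs)
      rw [abs_of_neg (by linarith : x - s < 0), ← abs_neg]
      convert this using 1
      · congr 1; ring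
      · ring
    · rw [hl]; simp
    · have := hδ s x (τ s) (τ x) (by linarith) hl (by linarith) (hτ s hs) (hτ x hxI)
      rw [abs_of_pos (by linarith : 0 < x - s)]
      convert this using 1
      congr 1; ring
  have := constant_of_derivWithin_zero (fun s hs => (hder s hs).differentiableWithinAt)
    (fun s hs' => (hder s ⟨hs'.1, hs'.2.le⟩).derivWithin (uniqueDiffOn_Icc hs s ⟨hs'.1, hs'.2.le⟩)) s2 m2
  simp only [e1, e2] at this
  linarith

lemma Rel_inj (h : Ctx S α w) {E f p} (g : GS S α w E f p) {e : Euc n}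
    (he : ‖e‖ = 1) {s a b : ℝ} (r1 : Rel S w E e s a) (r2 : Rel S w E e s b) : a = b := by
  obtain ⟨x1, x2, x3⟩ := r1
  obtain ⟨y1, y2, y3⟩ := r2
  rcases lt_trichotomy a b with hl | hl | hl
  · have := h.NG g he hl (by linarith) (by linarith); linarith
  · exact hl
  · have := h.NG g he hl (by linarith) (by linarith); linarith

lemma P2 (h : Ctx S α w) {E f p f' p'} (g : GS S α w E f p) (gb : GS S α w (BS S) f' p') {e : Euc n}
    (he : ‖e‖ = 1) {s1 s2 t1 t2 : ℝ} (s0 : 0 ≤ s1) (hs : s1 < s2) (r1 : Rel S w E e s1 t1)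
    (r2 : Rel S w E e s2 t2) : t2 - t1 = s2 - s1 := by
  rcases s0.eq_or_lt with hs0 | hs0
  swap
  · exact h.P1 g gb he hs0 hs r1 r2
  subst hs0
  have key : ∀ s ∈ Ioo 0 s2, th S w (BS S) e s = th S w E e (t2 - s2 + s) := by
    intro s hsI
    have b1 : 0 < th S w (BS S) e s := lt_of_lt_of_le r1.2.1 (h.thmono rfl e hsI.1.le)
    have b2 : th S w (BS S) e s < VV S w := lt_of_le_of_lt (h.thmono rfl e hsI.2.le) r2.2.2
    obtain ⟨t, ht⟩ := h.th_ivt g.eo.measurableSet g.ev he b1 b2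
    have := h.P1 g gb he hsI.1 hsI.2 ⟨ht.symm, b1, b2⟩ r2
    rw [← ht]; congr 1; linarith
  have c1 : Filter.Tendsto (th S w (BS S) e) (𝓝[>] 0) (𝓝 (th S w (BS S) e 0)) :=
    (h.thcont h.BSo.measurableSet rfl he).continuousAt.tendsto.mono_left nhdsWithin_le_nhds
  have c2 : Filter.Tendsto (fun s => th S w E e (t2 - s2 + s)) (𝓝[>] 0) (𝓝 (th S w E e (t2 - s2 + 0))) := by
    have := (h.thcont g.eo.measurableSet g.ev he).comp (continuous_const.add continuous_id : Continuous fun s : ℝ => t2 - s2 + s)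
    exact this.continuousAt.tendsto.mono_left nhdsWithin_le_nhds
  have c3 : Filter.Tendsto (th S w (BS S) e) (𝓝[>] 0) (𝓝 (th S w E e (t2 - s2 + 0))) := by
    apply c2.congr'
    filter_upwards [Ioo_mem_nhdsGT hs] with s hs'
    exact (key s hs').symm
  have e0 := tendsto_nhds_unique c1 c3
  have := h.Rel_inj g he r1 ⟨e0, r1.2⟩
  linarith

lemma Relneg (h : Ctx S α w) {E f p} (g : GS S α w E f p) {e : Euc n}
    (he : ‖e‖ = 1) {s t : ℝ} (r : Rel S w E e s t) : Rel S w E (-e) (-s) (-t) := by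
  obtain ⟨a, b, c⟩ := r
  refine ⟨?_, ?_, ?_⟩
  · rw [h.thneg rfl he, h.thneg g.ev he, a]
  · rw [h.thneg rfl he]; linarith
  · rw [h.thneg rfl he]; linarith

lemma P3 (h : Ctx S α w) {E f p f' p'} (g : GS S α w E f p) (gb : GS S α w (BS S) f' p') {e : Euc n}
    (he : ‖e‖ = 1) {s1 s2 t1 t2 : ℝ} (hs : s1 < s2) (r1 : Rel S w E e s1 t1)
    (r2 : Rel S w E e s2 t2) : t2 - t1 = s2 - s1 := by
  have he' : ‖-e‖ = 1 := by rwa [norm_neg]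
  rcases le_or_gt 0 s1 with h0 | h0
  · exact h.P2 g gb he h0 hs r1 r2
  rcases le_or_gt s2 0 with h1 | h1
  · have := h.P2 g gb he' (by linarith) (by linarith) (h.Relneg g he r2) (h.Relneg g he r1)
    linarith
  have b1 : 0 < th S w (BS S) e 0 := lt_of_lt_of_le r1.2.1 (h.thmono rfl e h0.le)
  have b2 : th S w (BS S) e 0 < VV S w := lt_of_le_of_lt (h.thmono rfl e h1.le) r2.2.2
  obtain ⟨t, ht⟩ := h.th_ivt g.eo.measurableSet g.ev he b1 b2
  have r0 : Rel S w E e 0 t := ⟨ht.symm, b1, b2⟩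
  have q1 := h.P2 g gb he le_rfl h1 r0 r2
  have q2 := h.P2 g gb he' (by simp) (by linarith) (h.Relneg g he r0) (h.Relneg g he r1)
  linarith

lemma P4 (h : Ctx S α w) {E f p f' p'} (g : GS S α w E f p) (gb : GS S α w (BS S) f' p') {e : Euc n}
    (he : ‖e‖ = 1) {s1 s2 t1 t2 : ℝ} (r1 : Rel S w E e s1 t1)
    (r2 : Rel S w E e s2 t2) : t2 - t1 = s2 - s1 := by
  rcases lt_trichotomy s1 s2 with hl | hl | hl
  · exact h.P3 g gb he hl r1 r2
  · subst hl
    have := h.Rel_inj g he r1 r2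
    linarith
  · have := h.P3 g gb he hl r2 r1
    linarith

/-- main one-dimensional conclusion -/
lemma shift (h : Ctx S α w) {E f p f' p'} (g : GS S α w E f p) (gb : GS S α w (BS S) f' p') {e : Euc n}
    (he : ‖e‖ = 1) : ∃ q : ℝ, ∀ t, th S w E e t = th S w (BS S) e (t + q) := by
  have V0 := h.V0
  obtain ⟨s0, hs0⟩ := h.th_ivt h.BSo.measurableSet rfl he (half_pos V0) (half_lt_self V0)
  obtain ⟨t0, ht0⟩ := h.th_ivt g.eo.measurableSet g.ev he (half_pos V0) (half_lt_self V0)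
  have r0 : Rel S w E e s0 t0 := ⟨by rw [hs0, ht0], by rw [hs0]; linarith, by rw [hs0]; linarith⟩
  have hub : ∀ {E : Set (Euc n)}, wm S w E = wm S w (BS S) → ∀ t, th S w E e t ≤ VV S w := by
    intro E hE t
    rw [← h.Ereal hE]
    exact measureReal_mono inter_subset_left (by rw [hE]; exact h.Vt)
  refine ⟨s0 - t0, fun t => ?_⟩
  have main : ∀ t, 0 < th S w (BS S) e (t + (s0 - t0)) → th S w (BS S) e (t + (s0 - t0)) < VV S w →
      th S w E e t = th S w (BS S) e (t + (s0 - t0)) := by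
    intro t h1 h2
    obtain ⟨t', ht'⟩ := h.th_ivt g.eo.measurableSet g.ev he h1 h2
    have := h.P4 g gb he r0 ⟨ht'.symm, h1, h2⟩
    have : t' = t := by linarith
    rw [← ht', this]
  rcases (thnn (S := S) (w := w) (E := E) e t).eq_or_lt with h1 | h1
  · by_contra hne
    rw [← h1] at hne
    have p1 : 0 < th S w (BS S) e (t + (s0 - t0)) := lt_of_le_of_ne (thnn _ _) hne
    have : t < t0 := by
      by_contra hc
      have := h.thmono g.ev e (not_lt.1 hc)
      linarith
    have p2 := h.thmono (E := BS S) rfl e (show t + (s0 - t0) ≤ s0 by linarith)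
    have := main t p1 (by linarith)
    linarith
  rcases (hub g.ev t).eq_or_lt with h2 | h2
  · by_contra hne
    rw [h2] at hne
    have p1 : th S w (BS S) e (t + (s0 - t0)) < VV S w := lt_of_le_of_ne (hub rfl _) (Ne.symm hne)
    have : t0 < t := by
      by_contra hc
      have := h.thmono g.ev e (not_lt.1 hc)
      linarith
    have p2 := h.thmono (E := BS S) rfl e (show s0 ≤ t + (s0 - t0) by linarith)
    have := main t (by linarith) p1
    linarith
  · obtain ⟨s, hs⟩ := h.th_ivt h.BSo.measurableSet rfl he h1 h2
    have := h.P4 g gb he r0 ⟨hs, by linarith, by linarith⟩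
    rw [← hs]; congr 1; linarith
end Ctx

end

noncomputable section

lemma cramer {n : ℕ} (μ ν : Measure (Euc n)) [IsFiniteMeasure μ] [IsFiniteMeasure ν]
    (hu : μ univ = ν univ) (hu0 : ν univ ≠ 0) (hb : ∀ᵐ x ∂ν, ‖x‖ ≤ 1)
    (hq : ∀ e : Euc n, ‖e‖ = 1 → ∃ q : ℝ, ∀ t : ℝ, μ {x | ⟪x, e⟫ < t} = ν {x | ⟪x, e⟫ < t + q}) :
    ∃ q : Euc n, μ.map (fun x => x + q) = ν := by
  have s1 : ∀ v : Euc n, ∃ q : ℝ, μ.map (fun x => ⟪x, v⟫ + q) = ν.map (fun x => ⟪x, v⟫) := by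
    intro v
    by_cases hv : v = 0
    · refine ⟨0, ?_⟩
      subst hv
      simp only [inner_zero_right, add_zero, Measure.map_const, hu]
    · have hv' : 0 < ‖v‖ := norm_pos_iff.2 hv
      set e : Euc n := (‖v‖)⁻¹ • v with he
      have he1 : ‖e‖ = 1 := by rw [he, norm_smul, norm_inv, norm_norm, inv_mul_cancel₀ hv'.ne']
      obtain ⟨q, hq⟩ := hq e he1
      refine ⟨‖v‖ * q, ?_⟩
      have hve : ∀ x : Euc n, ⟪x, v⟫ = ‖v‖ * ⟪x, e⟫ := by
        intro x; rw [he, inner_smul_right, ← mul_assoc, mul_inv_cancel₀ hv'.ne', one_mul]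
      have hm1 : Measurable (fun x : Euc n => ⟪x, e⟫ + q) := by fun_prop
      have hm2 : Measurable (fun x : Euc n => ⟪x, e⟫) := by fun_prop
      have key : μ.map (fun x => ⟪x, e⟫ + q) = ν.map (fun x => ⟪x, e⟫) := by
        refine Measure.ext_of_Ici _ _ (fun a => ?_)
        rw [Measure.map_apply hm1 measurableSet_Ici, Measure.map_apply hm2 measurableSet_Ici]
        have e1 : (fun x : Euc n => ⟪x, e⟫ + q) ⁻¹' Ici a = {x | ⟪x, e⟫ < a - q}ᶜ := by
          ext x; simp only [mem_preimage, mem_Ici, mem_compl_iff, mem_setOf_eq, not_lt]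
          constructor <;> intro h <;> linarith
        have e2 : (fun x : Euc n => ⟪x, e⟫) ⁻¹' Ici a = {x | ⟪x, e⟫ < a}ᶜ := by
          ext x; simp only [mem_preimage, mem_Ici, mem_compl_iff, mem_setOf_eq, not_lt]
        rw [e1, e2, measure_compl (measurableSet_lt hm2 measurable_const) (measure_ne_top _ _),
          measure_compl (measurableSet_lt hm2 measurable_const) (measure_ne_top _ _), hu, hq, sub_add_cancel]
      have k2 := congrArg (Measure.map (fun s : ℝ => ‖v‖ * s)) key
      rw [Measure.map_map (by fun_prop) hm1, Measure.map_map (by fun_prop) hm2] at k2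
      convert k2 using 2
      · ext x; simp only [Function.comp, hve x]; ring
      · ext x; simp only [Function.comp, hve x]
  choose Q hQ using s1
  have iν : Integrable (fun x : Euc n => x) ν :=
    Integrable.of_bound (by fun_prop) 1 hb
  have iνv : ∀ v : Euc n, Integrable (fun x : Euc n => ⟪x, v⟫) ν := fun v => iν.inner_const v
  have iμv' : ∀ v : Euc n, Integrable (fun x : Euc n => ⟪x, v⟫ + Q v) μ := by
    intro v
    have h1 : Integrable (fun s : ℝ => s) (ν.map (fun x => ⟪x, v⟫)) :=
      (integrable_map_measure (by fun_prop) (by fun_prop)).2 (iνv v)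
    rw [← hQ] at h1
    exact (integrable_map_measure (by fun_prop) (by fun_prop)).1 h1
  have iμv : ∀ v : Euc n, Integrable (fun x : Euc n => ⟪x, v⟫) μ := by
    intro v
    refine ((iμv' v).sub (integrable_const (Q v))).congr (Filter.Eventually.of_forall fun x => ?_)
    simp
  have iμ : Integrable (fun x : Euc n => x) μ := by
    have h1 : Integrable (fun x : Euc n => ∑ i, ‖⟪x, EuclideanSpace.single i (1:ℝ)⟫‖) μ :=
      integrable_finset_sum _ (fun i _ => (iμv _).norm)
    refine h1.mono' (by fun_prop) (Filter.Eventually.of_forall fun x => ?_)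
    simp only [EuclideanSpace.inner_single_right, map_one, one_mul, RCLike.conj_to_real]
    rw [EuclideanSpace.norm_eq]
    refine Real.sqrt_le_iff.2 ⟨by positivity, ?_⟩
    exact Finset.sum_sq_le_sq_sum_of_nonneg (fun i _ => norm_nonneg _)
  have hV : ν.real univ ≠ 0 := by
    rw [measureReal_def]; exact (ENNReal.toReal_pos hu0 (measure_ne_top _ _)).ne'
  have hVμ : μ.real univ = ν.real univ := by rw [measureReal_def, hu]; rfl
  set q : Euc n := (ν.real univ)⁻¹ • ((∫ x, x ∂ν) - ∫ x, x ∂μ) with hqd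
  have hQq : ∀ v, Q v = ⟪q, v⟫ := by
    intro v
    have h1 : ∫ s, s ∂(μ.map (fun x : Euc n => ⟪x, v⟫ + Q v)) = ∫ s, s ∂(ν.map (fun x : Euc n => ⟪x, v⟫)) := by rw [hQ]
    rw [integral_map (by fun_prop) (by fun_prop), integral_map (by fun_prop) (by fun_prop),
      integral_add (iμv v) (integrable_const _), integral_const, smul_eq_mul, hVμ] at h1
    have h2 : ∫ x, ⟪x, v⟫ ∂μ = ⟪∫ x, x ∂μ, v⟫ := by
      rw [real_inner_comm, ← integral_inner iμ v]; simp only [real_inner_comm]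
    have h3 : ∫ x, ⟪x, v⟫ ∂ν = ⟪∫ x, x ∂ν, v⟫ := by
      rw [real_inner_comm, ← integral_inner iν v]; simp only [real_inner_comm]
    rw [hqd, real_inner_smul_left, inner_sub_left, ← h2, ← h3, ← h1]
    field_simp; ring
  refine ⟨q, ?_⟩
  apply Measure.ext_of_charFun
  ext v
  rw [charFun_apply, charFun_apply, integral_map (by fun_prop) (by fun_prop)]
  have h1 : ∫ s : ℝ, Complex.exp (s * Complex.I) ∂(μ.map (fun x : Euc n => ⟪x, v⟫ + Q v)) = ∫ s : ℝ, Complex.exp (s * Complex.I) ∂(ν.map (fun x : Euc n => ⟪x, v⟫)) := by rw [hQ]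
  rw [integral_map (by fun_prop) (by fun_prop), integral_map (by fun_prop) (by fun_prop)] at h1
  rw [← h1]
  simp only [inner_add_left, hQq]

namespace Ctx
variable {n : ℕ} {S : Set (Euc n)} {α : ℝ} {w : Euc n → ℝ}

lemma trans (h : Ctx S α w) {E f p f' p'} (g : GS S α w E f p) (gb : GS S α w (BS S) f' p') :
    ∃ p : Euc n, p ∈ closure S ∧ E =ᵐ[volume] {z | z - p ∈ BS S} := by
  have fE : wm S w E ≠ ⊤ := g.ev ▸ h.Vt
  haveI : IsFiniteMeasure ((wm S w).restrict E) := ⟨by simpa using fE.lt_top⟩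
  haveI : IsFiniteMeasure ((wm S w).restrict (BS S)) := ⟨by simpa using h.Vt.lt_top⟩
  have mE := g.eo.measurableSet
  have mB := h.BSo.measurableSet
  obtain ⟨q, hq⟩ := cramer ((wm S w).restrict E) ((wm S w).restrict (BS S))
    (by simpa using g.ev) (by simpa using h.wm_pos h.BSo h.BSs h.BSn)
    (by
      filter_upwards [ae_restrict_mem mB] with x hx
      exact (mem_ball_zero_iff.1 hx.1).le)
    (by
      intro e he
      obtain ⟨q, hq⟩ := h.shift g gb he
      refine ⟨q, fun t => ?_⟩
      have := hq t
      have ms : ∀ t : ℝ, MeasurableSet {x : Euc n | ⟪x, e⟫ < t} := fun t => measurableSet_lt (by fun_prop) measurable_const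
      rw [Measure.restrict_apply (ms _), Measure.restrict_apply (ms _), inter_comm, inter_comm _ (BS S)]
      exact (ENNReal.toReal_eq_toReal_iff' (h.fin g.ev _) (h.fin rfl _)).1 this)
  -- positivity of density: null sets agree inside S
  have nul : ∀ A : Set (Euc n), MeasurableSet A → A ⊆ S → wm S w A = 0 → volume A = 0 := by
    intro A mA hA h0
    rw [h.wm_apply mA] at h0
    rw [lintegral_eq_zero_iff' h.wd_meas.aemeasurable] at h0
    have : ∀ᵐ x ∂volume.restrict A, False := by
      filter_upwards [h0, ae_restrict_mem mA] with x hx hxA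
      rw [wd, indicator_of_mem (hA hxA)] at hx
      have := h.wpos (hA hxA)
      simp only [Pi.zero_apply, ENNReal.ofReal_eq_zero] at hx
      linarith
    simpa [ae_iff] using this
  have mq : Measurable (fun x : Euc n => x + q) := by fun_prop
  set T : Set (Euc n) := {z | z - (-q) ∈ BS S} with hT
  have hTp : T = (fun x : Euc n => x + q) ⁻¹' BS S := by ext z; simp [hT]
  have oT : IsOpen T := by rw [hTp]; exact h.BSo.preimage (by fun_prop)
  -- E \ T null
  have n1 : volume (E \ T) = 0 := by
    apply nul _ (mE.diff oT.measurableSet) (diff_subset.trans g.es)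
    have := congrArg (fun m : Measure (Euc n) => m (BS S)ᶜ) hq
    simp only [Measure.restrict_apply mB.compl, compl_inter_self, measure_empty] at this
    rw [Measure.map_apply mq mB.compl, Measure.restrict_apply (mq mB.compl)] at this
    rw [← this, hTp]; congr 1; ext x; simp [and_comm]
  have n2 : volume (T \ E) = 0 := by
    have := congrArg (fun m : Measure (Euc n) => m ((fun x => x - q) ⁻¹' Eᶜ)) hq
    have mm : MeasurableSet ((fun x : Euc n => x - q) ⁻¹' Eᶜ) := by measurability
    beta_reduce at this
    rw [Measure.map_apply mq mm, Measure.restrict_apply (mq mm), Measure.restrict_apply mm] at this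
    have e1 : (fun x => x + q) ⁻¹' ((fun x => x - q) ⁻¹' Eᶜ) ∩ E = ∅ := by
      ext x; simp
    rw [e1, measure_empty] at this
    have h2 := nul _ (mm.inter mB) (inter_subset_right.trans h.BSs) this.symm
    have e2 : T \ E = (fun x : Euc n => x + q) ⁻¹' ((fun x => x - q) ⁻¹' Eᶜ ∩ BS S) := by
      rw [hTp]; ext x; simp [and_comm]
    rw [e2, measure_preimage_add_right, h2]
  have hTcl : T ⊆ closure S := by
    by_contra hcon
    obtain ⟨z, hz, hzS⟩ := not_subset.1 hcon
    have o2 : IsOpen (T ∩ (closure S)ᶜ) := oT.inter isClosed_closure.isOpen_compl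
    have : volume (T ∩ (closure S)ᶜ) = 0 := by
      refine measure_mono_null (fun x hx => ?_) n2
      exact ⟨hx.1, fun hE => hx.2 (subset_closure (g.es hE))⟩
    exact (o2.measure_pos volume ⟨z, hz, hzS⟩).ne' this
  refine ⟨-q, ?_, ?_⟩
  · obtain ⟨b, hb⟩ := h.BSn
    have hlim : Filter.Tendsto (fun t : ℝ => t • b - q) (𝓝[>] 0) (𝓝 (-q)) := by
      have : Filter.Tendsto (fun t : ℝ => t • b - q) (𝓝 0) (𝓝 ((0:ℝ) • b - q)) := by
        apply Continuous.tendsto; fun_prop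
      rw [zero_smul, zero_sub] at this
      exact this.mono_left nhdsWithin_le_nhds
    refine isClosed_closure.mem_of_tendsto hlim ?_
    filter_upwards [Ioo_mem_nhdsGT (show (0:ℝ) < 1 by norm_num)] with t ht
    apply hTcl
    show t • b - q - -q ∈ BS S
    rw [sub_neg_eq_add, sub_add_cancel]
    refine ⟨?_, h.cone hb.2 ht.1⟩
    have := mem_ball_zero_iff.1 hb.1
    rw [mem_ball_zero_iff, norm_smul, Real.norm_of_nonneg ht.1.le]
    nlinarith [ht.2, norm_nonneg b, ht.1]
  · rw [ae_eq_set]; exact ⟨n1, n2⟩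
end Ctx

end

noncomputable section

/-- ratio of Hausdorff measure and Lebesgue measure on `Euc m` -/
def cH (m : ℕ) : ℝ≥0 := Measure.addHaarScalarFactor (μH[(m:ℝ)] : Measure (Euc m)) volume

lemma haar_H (m : ℕ) : Measure.IsAddHaarMeasure (μH[(m:ℝ)] : Measure (Euc m)) := by
  have := isAddHaarMeasure_hausdorffMeasure (E := Euc m)
  simpa using this

lemma cH_eq (m : ℕ) : (μH[(m:ℝ)] : Measure (Euc m)) = cH m • volume := by
  haveI := haar_H m
  exact Measure.isAddLeftInvariant_eq_smul _ _

lemma cH_pos (m : ℕ) : 0 < cH m := by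
  haveI := haar_H m
  exact Measure.addHaarScalarFactor_pos_of_isAddHaarMeasure _ _

lemma frame {m : ℕ} (e : Euc (m+1)) (he : ‖e‖ = 1) :
    ∃ (J : Euc m →ₗᵢ[ℝ] Euc (m+1)) (P : Euc (m+1) → Euc m), (∀ y, ⟪J y, e⟫ = 0) ∧
      MeasurePreserving (fun p : ℝ × Euc m => p.1 • e + J p.2) (volume.prod volume) volume ∧
      LipschitzWith 1 P ∧ ∀ x, x = ⟪x, e⟫ • e + J (P x) := by
  have he0 : e ≠ 0 := by intro h; simp [h] at he
  haveI : Fact (Module.finrank ℝ (Euc (m+1)) = m+1) := ⟨by simp⟩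
  let b := OrthonormalBasis.fromOrthogonalSpanSingleton (𝕜 := ℝ) m he0
  let J : Euc m →ₗᵢ[ℝ] Euc (m+1) := (Submodule.subtypeₗᵢ _).comp b.repr.symm.toLinearIsometry
  have hJ : ∀ y, ⟪J y, e⟫ = 0 := by
    intro y
    have h1 : J y ∈ (ℝ ∙ e)ᗮ := (b.repr.symm y).2
    rw [real_inner_comm]
    exact Submodule.mem_orthogonal_singleton_iff_inner_right.1 h1
  let L : WithLp 2 (ℝ × Euc m) →ₗᵢ[ℝ] Euc (m+1) :=
    { toFun := fun p => p.fst • e + J p.snd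
      map_add' := by intro p q; simp [add_smul]; abel
      map_smul' := by intro r p; simp [smul_smul]
      norm_map' := by
        intro p
        have h1 : ‖p.fst • e + J p.snd‖^2 = ‖p‖^2 := by
          rw [WithLp.prod_norm_sq_eq_of_L2, norm_add_sq_real, inner_smul_left, real_inner_comm, hJ, norm_smul, he,
            J.norm_map]
          simp
        exact (pow_left_inj₀ (norm_nonneg _) (norm_nonneg _) two_ne_zero).1 h1 }
  have hfr : Module.finrank ℝ (WithLp 2 (ℝ × Euc m)) = Module.finrank ℝ (Euc (m+1)) := by
    rw [LinearEquiv.finrank_eq (WithLp.linearEquiv 2 ℝ (ℝ × Euc m))]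
    simp [add_comm]
  let L' := L.toLinearIsometryEquiv hfr
  have hL' : ∀ p, L' p = p.fst • e + J p.snd := fun p => rfl
  have mp : MeasurePreserving (fun p : ℝ × Euc m => p.1 • e + J p.2) (volume.prod volume) volume := by
    have := L'.measurePreserving.comp (WithLp.volume_preserving_toLp ℝ (Euc m))
    exact this
  have hP : ∀ x : Euc (m+1), ∃ y, x = ⟪x, e⟫ • e + J y := by
    intro x
    obtain ⟨p, hp⟩ := L'.surjective x
    rw [hL'] at hp
    refine ⟨p.snd, ?_⟩
    have : ⟪x, e⟫ = p.fst := by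
      rw [← hp, inner_add_left, hJ, inner_smul_left, real_inner_self_eq_norm_sq, he]; simp
    rw [this, hp]
  choose P hP using hP
  refine ⟨J, P, hJ, mp, ?_, hP⟩
  apply LipschitzWith.of_dist_le_mul
  intro x x'
  rw [dist_eq_norm, dist_eq_norm, NNReal.coe_one, one_mul, ← J.norm_map, J.map_sub]
  have h1 : x - x' = ⟪x - x', e⟫ • e + (J (P x) - J (P x')) := by
    have a := hP x
    have b := hP x'
    calc x - x' = (⟪x, e⟫ • e + J (P x)) - (⟪x', e⟫ • e + J (P x')) := by rw [← a, ← b]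
      _ = _ := by rw [inner_sub_left, sub_smul]; abel
  have h2 : ‖x - x'‖^2 = ⟪x - x', e⟫^2 + ‖J (P x) - J (P x')‖^2 := by
    conv_lhs => rw [h1]
    rw [← J.map_sub, norm_add_sq_real, inner_smul_left, real_inner_comm (J _) e, hJ, norm_smul, he]
    simp
  refine le_of_sq_le_sq ?_ (norm_nonneg _)
  rw [h2]; nlinarith [sq_nonneg ⟪x - x', e⟫]

lemma G0 {m : ℕ} {e : Euc (m+1)} (he : ‖e‖ = 1) {F : Set (Euc (m+1))} (hF : MeasurableSet F) {h : ℝ}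
    (hh : 0 < h) {T : Set (Euc (m+1))} (hT : ∀ z ∈ T, ∃ x ∈ F, ∃ s ∈ Icc 0 h, z = x + s • e) :
    (cH m : ℝ≥0∞) * volume T ≤ ENNReal.ofReal h * μH[(m:ℝ)] F := by
  obtain ⟨J, P, hJ, mp, hP, hx⟩ := frame e he
  have key : ∀ η : ℝ, 0 < η → (cH m : ℝ≥0∞) * volume T ≤ ENNReal.ofReal (h + η) * μH[(m:ℝ)] F := by
    intro η hη
    set Q : ℤ → Set (Euc (m+1)) := fun i => F ∩ {x | ⌊⟪x, e⟫ / η⌋ = i} with hQ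
    have mfl : Measurable (fun x : Euc (m+1) => ⌊⟪x, e⟫ / η⌋) := by
      apply Int.measurable_floor.comp; fun_prop
    have mQ : ∀ i, MeasurableSet (Q i) := fun i => hF.inter (mfl (measurableSet_singleton i))
    have hFQ : F = ⋃ i, Q i := by ext x; simp [hQ]
    have dQ : Pairwise (Function.onFun Disjoint Q) := by
      intro i j hij
      refine Set.disjoint_left.2 fun x hx hy => hij ?_
      exact hx.2.symm.trans hy.2
    have mF : μH[(m:ℝ)] F = ∑' i, μH[(m:ℝ)] (Q i) := by
      conv_lhs => rw [hFQ]
      exact measure_iUnion dQ mQ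
    set C : ℤ → Set (Euc (m+1)) := fun i =>
      (fun p : ℝ × Euc m => p.1 • e + J p.2) '' (Icc (i*η) (i*η + (h+η)) ×ˢ (P '' Q i)) with hC
    have hTC : T ⊆ ⋃ i, C i := by
      intro z hz
      obtain ⟨x, hxF, s, hs, rfl⟩ := hT z hz
      refine mem_iUnion.2 ⟨⌊⟪x, e⟫ / η⌋, (⟪x, e⟫ + s, P x), ⟨⟨?_, ?_⟩, x, ⟨hxF, rfl⟩, rfl⟩, ?_⟩
      · have := Int.floor_le (⟪x, e⟫ / η)
        have := (le_div_iff₀ hη).1 this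
        linarith [hs.1]
      · have := (Int.lt_floor_add_one (⟪x, e⟫ / η)).le
        have := (div_le_iff₀ hη).1 this
        have h2 := hs.2
        simp only; nlinarith
      · simp only
        conv_rhs => rw [hx x]
        rw [add_smul]; abel
    have hCi : ∀ i, (cH m : ℝ≥0∞) * volume (C i) ≤ ENNReal.ofReal (h+η) * μH[(m:ℝ)] (Q i) := by
      intro i
      have inj : Function.Injective (fun p : ℝ × Euc m => p.1 • e + J p.2) := by
        intro p q hpq
        simp only at hpq
        have h1 := congrArg (fun v => ⟪v, e⟫) hpq
        simp only [inner_add_left, hJ, inner_smul_left, real_inner_self_eq_norm_sq, he] at h1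
        have h1' : p.1 = q.1 := by simpa using h1
        rw [h1'] at hpq
        have h2 := J.injective (add_left_cancel hpq)
        exact Prod.ext h1' h2
      have me : MeasurableEmbedding (fun p : ℝ × Euc m => p.1 • e + J p.2) :=
        Continuous.measurableEmbedding (by fun_prop) inj
      have e1 : volume (C i) = (volume.prod volume) (Icc (i*η) (i*η + (h+η)) ×ˢ (P '' Q i)) := by
        rw [hC, ← mp.map_eq, me.map_apply, preimage_image_eq _ inj]
      rw [e1, Measure.prod_prod, Real.volume_Icc]
      have e2 : (cH m : ℝ≥0∞) * volume (P '' Q i) ≤ μH[(m:ℝ)] (Q i) := by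
        have h3 := hP.hausdorffMeasure_image_le (d := (m:ℝ)) (by positivity) (Q i)
        rw [cH_eq] at h3
        simpa using h3
      calc _ = ENNReal.ofReal (h+η) * ((cH m : ℝ≥0∞) * volume (P '' Q i)) := by
            rw [show (i:ℝ)*η + (h+η) - i*η = h + η by ring]; ring
        _ ≤ _ := by gcongr
    calc (cH m : ℝ≥0∞) * volume T ≤ (cH m : ℝ≥0∞) * ∑' i, volume (C i) := by
          gcongr; exact (measure_mono hTC).trans (measure_iUnion_le _)
      _ = ∑' i, (cH m : ℝ≥0∞) * volume (C i) := ENNReal.tsum_mul_left.symm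
      _ ≤ ∑' i, ENNReal.ofReal (h+η) * μH[(m:ℝ)] (Q i) := ENNReal.tsum_le_tsum hCi
      _ = _ := by rw [ENNReal.tsum_mul_left, mF]
  by_cases hfin : μH[(m:ℝ)] F = ⊤
  · rw [hfin, ENNReal.mul_top (by simpa using hh)]; exact le_top
  · have hl : Filter.Tendsto (fun η : ℝ => ENNReal.ofReal (h + η) * μH[(m:ℝ)] F) (𝓝[>] 0)
        (𝓝 (ENNReal.ofReal (h + 0) * μH[(m:ℝ)] F)) := by
      apply ENNReal.Tendsto.mul_const _ (Or.inr hfin)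
      apply Filter.Tendsto.mono_left _ nhdsWithin_le_nhds
      apply Continuous.tendsto (f := fun η : ℝ => ENNReal.ofReal (h + η))
      exact ENNReal.continuous_ofReal.comp (by fun_prop)
    rw [add_zero] at hl
    exact ge_of_tendsto hl (Filter.eventually_of_mem self_mem_nhdsWithin key)

lemma G0w {m : ℕ} {e : Euc (m+1)} (he : ‖e‖ = 1) {F : Set (Euc (m+1))} (hF : MeasurableSet F) {h : ℝ}
    (hh : 0 < h) {T : Set (Euc (m+1))} {φ ψ : Euc (m+1) → ℝ} (mφ : Measurable φ) (mψ : Measurable ψ)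
    (φ0 : ∀ x, 0 ≤ φ x) (ψ0 : ∀ x, 0 ≤ ψ x)
    (hT : ∀ z ∈ T, ∃ x ∈ F, ∃ s ∈ Icc 0 h, z = x + s • e ∧ φ z ≤ ψ x) :
    (cH m : ℝ≥0∞) * ∫⁻ z in T, ENNReal.ofReal (φ z) ≤
      ENNReal.ofReal h * ∫⁻ x in F, ENNReal.ofReal (ψ x) ∂μH[(m:ℝ)] := by
  rw [lintegral_eq_lintegral_meas_lt _ (Filter.Eventually.of_forall φ0) mφ.aemeasurable,
    lintegral_eq_lintegral_meas_lt _ (Filter.Eventually.of_forall ψ0) mψ.aemeasurable,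
    ← lintegral_const_mul' _ _ ENNReal.coe_ne_top, ← lintegral_const_mul' _ _ ENNReal.ofReal_ne_top]
  apply lintegral_mono
  intro t
  have m1 : MeasurableSet {a | t < φ a} := measurableSet_lt measurable_const mφ
  have m2 : MeasurableSet {a | t < ψ a} := measurableSet_lt measurable_const mψ
  simp only
  rw [Measure.restrict_apply m1, Measure.restrict_apply m2]
  apply G0 he (m2.inter hF) hh
  rintro z ⟨hz1, hz2⟩
  obtain ⟨x, hx, s, hs, h1, h2⟩ := hT z hz2
  exact ⟨x, ⟨lt_of_lt_of_le hz1 h2, hx⟩, s, hs, h1⟩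

end

noncomputable section

/-- radial normalization -/
def nrm {n : ℕ} (x : Euc n) : Euc n := ‖x‖⁻¹ • x

lemma nrm_meas {n : ℕ} : Measurable (nrm : Euc n → Euc n) := by unfold nrm; fun_prop

lemma nrm_lip {n : ℕ} {a b : Euc n} (ha : 1 ≤ ‖a‖) (hb : 1 ≤ ‖b‖) : dist (nrm a) (nrm b) ≤ dist a b := by
  rw [dist_eq_norm, dist_eq_norm]
  refine le_of_sq_le_sq ?_ (norm_nonneg _)
  have ha0 : 0 < ‖a‖ := by linarith
  have hb0 : 0 < ‖b‖ := by linarith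
  have h1 : ‖nrm a - nrm b‖^2 = 2 - 2 * (⟪a, b⟫ / (‖a‖ * ‖b‖)) := by
    rw [norm_sub_sq_real, nrm, nrm, norm_smul, norm_smul, norm_inv, norm_norm, norm_inv, norm_norm,
      inv_mul_cancel₀ ha0.ne', inv_mul_cancel₀ hb0.ne', inner_smul_left, inner_smul_right]
    simp only [RCLike.conj_to_real]
    field_simp; ring
  have hle : ⟪a, b⟫ / (‖a‖ * ‖b‖) ≤ 1 := by
    rw [div_le_one (by positivity)]; exact real_inner_le_norm a b
  have h2 : ⟪a, b⟫ = (‖a‖ * ‖b‖) * (⟪a, b⟫ / (‖a‖ * ‖b‖)) := by field_simp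
  rw [h1, norm_sub_sq_real]
  set q := ⟪a, b⟫ / (‖a‖ * ‖b‖)
  rw [h2]
  have h3 : 1 ≤ ‖a‖ * ‖b‖ := by nlinarith
  nlinarith [sq_nonneg (‖a‖ - ‖b‖), mul_nonneg (sub_nonneg.2 h3) (sub_nonneg.2 hle)]

lemma cap_le {m : ℕ} {u : Euc (m+1)} (hu : ‖u‖ = 1) {κ : ℝ} (hκ : 0 < κ) {A : Set (Euc (m+1))}
    (mA : MeasurableSet A) (hA1 : ∀ x ∈ A, ‖x‖ = 1) (hAk : ∀ x ∈ A, κ < ⟪x, u⟫) :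
    ENNReal.ofReal (κ^(m+1)) * μH[(m:ℝ)] A ≤ cH m * ((m+1 : ℕ) : ℝ≥0∞) * volume (nrm ⁻¹' A ∩ ball 0 1) := by
  obtain ⟨J, P, hJ, mp, hP, hx⟩ := frame u hu
  set ψ : Euc m → Euc (m+1) := fun y => nrm (u + J y) with hψ
  have huJ : ∀ y, ⟪u + J y, u⟫ = 1 := by
    intro y; rw [inner_add_left, hJ, real_inner_self_eq_norm_sq, hu]; norm_num
  have hge : ∀ y, 1 ≤ ‖u + J y‖ := by
    intro y
    have := real_inner_le_norm (u + J y) u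
    rwa [huJ, hu, mul_one] at this
  have lψ : LipschitzWith 1 ψ := by
    apply LipschitzWith.of_dist_le_mul
    intro y y'
    rw [NNReal.coe_one, one_mul]
    refine (nrm_lip (hge y) (hge y')).trans ?_
    rw [dist_add_left, J.dist_map]
  set A' := ψ ⁻¹' A with hA'
  have mA' : MeasurableSet A' := lψ.continuous.measurable mA
  have sub : A ⊆ ψ '' A' := by
    intro a ha
    have h1 := hAk a ha
    have h0 : 0 < ⟪a, u⟫ := hκ.trans h1
    have e1 : u + J (P ((⟪a, u⟫)⁻¹ • a)) = (⟪a, u⟫)⁻¹ • a := by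
      have := hx ((⟪a, u⟫)⁻¹ • a)
      rw [inner_smul_left] at this
      simp only [RCLike.conj_to_real, inv_mul_cancel₀ h0.ne', one_smul] at this
      exact this.symm
    have e2 : ψ (P ((⟪a, u⟫)⁻¹ • a)) = a := by
      simp only [hψ, e1, nrm]
      rw [norm_smul, hA1 a ha, norm_inv, Real.norm_of_nonneg h0.le, smul_smul, mul_one, inv_inv,
        mul_inv_cancel₀ h0.ne', one_smul]
    exact ⟨_, by rw [hA', mem_preimage, e2]; exact ha, e2⟩
  have H1 : μH[(m:ℝ)] A ≤ cH m * volume A' := by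
    refine (measure_mono sub).trans ?_
    have := lψ.hausdorffMeasure_image_le (d := (m:ℝ)) (by positivity) A'
    rw [cH_eq m] at this
    simpa using this
  have mC : MeasurableSet (nrm ⁻¹' A ∩ ball 0 1) := (nrm_meas mA).inter measurableSet_ball
  have H2 : ENNReal.ofReal (κ^(m+1)) * volume A' ≤ ((m+1 : ℕ) : ℝ≥0∞) * volume (nrm ⁻¹' A ∩ ball 0 1) := by
    rw [← mp.measure_preimage mC.nullMeasurableSet, Measure.prod_apply (mp.measurable mC)]
    have h1 : ∀ s ∈ Ioo 0 κ, ENNReal.ofReal (s^m) * volume A' ≤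
        volume (Prod.mk s ⁻¹' ((fun p : ℝ × Euc m => p.1 • u + J p.2) ⁻¹' (nrm ⁻¹' A ∩ ball 0 1))) := by
      intro s hs
      have := Measure.addHaar_smul (volume : Measure (Euc m)) s A'
      rw [abs_of_nonneg (pow_nonneg hs.1.le _)] at this
      simp only [finrank_euclideanSpace, Fintype.card_fin] at this
      rw [← this]
      apply measure_mono
      rintro _ ⟨y, hy, rfl⟩
      have e3 : s • u + J (s • y) = s • (u + J y) := by rw [J.map_smul, smul_add]
      have p1 : 0 < ‖u + J y‖ := by linarith [hge y]
      have p2 := hAk _ hy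
      simp only [hψ, nrm] at p2
      rw [inner_smul_left, huJ] at p2
      simp only [RCLike.conj_to_real, mul_one] at p2
      have p3 : κ * ‖u + J y‖ < 1 := by
        have := mul_lt_mul_of_pos_right p2 p1
        rwa [inv_mul_cancel₀ p1.ne'] at this
      refine ⟨?_, ?_⟩
      · simp only [mem_preimage]
        rw [e3, nrm, norm_smul, Real.norm_of_nonneg hs.1.le, smul_smul, mul_inv,
          mul_comm s⁻¹, mul_assoc, inv_mul_cancel₀ hs.1.ne', mul_one]
        exact hy
      · simp only
        rw [e3, mem_ball_zero_iff, norm_smul, Real.norm_of_nonneg hs.1.le]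
        nlinarith [hs.2]
    have h2 : ∫⁻ s in Ioo 0 κ, ENNReal.ofReal (s^m) = ENNReal.ofReal (κ^(m+1)/(m+1)) := by
      rw [← ofReal_integral_eq_lintegral_ofReal]
      · rw [← integral_Ioc_eq_integral_Ioo, ← intervalIntegral.integral_of_le hκ.le, integral_pow]
        simp
      · have : IntegrableOn (fun s : ℝ => s^m) (Icc 0 κ) := (by fun_prop : Continuous fun s : ℝ => s^m).continuousOn.integrableOn_Icc
        exact this.mono_set Ioo_subset_Icc_self
      · filter_upwards [ae_restrict_mem measurableSet_Ioo] with s hs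
        exact pow_nonneg hs.1.le _
    calc ENNReal.ofReal (κ^(m+1)) * volume A'
        = ((m+1 : ℕ) : ℝ≥0∞) * (ENNReal.ofReal (κ^(m+1)/(m+1)) * volume A') := by
          rw [← mul_assoc]
          congr 1
          rw [← ENNReal.ofReal_natCast, ← ENNReal.ofReal_mul (by positivity)]
          congr 1; push_cast; field_simp
      _ = ((m+1 : ℕ) : ℝ≥0∞) * ∫⁻ s in Ioo 0 κ, ENNReal.ofReal (s^m) * volume A' := by
          rw [lintegral_mul_const _ (by fun_prop), h2]
      _ ≤ _ := by
          refine mul_le_mul' le_rfl ?_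
          refine le_trans ?_ (setLIntegral_le_lintegral (Ioo 0 κ) _)
          exact setLIntegral_mono' measurableSet_Ioo h1
  calc ENNReal.ofReal (κ^(m+1)) * μH[(m:ℝ)] A ≤ ENNReal.ofReal (κ^(m+1)) * (cH m * volume A') := by gcongr
    _ = cH m * (ENNReal.ofReal (κ^(m+1)) * volume A') := by ring
    _ ≤ _ := by rw [mul_assoc]; gcongr

lemma sphere_le {m : ℕ} {A : Set (Euc (m+1))} (mA : MeasurableSet A) (hA1 : ∀ x ∈ A, ‖x‖ = 1) :
    μH[(m:ℝ)] A ≤ cH m * ((m+1 : ℕ) : ℝ≥0∞) * volume (nrm ⁻¹' A ∩ ball 0 1) := by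
  haveI : Nonempty (sphere (0 : Euc (m+1)) 1) :=
    ⟨⟨EuclideanSpace.single 0 1, by simp⟩⟩
  set U := TopologicalSpace.denseSeq (sphere (0 : Euc (m+1)) 1) with hU
  have hU1 : ∀ i, ‖(U i : Euc (m+1))‖ = 1 := fun i => mem_sphere_zero_iff_norm.1 (U i).2
  have key : ∀ κ : ℝ, 0 < κ → κ < 1 → ENNReal.ofReal (κ^(m+1)) * μH[(m:ℝ)] A ≤
      cH m * ((m+1 : ℕ) : ℝ≥0∞) * volume (nrm ⁻¹' A ∩ ball 0 1) := by
    intro κ hκ hκ1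
    set Q : ℕ → Set (Euc (m+1)) := fun i => {x | κ < ⟪x, (U i : Euc (m+1))⟫} with hQ
    have mQ : ∀ i, MeasurableSet (Q i) := fun i => measurableSet_lt measurable_const (by fun_prop)
    set B : ℕ → Set (Euc (m+1)) := fun i => A ∩ disjointed Q i with hB
    have mB : ∀ i, MeasurableSet (B i) := fun i => mA.inter (MeasurableSet.disjointed mQ i)
    have dB : Pairwise (Function.onFun Disjoint B) := fun i j hij =>
      (disjoint_disjointed Q hij).mono inter_subset_right inter_subset_right
    have hAB : A = ⋃ i, B i := by
      rw [hB, ← inter_iUnion, iUnion_disjointed]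
      refine (inter_eq_left.2 fun x hx => ?_).symm
      obtain ⟨i, hi⟩ : ∃ i, κ < ⟪x, (U i : Euc (m+1))⟫ := by
        have hd := TopologicalSpace.denseRange_denseSeq (sphere (0 : Euc (m+1)) 1)
        have ho : IsOpen {y : sphere (0 : Euc (m+1)) 1 | κ < ⟪x, (y : Euc (m+1))⟫} :=
          isOpen_lt continuous_const (by fun_prop)
        obtain ⟨i, hi⟩ := hd.exists_mem_open ho ⟨⟨x, by simpa using hA1 x hx⟩, by
          simp only [mem_setOf_eq, real_inner_self_eq_norm_sq, hA1 x hx]; linarith⟩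
        exact ⟨i, hi⟩
      exact mem_iUnion.2 ⟨i, hi⟩
    have e1 : μH[(m:ℝ)] A = ∑' i, μH[(m:ℝ)] (B i) := by
      conv_lhs => rw [hAB]
      exact measure_iUnion dB mB
    have e2 : volume (nrm ⁻¹' A ∩ ball 0 1) = ∑' i, volume (nrm ⁻¹' (B i) ∩ ball 0 1) := by
      conv_lhs => rw [hAB]
      rw [preimage_iUnion, iUnion_inter]
      refine measure_iUnion (fun i j hij => ?_) (fun i => (nrm_meas (mB i)).inter measurableSet_ball)
      exact ((dB hij).preimage nrm).mono inter_subset_left inter_subset_left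
    rw [e1, e2, ← ENNReal.tsum_mul_left, ← ENNReal.tsum_mul_left]
    refine ENNReal.tsum_le_tsum fun i => ?_
    refine cap_le (hU1 i) hκ (mB i) (fun x hx => hA1 x hx.1) (fun x hx => ?_)
    exact disjointed_subset Q i hx.2
  have hl : Filter.Tendsto (fun κ : ℝ => ENNReal.ofReal (κ^(m+1)) * μH[(m:ℝ)] A) (𝓝[<] 1)
        (𝓝 (ENNReal.ofReal (1^(m+1)) * μH[(m:ℝ)] A)) := by
    apply ENNReal.Tendsto.mul_const _ (Or.inl (by simp))
    apply Filter.Tendsto.mono_left _ nhdsWithin_le_nhds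
    apply Continuous.tendsto (f := fun η : ℝ => ENNReal.ofReal (η^(m+1)))
    exact ENNReal.continuous_ofReal.comp (by fun_prop)
  rw [one_pow, ENNReal.ofReal_one, one_mul] at hl
  refine le_of_tendsto hl ?_
  filter_upwards [Ioo_mem_nhdsLT (show (0:ℝ) < 1 by norm_num)] with κ hκ
  exact key κ hκ.1 hκ.2

lemma inv_pow_formula {α s : ℝ} (hα : 0 < α) (hs : 0 < s) (hs1 : s < 1) :
    ENNReal.ofReal (s ^ (-α)) = 1 + ∫⁻ r in Ioo 0 1, ENNReal.ofReal (α * r ^ (-α-1)) * (Ioi s).indicator 1 r := by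
  have e1 : ∫⁻ r in Ioo 0 1, ENNReal.ofReal (α * r ^ (-α-1)) * (Ioi s).indicator 1 r
      = ∫⁻ r in Ioo s 1, ENNReal.ofReal (α * r ^ (-α-1)) := by
    have : ∀ r, ENNReal.ofReal (α * r ^ (-α-1)) * (Ioi s).indicator (1 : ℝ → ℝ≥0∞) r =
        (Ioi s).indicator (fun r => ENNReal.ofReal (α * r ^ (-α-1))) r := by
      intro r
      by_cases hr : r ∈ Ioi s
      · rw [indicator_of_mem hr, indicator_of_mem hr]; simp
      · rw [indicator_of_notMem hr, indicator_of_notMem hr]; simp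
    simp only [this]
    rw [lintegral_indicator measurableSet_Ioi, Measure.restrict_restrict measurableSet_Ioi]
    congr 2
    ext r; simp only [mem_inter_iff, mem_Ioi, mem_Ioo]
    constructor
    · rintro ⟨h1, h2⟩; exact ⟨h1, h2.2⟩
    · rintro ⟨h1, h2⟩; exact ⟨h1, by linarith, h2⟩
  have hn0 : (0:ℝ) ∉ Set.uIcc s 1 := by
    rw [uIcc_of_le hs1.le]; intro h; linarith [h.1]
  have e2 : ∫⁻ r in Ioo s 1, ENNReal.ofReal (α * r ^ (-α-1)) = ENNReal.ofReal (s ^ (-α) - 1) := by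
    rw [← ofReal_integral_eq_lintegral_ofReal]
    · rw [← integral_Ioc_eq_integral_Ioo, ← intervalIntegral.integral_of_le hs1.le,
        intervalIntegral.integral_const_mul, integral_rpow (Or.inr ⟨by linarith, hn0⟩)]
      rw [sub_add_cancel, Real.one_rpow]
      congr 1; field_simp; ring
    · have : IntegrableOn (fun r : ℝ => α * r ^ (-α-1)) (Icc s 1) := by
        apply ContinuousOn.integrableOn_Icc
        apply continuousOn_const.mul
        intro x hx
        exact (Real.continuousAt_rpow_const _ _ (Or.inl (by linarith [hx.1]))).continuousWithinAt
      exact this.mono_set Ioo_subset_Icc_self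
    · filter_upwards [ae_restrict_mem measurableSet_Ioo] with r hr
      have : 0 < r := hs.trans hr.1
      simp only [Pi.zero_apply]; positivity
  have h1 : 1 ≤ s ^ (-α) := Real.one_le_rpow_of_pos_of_le_one_of_nonpos hs hs1.le (by linarith)
  rw [e1, e2, ← ENNReal.ofReal_one, ← ENNReal.ofReal_add (by norm_num) (by linarith)]
  congr 1; ring

namespace Ctx
open scoped Pointwise in
lemma radial {n : ℕ} {S : Set (Euc n)} {α : ℝ} {w : Euc n → ℝ} (h : Ctx S α w) :
    ∫⁻ x in BS S, ENNReal.ofReal (‖x‖ ^ (-α)) ∂(wm S w) = ENNReal.ofReal (((n:ℝ)+α)/n) * wm S w (BS S) := by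
  have hn : (0:ℝ) < n := by exact_mod_cast h.hn
  have hα := h.hα
  have mB := h.BSo.measurableSet
  have e1 : ∫⁻ x in BS S, ENNReal.ofReal (‖x‖ ^ (-α)) ∂(wm S w) = ∫⁻ x in BS S, (1 + ∫⁻ r in Ioo 0 1, ENNReal.ofReal (α * r ^ (-α-1)) * (Ioi ‖x‖).indicator 1 r) ∂(wm S w) := by
    apply setLIntegral_congr_fun mB
    intro x hx
    apply inv_pow_formula h.hα
    · apply norm_pos_iff.2; intro h0; exact h.z (h0 ▸ hx.2)
    · exact mem_ball_zero_iff.1 hx.1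
  haveI : SFinite (wm S w) := by unfold wm; infer_instance
  have mf : Measurable (fun p : Euc n × ℝ => ENNReal.ofReal (α * p.2 ^ (-α-1)) * (Ioi ‖p.1‖).indicator (1 : ℝ → ℝ≥0∞) p.2) := by
    apply Measurable.mul (by fun_prop)
    have : (fun p : Euc n × ℝ => (Ioi ‖p.1‖).indicator (1 : ℝ → ℝ≥0∞) p.2) =
        {p : Euc n × ℝ | ‖p.1‖ < p.2}.indicator 1 := by
      ext p; simp [indicator]
    rw [this]
    exact measurable_one.indicator (measurableSet_lt (by fun_prop) (by fun_prop))
  rw [e1, lintegral_add_left measurable_const, lintegral_lintegral_swap mf.aemeasurable, lintegral_one,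
    Measure.restrict_apply_univ]
  have e2 : ∀ r ∈ Ioo (0:ℝ) 1, ∫⁻ x in BS S, ENNReal.ofReal (α * r ^ (-α-1)) * (Ioi ‖x‖).indicator 1 r ∂(wm S w)
      = ENNReal.ofReal (α * r ^ ((n:ℝ)-1)) * wm S w (BS S) := by
    intro r hr
    have hb : ∀ x : Euc n, (Ioi ‖x‖).indicator (1 : ℝ → ℝ≥0∞) r = (ball 0 r).indicator 1 x := by
      intro x; simp [indicator]
    simp only [hb]
    rw [lintegral_const_mul _ (measurable_one.indicator measurableSet_ball), lintegral_indicator_one measurableSet_ball,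
      Measure.restrict_apply measurableSet_ball]
    have : ball (0 : Euc n) r ∩ BS S = r • BS S := by
      ext x
      rw [mem_smul_set_iff_inv_smul_mem₀ hr.1.ne']
      simp only [BS, mem_inter_iff, mem_ball_zero_iff, norm_smul, norm_inv, Real.norm_of_nonneg hr.1.le]
      rw [inv_mul_lt_iff₀ hr.1, mul_one]
      constructor
      · rintro ⟨h1, h2, h3⟩; exact ⟨h1, h.cone h3 (inv_pos.2 hr.1)⟩
      · rintro ⟨h1, h2⟩
        have := h.cone h2 hr.1
        rw [smul_smul, mul_inv_cancel₀ hr.1.ne', one_smul] at this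
        exact ⟨h1, h1.trans hr.2, this⟩
    rw [this, h.wm_smul mB hr.1, ← mul_assoc, ← ENNReal.ofReal_mul (by have := hr.1; positivity), mul_assoc, ← Real.rpow_add hr.1]
    congr 4; ring
  rw [setLIntegral_congr_fun measurableSet_Ioo e2, lintegral_mul_const _ (by fun_prop)]
  have e3 : ∫⁻ r in Ioo (0:ℝ) 1, ENNReal.ofReal (α * r ^ ((n:ℝ)-1)) = ENNReal.ofReal (α / n) := by
    rw [← ofReal_integral_eq_lintegral_ofReal]
    · rw [← integral_Ioc_eq_integral_Ioo, ← intervalIntegral.integral_of_le (by norm_num),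
        intervalIntegral.integral_const_mul, integral_rpow (Or.inl (by linarith))]
      rw [sub_add_cancel, Real.one_rpow, Real.zero_rpow hn.ne']
      congr 1; field_simp; ring
    · have := (intervalIntegral.intervalIntegrable_rpow' (a := 0) (b := 1) (r := (n:ℝ)-1) (by linarith)).const_mul α
      rw [intervalIntegrable_iff_integrableOn_Ioo_of_le (by norm_num)] at this
      exact this
    · filter_upwards [ae_restrict_mem measurableSet_Ioo] with r hr
      have := hr.1
      simp only [Pi.zero_apply]; positivity
  rw [e3, add_div, div_self hn.ne', ENNReal.ofReal_add (by norm_num) (by positivity), ENNReal.ofReal_one]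
  ring

lemma perB {m : ℕ} {S : Set (Euc (m+1))} {α : ℝ} {w : Euc (m+1) → ℝ} (h : Ctx S α w) :
    ∫⁻ x in sphere 0 1 ∩ S, ENNReal.ofReal (w x) ∂(μH[(m:ℝ)]) ≤
      cH m * ENNReal.ofReal ((((m+1:ℕ):ℝ)+α)) * wm S w (BS S) := by
  have mS := h.op.measurableSet
  have mA : MeasurableSet (sphere (0 : Euc (m+1)) 1 ∩ S) := isClosed_sphere.measurableSet.inter mS
  set σ : Measure (Euc (m+1)) := (volume.restrict (ball 0 1)).map nrm with hσ
  have hle : (μH[(m:ℝ)] : Measure (Euc (m+1))).restrict (sphere 0 1 ∩ S) ≤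
      ((cH m : ℝ≥0∞) * ((m+1 : ℕ) : ℝ≥0∞)) • σ.restrict (sphere 0 1 ∩ S) := by
    refine Measure.le_iff.2 fun A mA' => ?_
    rw [Measure.restrict_apply mA', Measure.smul_apply, Measure.restrict_apply mA', hσ,
      Measure.map_apply nrm_meas (mA'.inter mA), Measure.restrict_apply (nrm_meas (mA'.inter mA)), smul_eq_mul]
    exact sphere_le (mA'.inter mA) (fun x hx => mem_sphere_zero_iff_norm.1 hx.2.1)
  have hpre : nrm ⁻¹' (sphere (0 : Euc (m+1)) 1 ∩ S) ∩ ball 0 1 = BS S := by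
    ext x
    simp only [mem_inter_iff, mem_preimage, BS, mem_sphere_zero_iff_norm]
    by_cases hx : x = 0
    · subst hx; simp [nrm, h.z]
    · have hp : 0 < ‖x‖ := norm_pos_iff.2 hx
      have h1 : ‖nrm x‖ = 1 := by rw [nrm, norm_smul, norm_inv, norm_norm, inv_mul_cancel₀ hp.ne']
      have h2 : nrm x ∈ S ↔ x ∈ S := by
        constructor
        · intro h3
          have := h.cone h3 hp
          rwa [nrm, smul_smul, mul_inv_cancel₀ hp.ne', one_smul] at this
        · intro h3; exact h.cone h3 (inv_pos.2 hp)
      rw [h2]; tauto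
  have mw : Measurable (wd S w) := h.wd_meas
  have e0 : ∀ x ∈ S, ENNReal.ofReal (w x) = wd S w x := by
    intro x hx; rw [wd, indicator_of_mem hx]
  calc ∫⁻ x in sphere 0 1 ∩ S, ENNReal.ofReal (w x) ∂(μH[(m:ℝ)])
      = ∫⁻ x in sphere 0 1 ∩ S, wd S w x ∂(μH[(m:ℝ)]) := setLIntegral_congr_fun mA fun x hx => e0 x hx.2
    _ ≤ ∫⁻ x, wd S w x ∂(((cH m : ℝ≥0∞) * ((m+1 : ℕ) : ℝ≥0∞)) • σ.restrict (sphere 0 1 ∩ S)) := lintegral_mono' hle le_rfl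
    _ = (cH m : ℝ≥0∞) * ((m+1 : ℕ) : ℝ≥0∞) * ∫⁻ x in BS S, wd S w (nrm x) := by
        rw [lintegral_smul_measure, smul_eq_mul, hσ, Measure.restrict_map nrm_meas mA, lintegral_map mw nrm_meas,
          Measure.restrict_restrict (nrm_meas mA), hpre]
    _ = (cH m : ℝ≥0∞) * ((m+1 : ℕ) : ℝ≥0∞) * ∫⁻ x in BS S, ENNReal.ofReal (‖x‖ ^ (-α)) ∂(wm S w) := by
        congr 1
        rw [wm, restrict_withDensity h.BSo.measurableSet, lintegral_withDensity_eq_lintegral_mul _ mw (by fun_prop)]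
        refine setLIntegral_congr_fun h.BSo.measurableSet fun x hx => ?_
        have hp : 0 < ‖x‖ := by apply norm_pos_iff.2; intro h0; exact h.z (h0 ▸ hx.2)
        simp only [Pi.mul_apply]
        rw [← e0 x hx.2, ← e0 (nrm x) (h.cone hx.2 (inv_pos.2 hp)), nrm, h.hom hx.2 (inv_pos.2 hp),
          ENNReal.ofReal_mul (by positivity), mul_comm, Real.inv_rpow hp.le, Real.rpow_neg hp.le]
    _ = _ := by
        rw [h.radial, mul_assoc, mul_assoc]
        congr 1
        rw [← mul_assoc, ← ENNReal.ofReal_natCast, ← ENNReal.ofReal_mul (by positivity)]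
        congr 2
        field_simp
end Ctx

end

noncomputable section

structure Mol {n : ℕ} (S : Set (Euc n)) (ρ : Euc n → ℝ) (y : Euc n) (r R : ℝ) : Prop where
  sm : ContDiff ℝ 2 ρ
  nn : ∀ u, 0 ≤ ρ u
  int : ∫ u, ρ u = 1
  sup : ∀ u, ρ u ≠ 0 → u ∈ closedBall y r
  hr : r < R
  hR : closedBall y R ⊆ S

/-- mollified indicator -/
def mf {n : ℕ} (E : Set (Euc n)) (ρ : Euc n → ℝ) (x : Euc n) : ℝ := ∫ z in E, ρ (z - x)
/-- its gradient -/
def mp {n : ℕ} (E : Set (Euc n)) (ρ : Euc n → ℝ) (x : Euc n) : Euc n := - ∫ z in E, gradient ρ (z - x)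

namespace Mol
variable {n : ℕ} {S : Set (Euc n)} {ρ : Euc n → ℝ} {y : Euc n} {r R : ℝ}

lemma tsup (M : Mol S ρ y r R) : tsupport ρ ⊆ closedBall y r :=
  closure_minimal (fun u hu => M.sup u hu) isClosed_closedBall
lemma cpt (M : Mol S ρ y r R) : HasCompactSupport ρ :=
  HasCompactSupport.of_support_subset_isCompact (isCompact_closedBall y r) (fun u hu => M.sup u hu)
lemma cont (M : Mol S ρ y r R) : Continuous ρ := M.sm.continuous
lemma intb (M : Mol S ρ y r R) : Integrable ρ := M.cont.integrable_of_hasCompactSupport M.cpt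
lemma diff (M : Mol S ρ y r R) : Differentiable ℝ ρ := M.sm.differentiable (by norm_num)
lemma fdc (M : Mol S ρ y r R) : ContDiff ℝ 1 (fderiv ℝ ρ) := M.sm.fderiv_right (by norm_num)
lemma fd0 (M : Mol S ρ y r R) {u : Euc n} (hu : u ∉ closedBall y r) : fderiv ℝ ρ u = 0 := by
  by_contra h
  exact hu (M.tsup (support_fderiv_subset ℝ h))
lemma gradc (M : Mol S ρ y r R) : Continuous (gradient ρ) := by
  have := M.fdc.continuous
  unfold gradient
  fun_prop
lemma grad0 (M : Mol S ρ y r R) {u : Euc n} (hu : u ∉ closedBall y r) : gradient ρ u = 0 := by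
  rw [gradient, M.fd0 hu, map_zero]
lemma gradcpt (M : Mol S ρ y r R) : HasCompactSupport (gradient ρ) :=
  HasCompactSupport.of_support_subset_isCompact (isCompact_closedBall y r) (fun u hu => by
    by_contra h; exact hu (M.grad0 h))
lemma gradi (M : Mol S ρ y r R) : Integrable (gradient ρ) :=
  M.gradc.integrable_of_hasCompactSupport M.gradcpt
lemma grad_inner (M : Mol S ρ y r R) (u v : Euc n) : ⟪gradient ρ u, v⟫ = fderiv ℝ ρ u v := by
  rw [gradient, InnerProductSpace.toDual_symm_apply]
lemma lip (M : Mol S ρ y r R) : ∃ L : ℝ, 0 < L ∧ (∀ u v, |ρ u - ρ v| ≤ L * ‖u - v‖) := by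
  obtain ⟨C, hC⟩ := (M.sm.of_le (by norm_num) : ContDiff ℝ 1 ρ).lipschitzWith_of_hasCompactSupport M.cpt (by norm_num)
  refine ⟨C + 1, by positivity, fun u v => ?_⟩
  have := hC.dist_le_mul u v
  rw [Real.dist_eq, dist_eq_norm] at this
  nlinarith [norm_nonneg (u - v)]
lemma taylor (M : Mol S ρ y r R) : ∃ L : ℝ, 0 < L ∧ ∀ ε, 0 < ε → ε ≤ R - r → ∀ u v, ‖v‖ ≤ ε →
    |ρ (u - v) - ρ u + fderiv ℝ ρ u v| ≤ L * ε^2 * (closedBall y R).indicator 1 u := by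
  have hc : HasCompactSupport (fderiv ℝ ρ) := M.cpt.fderiv ℝ
  obtain ⟨C, hC⟩ := M.fdc.lipschitzWith_of_hasCompactSupport hc (by norm_num)
  refine ⟨C + 1, by positivity, fun ε hε hεR u v hv => ?_⟩
  by_cases hu : u ∈ closedBall y R
  · rw [indicator_of_mem hu, Pi.one_apply, mul_one]
    have h1 := Convex.norm_image_sub_le_of_norm_hasFDerivWithin_le' (𝕜 := ℝ) (f := ρ) (f' := fderiv ℝ ρ) (φ := fderiv ℝ ρ u)
      (C := (C+1) * ε) (s := closedBall u ε) (x := u) (y := u - v)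
      (fun x _ => (M.diff x).hasFDerivAt.hasFDerivWithinAt)
      (fun x hx => by
        have := hC.dist_le_mul x u
        rw [dist_eq_norm] at this
        have h2 := mem_closedBall.1 hx
        have : (C:ℝ) * dist x u ≤ C * ε := by gcongr
        nlinarith)
      (convex_closedBall u ε) (mem_closedBall_self hε.le) (by
        rw [mem_closedBall, dist_eq_norm, sub_sub_cancel_left, norm_neg]; exact hv)
    rw [sub_sub_cancel_left, map_neg, norm_neg, sub_neg_eq_add, Real.norm_eq_abs] at h1
    refine h1.trans ?_
    have : ((C:ℝ)+1) * ε * ‖v‖ ≤ (C+1) * ε * ε := by gcongr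
    nlinarith
  · rw [indicator_of_notMem hu, mul_zero]
    rw [mem_closedBall, not_le, dist_eq_norm] at hu
    have hr := M.hr
    have a1 : u ∉ closedBall y r := by
      rw [mem_closedBall, not_le, dist_eq_norm]; linarith
    have a2 : u - v ∉ closedBall y r := by
      rw [mem_closedBall, not_le, dist_eq_norm]
      have : ‖u - y‖ ≤ ‖u - v - y‖ + ‖v‖ := by
        calc ‖u - y‖ = ‖(u - v - y) + v‖ := by congr 1; abel
          _ ≤ _ := norm_add_le _ _
      linarith
    have z1 : ρ u = 0 := by by_contra h; exact a1 (M.sup u h)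
    have z2 : ρ (u - v) = 0 := by by_contra h; exact a2 (M.sup _ h)
    rw [z1, z2, M.fd0 a1]; simp
end Mol

namespace Ctx
variable {n : ℕ} {S : Set (Euc n)} {α : ℝ} {w : Euc n → ℝ}

lemma CV (h : Ctx S α w) {τ : Measure (Euc n)} [SFinite τ] {k : Euc n → ℝ≥0∞} (mk : Measurable k)
    (hk : ∀ v, k v ≠ 0 → v ∈ S) :
    ∫⁻ x, (∫⁻ z, k (z - x) ∂τ) ∂(wm S w) ≤ (∫⁻ v, k v) * ∫⁻ z, wd S w z ∂τ := by
  have mk2 : Measurable (fun p : Euc n × Euc n => k (p.2 - p.1)) := by fun_prop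
  have mw := h.wd_meas
  have m1 : Measurable (fun x => ∫⁻ z, k (z - x) ∂τ) := mk2.lintegral_prod_right'
  rw [wm, lintegral_withDensity_eq_lintegral_mul _ mw m1]
  calc ∫⁻ x, (wd S w * fun x => ∫⁻ z, k (z - x) ∂τ) x
      = ∫⁻ x, ∫⁻ z, wd S w x * k (z - x) ∂τ := by
        refine lintegral_congr fun x => ?_
        rw [Pi.mul_apply, lintegral_const_mul _ (by fun_prop)]
    _ = ∫⁻ z, ∫⁻ x, wd S w x * k (z - x) ∂volume ∂τ := by
        apply lintegral_lintegral_swap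
        exact ((mw.comp measurable_fst).mul mk2).aemeasurable
    _ ≤ ∫⁻ z, ∫⁻ x, wd S w z * k (z - x) ∂volume ∂τ := by
        refine lintegral_mono fun z => lintegral_mono fun x => ?_
        simp only
        by_cases h0 : k (z - x) = 0
        · rw [h0]; simp
        · have hv := hk _ h0
          by_cases hx : x ∈ S
          · have hz : z = x + (z - x) := by abel
            have hzS : z ∈ S := by rw [hz]; exact h.add hx hv
            rw [wd, indicator_of_mem hx, indicator_of_mem hzS]
            gcongr
            conv_rhs => rw [hz]
            exact h.wmono hx hv
          · rw [wd, indicator_of_notMem hx, zero_mul]; exact zero_le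
    _ = ∫⁻ z, wd S w z * (∫⁻ v, k v) ∂τ := by
        refine lintegral_congr fun z => ?_
        rw [lintegral_const_mul _ (by fun_prop), lintegral_sub_left_eq_self k z]
    _ = _ := by rw [lintegral_mul_const _ mw, mul_comm]

variable {ρ : Euc n → ℝ} {y : Euc n} {r R : ℝ} {E : Set (Euc n)}

lemma wmE (h : Ctx S α w) (mE : MeasurableSet E) : ∫⁻ z in E, wd S w z = wm S w E := (h.wm_apply mE).symm

lemma ii (M : Mol S ρ y r R) (x : Euc n) : Integrable (fun z => ρ (z - x)) (volume.restrict E) :=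
  (M.intb.comp_sub_right x).restrict
lemma ig (M : Mol S ρ y r R) (x : Euc n) : Integrable (fun z => gradient ρ (z - x)) (volume.restrict E) :=
  (M.gradi.comp_sub_right x).restrict

lemma mf_of (M : Mol S ρ y r R) (x : Euc n) : ENNReal.ofReal (mf E ρ x) = ∫⁻ z in E, ENNReal.ofReal (ρ (z - x)) := by
  rw [mf, ofReal_integral_eq_lintegral_ofReal (ii M x) (Filter.Eventually.of_forall fun z => M.nn _)]

lemma mf_nn (M : Mol S ρ y r R) (x : Euc n) : 0 ≤ mf E ρ x := integral_nonneg fun z => M.nn _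

lemma mf_meas (M : Mol S ρ y r R) : Measurable (mf E ρ) := by
  have : StronglyMeasurable (fun p : Euc n × Euc n => ρ (p.2 - p.1)) := by
    have := M.cont
    exact Continuous.stronglyMeasurable (by fun_prop)
  exact (this.integral_prod_right' (ν := volume.restrict E)).measurable
lemma mp_meas (M : Mol S ρ y r R) : Measurable (mp E ρ) := by
  have : StronglyMeasurable (fun p : Euc n × Euc n => gradient ρ (p.2 - p.1)) := by
    have := M.gradc
    exact Continuous.stronglyMeasurable (by fun_prop)
  exact (this.integral_prod_right' (ν := volume.restrict E)).measurable.neg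

lemma mf_int (h : Ctx S α w) (M : Mol S ρ y r R) (mE : MeasurableSet E) :
    ∫⁻ x, ENNReal.ofReal (mf E ρ x) ∂(wm S w) ≤ wm S w E := by
  have := M.cont
  simp only [mf_of M]
  refine (h.CV (τ := volume.restrict E) (k := fun v => ENNReal.ofReal (ρ v)) (by fun_prop) (fun v hv => ?_)).trans ?_
  · apply M.hR
    have : ρ v ≠ 0 := by intro h0; simp [h0] at hv
    exact closedBall_subset_closedBall M.hr.le (M.sup v this)
  · rw [h.wmE mE, ← ofReal_integral_eq_lintegral_ofReal M.intb (Filter.Eventually.of_forall M.nn), M.int]; simp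

lemma mtaylor (M : Mol S ρ y r R) : ∃ L : ℝ, 0 < L ∧ ∀ ε, 0 < ε → ε ≤ R - r → ∀ x v : Euc n, ‖v‖ ≤ ε →
    |mf E ρ (x + v) - mf E ρ x - ⟪mp E ρ x, v⟫| ≤ L * ε^2 * (∫ z in E, (closedBall y R).indicator (1 : Euc n → ℝ) (z - x)) := by
  obtain ⟨L, hL, hT⟩ := M.taylor
  refine ⟨L, hL, fun ε hε hεR x v hv => ?_⟩
  have i3 : Integrable (fun z => ⟪gradient ρ (z - x), v⟫) (volume.restrict E) := (ig M x).inner_const v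
  have e1 : ⟪mp E ρ x, v⟫ = - ∫ z in E, ⟪gradient ρ (z - x), v⟫ := by
    rw [mp, inner_neg_left, real_inner_comm, ← integral_inner (ig M x) v]
    simp only [real_inner_comm]
  have e2 : mf E ρ (x + v) - mf E ρ x - ⟪mp E ρ x, v⟫ =
      ∫ z in E, (ρ (z - x - v) - ρ (z - x) + fderiv ℝ ρ (z - x) v) := by
    have i1 : Integrable (fun z => ρ (z - x - v)) (volume.restrict E) := by
      have := ii (E := E) M (x + v)
      simpa only [sub_add_eq_sub_sub] using this
    rw [e1, mf, mf]
    simp only [← M.grad_inner, sub_add_eq_sub_sub]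
    have s1 := integral_add (i1.sub (ii M x)) i3
    have s2 := integral_sub i1 (ii M x)
    simp only [Pi.sub_apply] at s1
    rw [s1, s2]; ring
  rw [e2, ← integral_const_mul]
  refine (abs_integral_le_integral_abs).trans ?_
  have ik : Integrable (fun z => (closedBall y R).indicator (1 : Euc n → ℝ) (z - x)) (volume.restrict E) := by
    have : Integrable ((closedBall y R).indicator (1 : Euc n → ℝ)) := by
      rw [integrable_indicator_iff measurableSet_closedBall]
      exact integrableOn_const (by exact (isCompact_closedBall y R).measure_lt_top.ne)
    exact (this.comp_sub_right x).restrict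
  refine integral_mono_of_nonneg (Filter.Eventually.of_forall fun z => abs_nonneg _) (ik.const_mul _)
    (Filter.Eventually.of_forall fun z => ?_)
  exact hT ε hε hεR (z - x) v hv

lemma mtame (h : Ctx S α w) (M : Mol S ρ y r R) (mE : MeasurableSet E) (hE : wm S w E ≠ ⊤)
    (hp : Integrable (mp E ρ) (wm S w)) : Tame S w (mf E ρ) (mp E ρ) := by
  obtain ⟨L, hL, hT⟩ := mtaylor (E := E) M
  have hk : ∀ x : Euc n, Integrable (fun z => (closedBall y R).indicator (1 : Euc n → ℝ) (z - x)) (volume.restrict E) := by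
    intro x
    have : Integrable ((closedBall y R).indicator (1 : Euc n → ℝ)) := by
      rw [integrable_indicator_iff measurableSet_closedBall]
      exact integrableOn_const (by exact (isCompact_closedBall y R).measure_lt_top.ne)
    exact (this.comp_sub_right x).restrict
  set g : Euc n → ℝ := fun x => ∫ z in E, (closedBall y R).indicator (1 : Euc n → ℝ) (z - x) with hg
  have gmeas : Measurable g := by
    have : StronglyMeasurable (fun p : Euc n × Euc n => (closedBall y R).indicator (1 : Euc n → ℝ) (p.2 - p.1)) := by
      apply Measurable.stronglyMeasurable
      exact (measurable_one.indicator measurableSet_closedBall).comp (by fun_prop)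
    exact (this.integral_prod_right' (ν := volume.restrict E)).measurable
  have g0 : ∀ x, 0 ≤ g x := fun x => integral_nonneg fun z => indicator_nonneg (fun _ _ => zero_le_one) _
  have gi : Integrable g (wm S w) := by
    refine ⟨gmeas.aestronglyMeasurable, ?_⟩
    rw [hasFiniteIntegral_iff_ofReal (Filter.Eventually.of_forall g0)]
    have e1 : ∀ x, ENNReal.ofReal (g x) = ∫⁻ z in E, (closedBall y R).indicator (1 : Euc n → ℝ≥0∞) (z - x) := by
      intro x
      rw [hg, ofReal_integral_eq_lintegral_ofReal (hk x) (Filter.Eventually.of_forall fun z => indicator_nonneg (fun _ _ => zero_le_one) _)]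
      refine lintegral_congr fun z => ?_
      by_cases hz : z - x ∈ closedBall y R
      · rw [indicator_of_mem hz, indicator_of_mem hz]; simp
      · rw [indicator_of_notMem hz, indicator_of_notMem hz]; simp
    simp only [e1]
    refine lt_of_le_of_lt (h.CV (τ := volume.restrict E) (measurable_one.indicator measurableSet_closedBall)
      (fun v hv => M.hR (by by_contra h0; exact hv (indicator_of_notMem h0 _)))) ?_
    rw [h.wmE mE, lintegral_indicator_one measurableSet_closedBall]
    exact ENNReal.mul_lt_top (isCompact_closedBall y R).measure_lt_top hE.lt_top
  refine ⟨mf_meas M, mf_nn M, ?_, ?_, mp_meas M, hp, ?_⟩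
  · intro x
    calc mf E ρ x ≤ ∫ z, ρ (z - x) := setIntegral_le_integral (M.intb.comp_sub_right x)
          (Filter.Eventually.of_forall fun z => M.nn _)
      _ = 1 := by rw [integral_sub_right_eq_self ρ x, M.int]
  · refine ⟨(mf_meas M).aestronglyMeasurable, ?_⟩
    rw [hasFiniteIntegral_iff_ofReal (Filter.Eventually.of_forall (mf_nn M))]
    exact lt_of_le_of_lt (h.mf_int M mE) hE.lt_top
  · refine ⟨fun ε x => L * ε^2 * g x, R - r, sub_pos.2 M.hr, ?_, ?_, ?_⟩
    · intro ε hε _; exact gi.const_mul _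
    · have : Filter.Tendsto (fun ε : ℝ => ε * (L * ∫ x, g x ∂(wm S w))) (𝓝[>] 0) (𝓝 (0 * (L * ∫ x, g x ∂(wm S w)))) := by
        apply Filter.Tendsto.mono_left _ nhdsWithin_le_nhds
        apply Continuous.tendsto (f := fun ε : ℝ => ε * (L * ∫ x, g x ∂(wm S w))); fun_prop
      rw [zero_mul] at this
      refine this.congr' ?_
      filter_upwards [self_mem_nhdsWithin] with ε hε
      have hε' : (0:ℝ) < ε := hε
      rw [integral_const_mul]; field_simp
    · intro ε hε hεR z hz v hv
      exact hT ε hε hεR z v hv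
end Ctx

end

noncomputable section

lemma pre_frontier {X : Type*} [TopologicalSpace X] {t E : Set X} (ht : IsPreconnected t)
    (h1 : (t ∩ E).Nonempty) (h2 : (t ∩ Eᶜ).Nonempty) : (t ∩ frontier E).Nonempty := by
  by_contra hcon
  have hd : ∀ x ∈ t, x ∉ frontier E := fun x hx hf => hcon ⟨x, hx, hf⟩
  obtain ⟨a, ha, haE⟩ := h1
  obtain ⟨b, hb, hbE⟩ := h2
  obtain ⟨z, hz, hz1, hz2⟩ := ht (interior E) (interior Eᶜ) isOpen_interior isOpen_interior (by
    intro x hx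
    have hf := hd x hx
    rw [interior_compl]
    by_cases hi : x ∈ interior E
    · exact Or.inl hi
    · exact Or.inr fun hc => hf ⟨hc, hi⟩)
    ⟨a, ha, by by_contra hi; exact hd a ha ⟨subset_closure haE, hi⟩⟩
    ⟨b, hb, by rw [interior_compl]; exact fun hc => hd b hb ⟨hc, fun hi => hbE (interior_subset hi)⟩⟩
  exact interior_subset hz2 (interior_subset hz1)

namespace Ctx
variable {m : ℕ} {S : Set (Euc (m+1))} {α : ℝ} {w : Euc (m+1) → ℝ}
variable {ρ : Euc (m+1) → ℝ} {y : Euc (m+1)} {r R : ℝ} {E : Set (Euc (m+1))}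

lemma Ffin (h : Ctx S α w) {F K : Set (Euc (m+1))} (mF : MeasurableSet F) (hK : IsCompact K) (hKS : K ⊆ S)
    (hF : ∫⁻ z in F, ENNReal.ofReal (w z) ∂μH[(m:ℝ)] ≠ ⊤) : μH[(m:ℝ)] (K ∩ F) < ⊤ := by
  rcases K.eq_empty_or_nonempty with h0 | hne
  · simp [h0]
  obtain ⟨a, ha, hmin⟩ := hK.exists_isMinOn hne (h.wcont.mono hKS)
  have hp := h.wpos (hKS ha)
  have : ENNReal.ofReal (w a) * μH[(m:ℝ)] (K ∩ F) ≤ ∫⁻ z in F, ENNReal.ofReal (w z) ∂μH[(m:ℝ)] := by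
    rw [← setLIntegral_const]
    refine le_trans ?_ (lintegral_mono_set (inter_subset_right (s := K)))
    refine setLIntegral_mono' (hK.isClosed.measurableSet.inter mF) fun z hz => ?_
    exact ENNReal.ofReal_le_ofReal (hmin hz.1)
  by_contra hcon
  rw [not_lt, top_le_iff] at hcon
  rw [hcon, ENNReal.mul_top (by simpa using hp), top_le_iff] at this
  exact hF this

lemma gradbd (h : Ctx S α w) (M : Mol S ρ y r R) (hE : IsOpen E)
    (hF : ∫⁻ z in frontier E ∩ S, ENNReal.ofReal (w z) ∂μH[(m:ℝ)] ≠ ⊤) {x : Euc (m+1)} (hx : x ∈ S) :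
    cH m * ENNReal.ofReal ‖mp E ρ x‖ ≤ ∫⁻ z in frontier E ∩ S, ENNReal.ofReal (ρ (z - x)) ∂μH[(m:ℝ)] := by
  by_cases hp0 : mp E ρ x = 0
  · rw [hp0]; simp
  have hpp : 0 < ‖mp E ρ x‖ := norm_pos_iff.2 hp0
  set p := mp E ρ x with hp
  set e : Euc (m+1) := ‖p‖⁻¹ • p with he
  have he1 : ‖e‖ = 1 := by rw [he, norm_smul, norm_inv, norm_norm, inv_mul_cancel₀ hpp.ne']
  have hpe : ⟪p, e⟫ = ‖p‖ := by
    rw [he, inner_smul_right, real_inner_self_eq_norm_sq]; field_simp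
  set F := frontier E ∩ S with hFd
  have mF : MeasurableSet F := isClosed_frontier.measurableSet.inter h.op.measurableSet
  obtain ⟨L, hL, hT⟩ := mtaylor (E := E) M
  obtain ⟨L1, hL1, hlip⟩ := M.lip
  set C := ∫ z in E, (closedBall y R).indicator (1 : Euc (m+1) → ℝ) (z - x) with hC
  have C0 : 0 ≤ C := integral_nonneg fun z => indicator_nonneg (fun _ _ => zero_le_one) _
  set K := closedBall (x + y) R with hK
  have hKi : ∀ z, z ∈ K ↔ z - x ∈ closedBall y R := by
    intro z; simp only [hK, mem_closedBall, dist_eq_norm]; rw [sub_add_eq_sub_sub]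
  have hKS : K ⊆ S := by
    intro z hz
    have := h.add hx (M.hR ((hKi z).1 hz))
    simpa using this
  have hN := h.Ffin mF (isCompact_closedBall (x+y) R) hKS hF
  rw [← hK] at hN
  set A := ∫⁻ z in F, ENNReal.ofReal (ρ (z - x)) ∂μH[(m:ℝ)] with hA
  have mρ : Measurable ρ := M.cont.measurable
  have mK : MeasurableSet K := measurableSet_closedBall
  have key : ∀ t : ℝ, 0 < t → t ≤ R - r → cH m * ENNReal.ofReal ‖p‖ ≤
      A + ENNReal.ofReal (L1 * t) * μH[(m:ℝ)] (K ∩ F) + cH m * ENNReal.ofReal (L * t * C) := by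
    intro t ht htR
    set T : Set (Euc (m+1)) := {z | z ∉ E ∧ z + t • e ∈ E ∧ ρ (z - x) ≠ 0} with hTd
    set ψ : Euc (m+1) → ℝ := K.indicator (fun z => ρ (z - x) + L1 * t) with hψ
    have mψ : Measurable ψ := (by fun_prop : Measurable fun z => ρ (z - x) + L1 * t).indicator mK
    have ψ0 : ∀ z, 0 ≤ ψ z := fun z => indicator_nonneg (fun z _ => by have := M.nn (z - x); positivity) z
    have g := G0w (e := -e) (by rw [norm_neg, he1]) mF ht (T := T) (φ := fun z => ρ (z - x)) (ψ := ψ)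
      (by fun_prop) mψ (fun z => M.nn _) ψ0 (by
        rintro z ⟨h1, h2, h3⟩
        have hz := M.sup _ h3
        have hseg : IsPreconnected ((fun s : ℝ => z + s • e) '' Icc 0 t) :=
          isPreconnected_Icc.image _ (by fun_prop)
        obtain ⟨_, ⟨s, hs, rfl⟩, hfr⟩ := pre_frontier (E := E) hseg
          ⟨z + t • e, ⟨t, ⟨ht.le, le_rfl⟩, rfl⟩, h2⟩ ⟨z, ⟨0, ⟨le_rfl, ht.le⟩, by simp⟩, h1⟩
        have hzK : z + s • e ∈ K := by
          rw [hKi, mem_closedBall, dist_eq_norm]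
          rw [mem_closedBall, dist_eq_norm] at hz
          calc ‖z + s • e - x - y‖ = ‖(z - x - y) + s • e‖ := by congr 1; abel
            _ ≤ ‖z - x - y‖ + ‖s • e‖ := norm_add_le _ _
            _ ≤ r + t := by
              rw [norm_smul, he1, mul_one, Real.norm_of_nonneg hs.1]; linarith [hs.2]
            _ ≤ R := by linarith
        refine ⟨z + s • e, ⟨hfr, hKS hzK⟩, s, hs, by simp, ?_⟩
        simp only [hψ]
        rw [indicator_of_mem hzK]
        have := (abs_le.1 (hlip (z - x) (z + s • e - x))).2
        have e1 : ‖z - x - (z + s • e - x)‖ = s := by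
          rw [show z - x - (z + s • e - x) = -(s • e) by abel, norm_neg, norm_smul, he1, mul_one, Real.norm_of_nonneg hs.1]
        rw [e1] at this
        nlinarith [hs.2])
    have gψ : ∫⁻ z in F, ENNReal.ofReal (ψ z) ∂μH[(m:ℝ)] ≤ A + ENNReal.ofReal (L1 * t) * μH[(m:ℝ)] (K ∩ F) := by
      calc ∫⁻ z in F, ENNReal.ofReal (ψ z) ∂μH[(m:ℝ)]
          ≤ ∫⁻ z in F, (ENNReal.ofReal (ρ (z - x)) + K.indicator (fun _ => ENNReal.ofReal (L1 * t)) z) ∂μH[(m:ℝ)] := by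
            refine lintegral_mono fun z => ?_
            simp only [hψ]
            by_cases hz : z ∈ K
            · rw [indicator_of_mem hz, indicator_of_mem hz]; exact ENNReal.ofReal_add_le
            · rw [indicator_of_notMem hz, indicator_of_notMem hz]; simp
        _ = _ := by
            rw [lintegral_add_left (by fun_prop), lintegral_indicator mK, setLIntegral_const, Measure.restrict_apply mK]
    have f1 : ENNReal.ofReal (mf E ρ (x + t • e)) ≤ ENNReal.ofReal (mf E ρ x) + ∫⁻ z in T, ENNReal.ofReal (ρ (z - x)) := by
      rw [mf_of M, mf_of M]
      have e1 : ∫⁻ z in E, ENNReal.ofReal (ρ (z - (x + t • e))) = ∫⁻ z in (fun z => z + t • e) ⁻¹' E, ENNReal.ofReal (ρ (z - x)) := by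
        have mp' := measurePreserving_add_right (volume : Measure (Euc (m+1))) (t • e)
        rw [← mp'.setLIntegral_comp_preimage hE.measurableSet (by fun_prop)]
        refine lintegral_congr fun z => ?_
        have : z + t • e - (x + t • e) = z - x := by abel
        rw [this]
      rw [e1]
      have mT2 : MeasurableSet {z : Euc (m+1) | ρ (z - x) ≠ 0} := by
        have : Measurable (fun z : Euc (m+1) => ρ (z - x)) := by fun_prop
        exact (this (measurableSet_singleton 0)).compl
      calc ∫⁻ z in (fun z => z + t • e) ⁻¹' E, ENNReal.ofReal (ρ (z - x))
          ≤ ∫⁻ z in E ∪ (Eᶜ ∩ (fun z => z + t • e) ⁻¹' E), ENNReal.ofReal (ρ (z - x)) := by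
            apply lintegral_mono_set
            intro z hz
            by_cases hzE : z ∈ E
            · exact Or.inl hzE
            · exact Or.inr ⟨hzE, hz⟩
        _ ≤ (∫⁻ z in E, ENNReal.ofReal (ρ (z - x))) + (∫⁻ z in Eᶜ ∩ (fun z => z + t • e) ⁻¹' E, ENNReal.ofReal (ρ (z - x))) := lintegral_union_le _ _ _
        _ ≤ _ := by
            refine add_le_add le_rfl ?_
            have mX : MeasurableSet (Eᶜ ∩ (fun z => z + t • e) ⁻¹' E) :=
              hE.measurableSet.compl.inter (by exact (hE.preimage (by fun_prop)).measurableSet)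
            have mTT : MeasurableSet T := by
              have : T = (Eᶜ ∩ (fun z => z + t • e) ⁻¹' E) ∩ {z : Euc (m+1) | ρ (z - x) ≠ 0} := by
                ext z; simp only [hTd, mem_setOf_eq, mem_inter_iff, mem_compl_iff, mem_preimage]; tauto
              rw [this]; exact mX.inter mT2
            rw [← lintegral_indicator mX, ← lintegral_indicator mTT]
            refine lintegral_mono fun z => ?_
            by_cases hz : z ∈ Eᶜ ∩ (fun z => z + t • e) ⁻¹' E
            · by_cases hz2 : ρ (z - x) = 0
              · rw [indicator_of_mem hz, hz2]; simp
              · rw [indicator_of_mem hz, indicator_of_mem (show z ∈ T from ⟨hz.1, hz.2, hz2⟩)]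
            · rw [indicator_of_notMem hz]; exact zero_le
    have f2 := hT t ht htR x (t • e) (by rw [norm_smul, he1, mul_one, Real.norm_of_nonneg ht.le])
    rw [inner_smul_right, ← hp, hpe, ← hC] at f2
    have f3 : t * ‖p‖ ≤ mf E ρ (x + t • e) - mf E ρ x + L * t^2 * C := by
      have := (abs_le.1 f2).1; linarith
    have f4 : ENNReal.ofReal t * ENNReal.ofReal ‖p‖ ≤ (∫⁻ z in T, ENNReal.ofReal (ρ (z - x))) + ENNReal.ofReal t * ENNReal.ofReal (L * t * C) := by
      rw [← ENNReal.ofReal_mul ht.le, ← ENNReal.ofReal_mul ht.le]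
      have : ENNReal.ofReal (mf E ρ x) + ENNReal.ofReal (t * ‖p‖) ≤ ENNReal.ofReal (mf E ρ x) +
          ((∫⁻ z in T, ENNReal.ofReal (ρ (z - x))) + ENNReal.ofReal (t * (L * t * C))) := by
        rw [← add_assoc]
        refine le_trans ?_ (add_le_add_left f1 _)
        rw [← ENNReal.ofReal_add (mf_nn M x) (by positivity), ← ENNReal.ofReal_add (mf_nn M _) (by positivity)]
        apply ENNReal.ofReal_le_ofReal
        nlinarith
      exact (ENNReal.add_le_add_iff_left ENNReal.ofReal_ne_top).1 this
    have f5 : ENNReal.ofReal t * (cH m * ENNReal.ofReal ‖p‖) ≤ ENNReal.ofReal t *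
        (A + ENNReal.ofReal (L1 * t) * μH[(m:ℝ)] (K ∩ F) + cH m * ENNReal.ofReal (L * t * C)) := by
      calc ENNReal.ofReal t * (cH m * ENNReal.ofReal ‖p‖) = cH m * (ENNReal.ofReal t * ENNReal.ofReal ‖p‖) := by ring
        _ ≤ cH m * ((∫⁻ z in T, ENNReal.ofReal (ρ (z - x))) + ENNReal.ofReal t * ENNReal.ofReal (L * t * C)) := by gcongr
        _ = cH m * (∫⁻ z in T, ENNReal.ofReal (ρ (z - x))) + cH m * (ENNReal.ofReal t * ENNReal.ofReal (L * t * C)) := mul_add _ _ _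
        _ ≤ ENNReal.ofReal t * (A + ENNReal.ofReal (L1 * t) * μH[(m:ℝ)] (K ∩ F)) + cH m * (ENNReal.ofReal t * ENNReal.ofReal (L * t * C)) := by
            refine add_le_add (g.trans ?_) le_rfl
            exact mul_le_mul' le_rfl gψ
        _ = _ := by ring
    exact (ENNReal.mul_le_mul_iff_right (by simpa using ht) ENNReal.ofReal_ne_top).1 f5
  have hl : Filter.Tendsto (fun t : ℝ => A + ENNReal.ofReal (L1 * t) * μH[(m:ℝ)] (K ∩ F) + cH m * ENNReal.ofReal (L * t * C))
      (𝓝[>] 0) (𝓝 (A + ENNReal.ofReal (L1 * 0) * μH[(m:ℝ)] (K ∩ F) + cH m * ENNReal.ofReal (L * 0 * C))) := by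
    apply Filter.Tendsto.mono_left _ nhdsWithin_le_nhds
    refine Filter.Tendsto.add (Filter.Tendsto.add tendsto_const_nhds ?_) ?_
    · apply ENNReal.Tendsto.mul_const _ (Or.inr hN.ne)
      apply Continuous.tendsto (f := fun t : ℝ => ENNReal.ofReal (L1 * t))
      exact ENNReal.continuous_ofReal.comp (by fun_prop)
    · apply ENNReal.Tendsto.const_mul _ (Or.inr ENNReal.coe_ne_top)
      apply Continuous.tendsto (f := fun t : ℝ => ENNReal.ofReal (L * t * C))
      exact ENNReal.continuous_ofReal.comp (by fun_prop)
  simp only [mul_zero, zero_mul, ENNReal.ofReal_zero, add_zero] at hl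
  refine ge_of_tendsto hl ?_
  filter_upwards [Ioc_mem_nhdsGT (sub_pos.2 M.hr)] with t ht
  exact key t ht.1 ht.2

lemma gradint (h : Ctx S α w) (M : Mol S ρ y r R) (hE : IsOpen E)
    (hF : ∫⁻ z in frontier E ∩ S, ENNReal.ofReal (w z) ∂μH[(m:ℝ)] ≠ ⊤) :
    cH m * ∫⁻ x, ENNReal.ofReal ‖mp E ρ x‖ ∂(wm S w) ≤ ∫⁻ z in frontier E ∩ S, ENNReal.ofReal (w z) ∂μH[(m:ℝ)] := by
  set F := frontier E ∩ S with hFd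
  have mF : MeasurableSet F := isClosed_frontier.measurableSet.inter h.op.measurableSet
  have ew : ∫⁻ z in F, ENNReal.ofReal (w z) ∂μH[(m:ℝ)] = ∫⁻ z in F, wd S w z ∂μH[(m:ℝ)] := by
    refine setLIntegral_congr_fun mF fun z hz => ?_
    simp only [wd]; rw [indicator_of_mem hz.2]
  set τ : Measure (Euc (m+1)) := μH[(m:ℝ)].restrict F with hτ
  have mw := h.wd_meas
  have mρ : Measurable ρ := M.cont.measurable
  haveI : SigmaFinite τ := by
    haveI : IsFiniteMeasure (τ.withDensity (wd S w)) :=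
      isFiniteMeasure_withDensity (by rw [← ew]; exact hF)
    have h1 : ∀ᵐ z ∂τ, wd S w z ≠ 0 := by
      filter_upwards [ae_restrict_mem mF] with z hz
      rw [wd, indicator_of_mem hz.2]
      have := h.wpos hz.2
      simpa using this
    have h2 : ∀ᵐ z ∂τ, wd S w z ≠ ⊤ := by
      refine Filter.Eventually.of_forall fun z => ?_
      rw [wd]; by_cases hz : z ∈ S
      · rw [indicator_of_mem hz]; exact ENNReal.ofReal_ne_top
      · rw [indicator_of_notMem hz]; simp
    have h3 := withDensity_inv_same mw h1 h2
    rw [← h3]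
    apply SigmaFinite.withDensity_of_ne_top
    refine withDensity_absolutelyContinuous τ (wd S w) ?_
    have : ∀ᵐ z ∂τ, (wd S w)⁻¹ z ≠ ⊤ := by
      filter_upwards [h1] with z hz
      simpa using hz
    exact this
  calc cH m * ∫⁻ x, ENNReal.ofReal ‖mp E ρ x‖ ∂(wm S w)
      = ∫⁻ x, cH m * ENNReal.ofReal ‖mp E ρ x‖ ∂(wm S w) := (lintegral_const_mul' _ _ ENNReal.coe_ne_top).symm
    _ ≤ ∫⁻ x, (∫⁻ z, ENNReal.ofReal (ρ (z - x)) ∂τ) ∂(wm S w) := by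
        apply lintegral_mono_ae
        filter_upwards [h.ae_S] with x hx
        exact h.gradbd M hE hF hx
    _ ≤ (∫⁻ v, ENNReal.ofReal (ρ v)) * ∫⁻ z, wd S w z ∂τ := by
        refine h.CV (k := fun v => ENNReal.ofReal (ρ v)) (by fun_prop) fun v hv => ?_
        apply M.hR
        have : ρ v ≠ 0 := by intro h0; simp [h0] at hv
        exact closedBall_subset_closedBall M.hr.le (M.sup v this)
    _ = _ := by
        rw [← ofReal_integral_eq_lintegral_ofReal M.intb (Filter.Eventually.of_forall M.nn), M.int, ew]; simp

lemma exGS (h : Ctx S α w) (hE : IsOpen E) (hES : E ⊆ S) (hV : wm S w E = wm S w (BS S))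
    (hP : ∫⁻ z in frontier E ∩ S, ENNReal.ofReal (w z) ∂μH[(m:ℝ)] ≤
      cH m * ENNReal.ofReal ((((m+1:ℕ):ℝ)+α)) * wm S w (BS S)) :
    ∃ f p, GS S α w E f p := by
  have hα := h.hα
  have mE := hE.measurableSet
  have hVt : wm S w E ≠ ⊤ := hV ▸ h.Vt
  have hF : ∫⁻ z in frontier E ∩ S, ENNReal.ofReal (w z) ∂μH[(m:ℝ)] ≠ ⊤ := by
    refine ne_top_of_le_ne_top ?_ hP
    exact ENNReal.mul_ne_top (ENNReal.mul_ne_top ENNReal.coe_ne_top ENNReal.ofReal_ne_top) h.Vt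
  obtain ⟨y0, hy0⟩ := h.ne
  obtain ⟨R0, hR0, hRS⟩ := Metric.nhds_basis_closedBall.mem_iff.1 (h.op.mem_nhds hy0)
  set d : ℕ → ℝ := fun j => 1 / ((j:ℝ)+1) with hd
  have dpos : ∀ j, 0 < d j := fun j => by simp only [hd]; positivity
  let φ : ∀ j : ℕ, ContDiffBump (d j • y0) := fun j =>
    ⟨d j * R0 / 4, d j * R0 / 2, by have := dpos j; positivity, by have := dpos j; nlinarith⟩
  set ρ : ℕ → Euc (m+1) → ℝ := fun j => (φ j).normed volume with hρ
  have M : ∀ j, Mol S (ρ j) (d j • y0) (d j * R0 / 2) (d j * R0) := by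
    intro j
    have dj := dpos j
    refine ⟨(φ j).contDiff_normed, (φ j).nonneg_normed, (φ j).integral_normed, ?_, by nlinarith, ?_⟩
    · intro u hu
      have : u ∈ Function.support ((φ j).normed volume) := hu
      rw [(φ j).support_normed_eq] at this
      exact ball_subset_closedBall this
    · intro u hu
      have : (d j)⁻¹ • u ∈ closedBall y0 R0 := by
        rw [mem_closedBall, dist_eq_norm] at hu ⊢
        have e1 : (d j)⁻¹ • u - y0 = (d j)⁻¹ • (u - d j • y0) := by
          rw [smul_sub, smul_smul, inv_mul_cancel₀ dj.ne', one_smul]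
        rw [e1, norm_smul, norm_inv, Real.norm_of_nonneg dj.le, inv_mul_le_iff₀ dj]
        exact hu
      have := h.cone (hRS this) dj
      rwa [smul_smul, mul_inv_cancel₀ dj.ne', one_smul] at this
  have c0 : (cH m : ℝ≥0∞) ≠ 0 := by exact_mod_cast (cH_pos m).ne'
  have hpl : ∀ j, ∫⁻ x, ENNReal.ofReal ‖mp E (ρ j) x‖ ∂(wm S w) ≤ ENNReal.ofReal ((((m+1:ℕ):ℝ)+α)) * wm S w (BS S) := by
    intro j
    have := (h.gradint (M j) hE hF).trans hP
    rw [mul_assoc] at this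
    exact (ENNReal.mul_le_mul_iff_right c0 ENNReal.coe_ne_top).1 this
  have hpi : ∀ j, Integrable (mp E (ρ j)) (wm S w) := by
    intro j
    refine ⟨(mp_meas (M j)).aestronglyMeasurable, ?_⟩
    rw [hasFiniteIntegral_iff_norm]
    exact lt_of_le_of_lt (hpl j) (ENNReal.mul_lt_top ENNReal.ofReal_lt_top h.Vt.lt_top)
  have tm : ∀ j, Tame S w (mf E (ρ j)) (mp E (ρ j)) := fun j => h.mtame (M j) mE hVt (hpi j)
  refine ⟨fun j => mf E (ρ j), fun j => mp E (ρ j), hE, hES, hV, tm, ?_, ?_, ?_⟩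
  · intro j
    rw [integral_eq_lintegral_of_nonneg_ae (Filter.Eventually.of_forall fun x => norm_nonneg _)
      (hpi j).norm.aestronglyMeasurable]
    refine ENNReal.toReal_le_of_le_ofReal (by have := h.V0; positivity) ((hpl j).trans_eq ?_)
    rw [VV, measureReal_def, ENNReal.ofReal_mul (by positivity), ENNReal.ofReal_toReal h.Vt]
  · intro j
    rw [integral_eq_lintegral_of_nonneg_ae (Filter.Eventually.of_forall fun x => mf_nn (M j) x)
      (tm j).gi.aestronglyMeasurable]
    refine ENNReal.toReal_le_of_le_ofReal h.V0.le ((h.mf_int (M j) mE).trans_eq ?_)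
    rw [VV, measureReal_def, ENNReal.ofReal_toReal h.Vt, hV]
  · intro x hx
    apply tendsto_const_nhds.congr'
    obtain ⟨ε, hε, hball⟩ := Metric.isOpen_iff.1 hE x hx
    have hdl : Filter.Tendsto (fun j => d j * (‖y0‖ + R0)) Filter.atTop (𝓝 (0 * (‖y0‖ + R0))) :=
      (tendsto_one_div_add_atTop_nhds_zero_nat).mul_const _
    rw [zero_mul] at hdl
    filter_upwards [hdl.eventually (gt_mem_nhds hε)] with j hj
    rw [mf, setIntegral_eq_integral_of_forall_compl_eq_zero, integral_sub_right_eq_self (ρ j) x, (M j).int]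
    intro z hz
    by_contra h0
    apply hz
    apply hball
    have h1 := (M j).sup _ h0
    rw [mem_closedBall, dist_eq_norm] at h1
    rw [mem_ball, dist_eq_norm]
    have dj := dpos j
    calc ‖z - x‖ = ‖(z - x - d j • y0) + d j • y0‖ := by rw [sub_add_cancel]
      _ ≤ ‖z - x - d j • y0‖ + ‖d j • y0‖ := norm_add_le _ _
      _ ≤ d j * R0 / 2 + d j * ‖y0‖ := by
        rw [norm_smul, Real.norm_of_nonneg dj.le]; linarith
      _ < ε := by nlinarith
end Ctx

end

noncomputable section

namespace Ctx
variable {m : ℕ} {S : Set (Euc (m+1))} {α : ℝ} {w : Euc (m+1) → ℝ} {E : Set (Euc (m+1))}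

lemma frsub (h : Ctx S α w) : frontier (BS S) ∩ S ⊆ sphere 0 1 ∩ S := by
  rintro x ⟨⟨h1, h2⟩, h3⟩
  refine ⟨?_, h3⟩
  rw [h.BSo.interior_eq] at h2
  have h4 : x ∈ closedBall (0 : Euc (m+1)) 1 :=
    closure_minimal (fun z hz => ball_subset_closedBall hz.1) isClosed_closedBall h1
  rw [mem_closedBall, dist_zero_right] at h4
  rw [mem_sphere, dist_zero_right]
  refine le_antisymm h4 (not_lt.1 fun hl => h2 ⟨?_, h3⟩)
  rwa [mem_ball, dist_zero_right]

lemma m7 (h : Ctx S α w) (hE : IsOpen E) (hES : E ⊆ S) {p : Euc (m+1)} (hp : p ∈ closure S)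
    (hEQ : E =ᵐ[volume] {z | z - p ∈ BS S})
    (hP : ∫⁻ z in frontier E ∩ S, ENNReal.ofReal (w z) ∂μH[(m:ℝ)] ≤
      ∫⁻ z in sphere 0 1 ∩ S, ENNReal.ofReal (w z) ∂μH[(m:ℝ)]) : -p ∈ closure S := by
  by_contra hcon
  set Q : Set (Euc (m+1)) := {z | z - p ∈ BS S} with hQ
  have Qo : IsOpen Q := h.BSo.preimage (by fun_prop : Continuous fun z : Euc (m+1) => z - p)
  have BC : Convex ℝ (BS S) := (convex_ball 0 1).inter h.cvx
  have Qc : Convex ℝ Q := by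
    have : Q = (fun z => z + (-p)) ⁻¹' BS S := by ext z; simp [hQ, sub_eq_add_neg]
    rw [this]; exact BC.translate_preimage_left _
  have EcQ : E ⊆ closure Q := by
    have : volume (E ∩ (closure Q)ᶜ) = 0 := by
      refine measure_mono_null (fun z hz => ?_) (ae_le_set.1 hEQ.le)
      exact ⟨hz.1, fun hq => hz.2 (subset_closure hq)⟩
    have := (hE.inter isClosed_closure.isOpen_compl).measure_eq_zero_iff volume |>.1 this
    intro z hz
    by_contra hq
    exact (this ▸ (⟨hz, hq⟩ : z ∈ E ∩ (closure Q)ᶜ) : z ∈ (∅ : Set (Euc (m+1))))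
  have QcE : Q ⊆ closure E := by
    have : volume (Q ∩ (closure E)ᶜ) = 0 := by
      refine measure_mono_null (fun z hz => ?_) (ae_le_set.1 hEQ.symm.le)
      exact ⟨hz.1, fun hq => hz.2 (subset_closure hq)⟩
    have := (Qo.inter isClosed_closure.isOpen_compl).measure_eq_zero_iff volume |>.1 this
    intro z hz
    by_contra hq
    exact (this ▸ (⟨hz, hq⟩ : z ∈ Q ∩ (closure E)ᶜ) : z ∈ (∅ : Set (Euc (m+1))))
  have Qne : Q.Nonempty := by
    obtain ⟨b, hb⟩ := h.BSn
    exact ⟨b + p, by simpa [hQ] using hb⟩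
  have EQ : E ⊆ Q := by
    have h1 : interior (closure Q) = Q := by
      rw [Qc.interior_closure_eq_interior_of_nonempty_interior (by rwa [Qo.interior_eq]), Qo.interior_eq]
    rw [← h1]; exact interior_maximal EcQ hE
  have frQE : frontier Q ⊆ frontier E := by
    rintro z ⟨hz1, hz2⟩
    rw [Qo.interior_eq] at hz2
    refine ⟨closure_minimal QcE isClosed_closure hz1, ?_⟩
    rw [hE.interior_eq]; exact fun hzE => hz2 (EQ hzE)
  set F : Set (Euc (m+1)) := frontier Q ∩ S ∩ ball p 1 with hF
  have mF : MeasurableSet F := (isClosed_frontier.measurableSet.inter h.op.measurableSet).inter measurableSet_ball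
  set G : Set (Euc (m+1)) := (fun z => z - p) ⁻¹' (sphere 0 1 ∩ S) with hG
  have mG : MeasurableSet G := by
    have : Measurable (fun z : Euc (m+1) => z - p) := by fun_prop
    exact this (isClosed_sphere.measurableSet.inter h.op.measurableSet)
  have hdis : Disjoint G F := by
    rw [Set.disjoint_left]
    rintro z ⟨h1, _⟩ ⟨_, h2⟩
    rw [mem_sphere, dist_zero_right] at h1
    rw [mem_ball, dist_eq_norm, h1] at h2
    exact lt_irrefl _ h2
  have hGs : G ⊆ frontier E ∩ S := by
    rintro z ⟨h1, h2⟩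
    refine ⟨frQE ?_, ?_⟩
    · rw [mem_sphere, dist_zero_right] at h1
      constructor
      · have hc : Filter.Tendsto (fun t : ℝ => p + t • (z - p)) (𝓝[<] 1) (𝓝 (p + (1:ℝ) • (z - p))) :=
          ((by fun_prop : Continuous fun t : ℝ => p + t • (z - p)).tendsto 1).mono_left nhdsWithin_le_nhds
        rw [one_smul, add_sub_cancel] at hc
        refine mem_closure_of_tendsto hc ?_
        have : ∀ᶠ t : ℝ in 𝓝[<] 1, t ∈ Ioo (0:ℝ) 1 := Ioo_mem_nhdsLT one_pos
        filter_upwards [this] with t ht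
        show p + t • (z - p) - p ∈ BS S
        rw [add_sub_cancel_left]
        refine ⟨?_, h.cone h2 ht.1⟩
        rw [mem_ball, dist_zero_right, norm_smul, h1, mul_one, Real.norm_of_nonneg ht.1.le]
        exact ht.2
      · rw [Qo.interior_eq]
        rintro ⟨h3, _⟩
        rw [mem_ball, dist_zero_right, h1] at h3
        exact lt_irrefl _ h3
    · have := h.addcl h2 hp
      simpa using this
  have hinq : ∫⁻ z in sphere 0 1 ∩ S, ENNReal.ofReal (w z) ∂μH[(m:ℝ)] ≤
      ∫⁻ z in G, ENNReal.ofReal (w z) ∂μH[(m:ℝ)] := by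
    have mp' := (IsometryEquiv.addRight p).measurePreserving_hausdorffMeasure (m:ℝ)
    have := mp'.setLIntegral_comp_preimage_emb (IsometryEquiv.addRight p).toHomeomorph.measurableEmbedding
      (fun z => ENNReal.ofReal (w z)) G
    rw [← this]
    have e1 : (IsometryEquiv.addRight p) ⁻¹' G = sphere 0 1 ∩ S := by
      ext z; simp [hG]
    rw [e1]
    refine setLIntegral_mono' (isClosed_sphere.measurableSet.inter h.op.measurableSet) fun z hz => ?_
    exact ENNReal.ofReal_le_ofReal (h.wmonocl hz.2 hp)
  have hfin : ∫⁻ z in sphere 0 1 ∩ S, ENNReal.ofReal (w z) ∂μH[(m:ℝ)] ≠ ⊤ := by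
    refine ne_top_of_le_ne_top ?_ h.perB
    exact ENNReal.mul_ne_top (ENNReal.mul_ne_top ENNReal.coe_ne_top ENNReal.ofReal_ne_top) h.Vt
  have hF0 : ∫⁻ z in F, ENNReal.ofReal (w z) ∂μH[(m:ℝ)] = 0 := by
    have h1 : (∫⁻ z in G, ENNReal.ofReal (w z) ∂μH[(m:ℝ)]) + (∫⁻ z in F, ENNReal.ofReal (w z) ∂μH[(m:ℝ)]) ≤
        (∫⁻ z in sphere 0 1 ∩ S, ENNReal.ofReal (w z) ∂μH[(m:ℝ)]) := by
      rw [← lintegral_union mF hdis]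
      refine (lintegral_mono_set ?_).trans hP
      exact union_subset hGs fun z hz => ⟨frQE hz.1.1, hz.1.2⟩
    have h2 : (∫⁻ z in sphere 0 1 ∩ S, ENNReal.ofReal (w z) ∂μH[(m:ℝ)]) + (∫⁻ z in F, ENNReal.ofReal (w z) ∂μH[(m:ℝ)]) ≤
        (∫⁻ z in sphere 0 1 ∩ S, ENNReal.ofReal (w z) ∂μH[(m:ℝ)]) + 0 := by
      rw [add_zero]
      exact (add_le_add hinq le_rfl).trans h1
    exact le_antisymm ((ENNReal.add_le_add_iff_left hfin).1 h2) zero_le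
  have hF1 : μH[(m:ℝ)] F = 0 := by
    rw [setLIntegral_eq_zero_iff' mF ?_] at hF0
    · have h1 : ∀ᵐ z ∂μH[(m:ℝ)], z ∉ F := by
        filter_upwards [hF0] with z hz hzF
        have := hz hzF
        rw [ENNReal.ofReal_eq_zero] at this
        exact absurd (h.wpos hzF.1.2) (not_lt.2 this)
      rw [ae_iff] at h1
      simpa using h1
    · exact ENNReal.measurable_ofReal.comp_aemeasurable ((h.wcont.mono fun z hz => hz.1.2).aemeasurable mF)
  -- the open set crossing the lateral boundary
  have p0 : p ≠ 0 := by
    rintro rfl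
    exact hcon (by simpa using hp)
  have pp : 0 < ‖p‖ := norm_pos_iff.2 p0
  obtain ⟨ε, hε, hball⟩ := Metric.isOpen_iff.1 isClosed_closure.isOpen_compl (-p) hcon
  set t : ℝ := 1 / (2 * (‖p‖ + 1)) with ht
  have t0 : 0 < t := by rw [ht]; positivity
  have t1 : t * (2 * (‖p‖ + 1)) = 1 := by rw [ht]; field_simp
  set U : Set (Euc (m+1)) := {z | z - p ∈ S ∧ ‖z - p‖ < min (1/2) (t * ε)} with hU
  have Uo : IsOpen U :=
    (h.op.preimage (by fun_prop : Continuous fun z : Euc (m+1) => z - p)).inter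
      (isOpen_lt (by fun_prop : Continuous fun z : Euc (m+1) => ‖z - p‖) continuous_const)
  have Une : U.Nonempty := by
    have hm : 0 < min (1/2) (t * ε) := lt_min (by norm_num) (by positivity)
    obtain ⟨b, hb, hb2⟩ := Metric.mem_closure_iff.1 h.zcl _ hm
    refine ⟨b + p, by simpa using hb, ?_⟩
    rw [dist_zero_left] at hb2
    simpa using hb2
  set e : Euc (m+1) := ‖p‖⁻¹ • p with he
  have he1 : ‖e‖ = 1 := by rw [he, norm_smul, norm_inv, norm_norm, inv_mul_cancel₀ pp.ne']
  have hse : ∀ s : ℝ, s • e = (s / ‖p‖) • p := fun s => by rw [he, smul_smul, div_eq_mul_inv]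
  have g := G0 he1 mF (h := t * ‖p‖) (by positivity) (T := U) (by
    rintro z ⟨hz1, hz2⟩
    have hz3 := lt_of_lt_of_le hz2 (min_le_left _ _)
    have hz4 := lt_of_lt_of_le hz2 (min_le_right _ _)
    have hseg : IsPreconnected ((fun s : ℝ => z - s • e) '' Icc 0 (t * ‖p‖)) :=
      isPreconnected_Icc.image _ (by fun_prop)
    obtain ⟨_, ⟨s, hs, rfl⟩, hfr⟩ := pre_frontier (E := Q) hseg
      ⟨z, ⟨0, ⟨le_rfl, by positivity⟩, by simp⟩, by
        refine ⟨?_, hz1⟩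
        rw [mem_ball, dist_zero_right]; linarith⟩
      ⟨z - (t * ‖p‖) • e, ⟨t * ‖p‖, ⟨by positivity, le_rfl⟩, rfl⟩, by
        rintro ⟨_, h2⟩
        rw [hse, mul_div_cancel_right₀ _ pp.ne'] at h2
        have h3 := h.cone h2 (inv_pos.2 t0)
        refine hball ?_ (subset_closure h3)
        rw [mem_ball, dist_eq_norm]
        have e1 : t⁻¹ • (z - t • p - p) - -p = t⁻¹ • (z - p) := by
          have : z - t • p - p = (z - p) - t • p := by abel
          rw [this, smul_sub, smul_smul, inv_mul_cancel₀ t0.ne', one_smul]; abel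
        rw [e1, norm_smul, norm_inv, Real.norm_of_nonneg t0.le, inv_mul_lt_iff₀ t0]
        exact hz4⟩
    refine ⟨z - s • e, ⟨⟨hfr, ?_⟩, ?_⟩, s, hs, by simp⟩
    · have h1 : 0 < 1 - s / ‖p‖ := by
        have : s / ‖p‖ ≤ t := (div_le_iff₀ pp).2 hs.2
        nlinarith
      have := h.addcl hz1 (h.conecl hp h1)
      have e1 : z - s • e = z - p + (1 - s / ‖p‖) • p := by
        rw [hse, sub_smul, one_smul]; abel
      rw [e1]; exact this
    · rw [mem_ball, dist_eq_norm]
      calc ‖z - s • e - p‖ = ‖(z - p) - s • e‖ := by congr 1; abel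
        _ ≤ ‖z - p‖ + ‖s • e‖ := norm_sub_le _ _
        _ < 1 := by
          rw [norm_smul, he1, mul_one, Real.norm_of_nonneg hs.1]
          nlinarith [hs.2])
  rw [hF1, mul_zero] at g
  have c0 : (cH m : ℝ≥0∞) ≠ 0 := by exact_mod_cast (cH_pos m).ne'
  have : volume U = 0 := by
    have := le_antisymm g zero_le
    rcases mul_eq_zero.1 this with h1 | h1
    · exact absurd h1 c0
    · exact h1
  exact (Uo.measure_pos volume Une).ne' this

end Ctx

end

noncomputable section

namespace Ctx
variable {m : ℕ} {S : Set (Euc (m+1))} {α : ℝ} {w : Euc (m+1) → ℝ} {E : Set (Euc (m+1))}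

lemma wPer_eq (S : Set (Euc (m+1))) (w : Euc (m+1) → ℝ) (E : Set (Euc (m+1))) :
    wPer S w E = ∫⁻ x in frontier E ∩ S, ENNReal.ofReal (w x) ∂μH[(m:ℝ)] := by
  have : ((m+1:ℕ):ℝ) - 1 = m := by push_cast; ring
  rw [wPer, this]

lemma wtr (h : Ctx S α w) {p x : Euc (m+1)} (hp : p ∈ closure S) (hp' : -p ∈ closure S) (hx : x ∈ S) :
    w (x + p) = w x := by
  refine le_antisymm ?_ (h.wmonocl hx hp)
  have := h.wmonocl (h.addcl hx hp) hp'
  simpa using this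

lemma Str (h : Ctx S α w) {p : Euc (m+1)} (hp : p ∈ closure S) (hp' : -p ∈ closure S) (x : Euc (m+1)) :
    x + p ∈ S ↔ x ∈ S := by
  refine ⟨fun hx => ?_, fun hx => h.addcl hx hp⟩
  have := h.addcl hx hp'
  simpa using this

lemma per_tr (h : Ctx S α w) {p : Euc (m+1)} (hp : p ∈ closure S) (hp' : -p ∈ closure S) (A : Set (Euc (m+1))) :
    wPer S w A = wPer S w ((fun z => z + p) ⁻¹' A) := by
  rw [wPer_eq, wPer_eq]
  have mp' := (IsometryEquiv.addRight p).measurePreserving_hausdorffMeasure (m:ℝ)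
  have := mp'.setLIntegral_comp_preimage_emb (IsometryEquiv.addRight p).toHomeomorph.measurableEmbedding
      (fun z => ENNReal.ofReal (w z)) (frontier A ∩ S)
  rw [← this]
  have e1 : (IsometryEquiv.addRight p) ⁻¹' (frontier A ∩ S) = frontier ((fun z => z + p) ⁻¹' A) ∩ S := by
    rw [preimage_inter]
    have a1 := (IsometryEquiv.addRight p).toHomeomorph.preimage_frontier A
    have a2 : (IsometryEquiv.addRight p) ⁻¹' S = S := by
      ext x; exact h.Str hp hp' x
    rw [a2]; congr 1
  rw [e1]
  refine setLIntegral_congr_fun (isClosed_frontier.measurableSet.inter h.op.measurableSet) fun z hz => ?_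
  exact congrArg ENNReal.ofReal (h.wtr hp hp' hz.2)

lemma vol_tr (h : Ctx S α w) {p : Euc (m+1)} (hp : p ∈ closure S) (hp' : -p ∈ closure S) {A : Set (Euc (m+1))}
    (mA : MeasurableSet A) (hA : A ⊆ S) :
    wVol w A = wVol w ((fun z => z + p) ⁻¹' A) := by
  have mp' := measurePreserving_add_right (volume : Measure (Euc (m+1))) p
  have := mp'.setLIntegral_comp_preimage_emb (measurableEmbedding_addRight p)
      (fun z => ENNReal.ofReal (w z)) A
  rw [wVol, wVol, ← this]
  refine setLIntegral_congr_fun ((measurable_add_const p) mA) fun z hz => ?_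
  exact congrArg ENNReal.ofReal (h.wtr hp hp' ((h.Str hp hp' z).1 (hA hz)))

lemma Ssm (h : Ctx S α w) {r : ℝ} (hr : 0 < r) (x : Euc (m+1)) : r • x ∈ S ↔ x ∈ S := by
  refine ⟨fun hx => ?_, fun hx => h.cone hx hr⟩
  have := h.cone hx (inv_pos.2 hr)
  rwa [smul_smul, inv_mul_cancel₀ hr.ne', one_smul] at this

open scoped Pointwise in
lemma pre_sm {r : ℝ} (hr : 0 < r) (A : Set (Euc (m+1))) : r • ((fun z => r • z) ⁻¹' A) = A := by
  ext z
  rw [mem_smul_set_iff_inv_smul_mem₀ hr.ne', mem_preimage, smul_smul, mul_inv_cancel₀ hr.ne', one_smul]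

lemma per_sm (h : Ctx S α w) {r : ℝ} (hr : 0 < r) (A : Set (Euc (m+1))) :
    wPer S w A = ENNReal.ofReal (r ^ ((m:ℝ) + α)) * wPer S w ((fun z => r • z) ⁻¹' A) := by
  rw [wPer_eq, wPer_eq]
  have emb : MeasurableEmbedding (fun z : Euc (m+1) => r • z) :=
    (Homeomorph.smulOfNeZero r hr.ne').measurableEmbedding
  have hm : (μH[(m:ℝ)] : Measure (Euc (m+1))) = ENNReal.ofReal (r ^ (m:ℝ)) • (μH[(m:ℝ)] : Measure (Euc (m+1))).map (fun z => r • z) := by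
    ext s hs
    rw [Measure.smul_apply, emb.map_apply, smul_eq_mul]
    conv_lhs => rw [← pre_sm hr s]
    rw [Measure.hausdorffMeasure_smul₀ (by positivity) hr.ne', ENNReal.smul_def, smul_eq_mul]
    congr 1
    rw [← ENNReal.ofReal_coe_nnreal, NNReal.coe_rpow, coe_nnnorm, Real.norm_of_nonneg hr.le]
  conv_lhs => rw [hm]
  rw [Measure.restrict_smul, lintegral_smul_measure, emb.restrict_map, emb.lintegral_map, smul_eq_mul]
  have e1 : (fun z : Euc (m+1) => r • z) ⁻¹' (frontier A ∩ S) = frontier ((fun z => r • z) ⁻¹' A) ∩ S := by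
    rw [preimage_inter]
    have a1 := (Homeomorph.smulOfNeZero (α := Euc (m+1)) r hr.ne').preimage_frontier A
    have a2 : (fun z : Euc (m+1) => r • z) ⁻¹' S = S := by
      ext x; exact h.Ssm hr x
    rw [a2]; congr 1
  rw [e1, Real.rpow_add hr, ENNReal.ofReal_mul (by positivity), mul_assoc]
  congr 1
  rw [← lintegral_const_mul' _ _ ENNReal.ofReal_ne_top]
  refine setLIntegral_congr_fun (isClosed_frontier.measurableSet.inter h.op.measurableSet) fun z hz => ?_
  beta_reduce
  rw [h.hom hz.2 hr, ENNReal.ofReal_mul (by positivity)]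

lemma vol_sm (h : Ctx S α w) {r : ℝ} (hr : 0 < r) {A : Set (Euc (m+1))}
    (mA : MeasurableSet A) (hA : A ⊆ S) :
    wVol w A = ENNReal.ofReal (r ^ (((m+1:ℕ):ℝ) + α)) * wVol w ((fun z => r • z) ⁻¹' A) := by
  have m2 : MeasurableSet ((fun z : Euc (m+1) => r • z) ⁻¹' A) := (measurable_const_smul r) mA
  rw [← h.wm_eq_wVol mA hA, ← h.wm_eq_wVol m2 (fun z hz => (h.Ssm hr z).1 (hA hz)), ← h.wm_smul m2 hr, pre_sm hr]

lemma ratio_sm (h : Ctx S α w) {r : ℝ} (hr : 0 < r) {A : Set (Euc (m+1))}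
    (mA : MeasurableSet A) (hA : A ⊆ S) :
    wPer S w A / (wVol w A) ^ ((((m+1:ℕ):ℝ) + α - 1) / (((m+1:ℕ):ℝ) + α)) =
    wPer S w ((fun z => r • z) ⁻¹' A) / (wVol w ((fun z => r • z) ⁻¹' A)) ^ ((((m+1:ℕ):ℝ) + α - 1) / (((m+1:ℕ):ℝ) + α)) := by
  have hα := h.hα
  have hD : 0 < ((m+1:ℕ):ℝ) + α := by positivity
  have hD1 : ((m+1:ℕ):ℝ) + α - 1 = m + α := by push_cast; ring
  rw [h.per_sm hr A, h.vol_sm hr mA hA, hD1, ENNReal.mul_rpow_of_nonneg _ _ (by positivity),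
    ENNReal.ofReal_rpow_of_pos (by positivity), ← Real.rpow_mul hr.le, mul_div_cancel₀ _ hD.ne']
  rw [ENNReal.mul_div_mul_left _ _ (by simpa using Real.rpow_pos_of_pos hr _) ENNReal.ofReal_ne_top]

end Ctx

lemma Ctx.mk' {m k : ℕ} (hk : k < m+1) (α : ℝ) (hα : 0 < α)
    (S : Set (Euc (m+1))) (hS : IsOpenConvexCone S)
    (hNoLine : ∀ p v : Euc (m+1), (∀ t : ℝ, p + t • v ∈ S) → v ∈ linSpan (m+1) k)
    (w : Euc (m+1) → ℝ) (hw : IsAdmissibleWeight S α w) : Ctx S α w := by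
  refine ⟨by omega, hα, hS, hw, fun h0 => ?_⟩
  obtain ⟨ε, hε, hb⟩ := Metric.isOpen_iff.1 hS.1 0 h0
  have hall : ∀ z : Euc (m+1), z ∈ S := by
    intro z
    set c : ℝ := ε / (‖z‖ + 1) with hc
    have c0 : 0 < c := by positivity
    have h1 : c • z ∈ S := by
      apply hb
      rw [mem_ball, dist_zero_right, norm_smul, Real.norm_of_nonneg c0.le, hc, div_mul_eq_mul_div,
        div_lt_iff₀ (by positivity)]
      nlinarith
    have := hS.2.2 _ h1 c⁻¹ (inv_pos.2 c0)
    rwa [smul_smul, inv_mul_cancel₀ c0.ne', one_smul] at this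
  have := hNoLine 0 (EuclideanSpace.single ⟨k, hk⟩ 1) (fun t => hall _) ⟨k, hk⟩ le_rfl
  simp at this

lemma lin_cl {m k : ℕ} {S : Set (Euc (m+1))} {α : ℝ} {w : Euc (m+1) → ℝ} (h : Ctx S α w)
    (hSL : ∀ x ∈ S, ∀ v ∈ linSpan (m+1) k, x + v ∈ S) {v : Euc (m+1)} (hv : v ∈ linSpan (m+1) k) : v ∈ closure S := by
  obtain ⟨x, hx⟩ := h.ne
  have hc : Filter.Tendsto (fun t : ℝ => t • x + v) (𝓝[>] 0) (𝓝 ((0:ℝ) • x + v)) :=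
    ((by fun_prop : Continuous fun t : ℝ => t • x + v).tendsto 0).mono_left nhdsWithin_le_nhds
  rw [zero_smul, zero_add] at hc
  refine mem_closure_of_tendsto hc ?_
  filter_upwards [self_mem_nhdsWithin] with t ht
  exact hSL _ (h.cone hx ht) v hv

lemma cl_lin {m k : ℕ} {S : Set (Euc (m+1))} {α : ℝ} {w : Euc (m+1) → ℝ} (h : Ctx S α w)
    (hNoLine : ∀ p v : Euc (m+1), (∀ t : ℝ, p + t • v ∈ S) → v ∈ linSpan (m+1) k)
    {p : Euc (m+1)} (hp : p ∈ closure S) (hp' : -p ∈ closure S) : p ∈ linSpan (m+1) k := by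
  obtain ⟨x, hx⟩ := h.ne
  refine hNoLine x p fun t => ?_
  rcases lt_trichotomy t 0 with ht | rfl | ht
  · have := h.addcl hx (h.conecl hp' (neg_pos.2 ht))
    simpa using this
  · simpa using hx
  · exact h.addcl hx (h.conecl hp ht)

end

noncomputable section

theorem main_aux {m k : ℕ} (hk : k < m+1) (α : ℝ) (hα : 0 < α)
    (S : Set (Euc (m+1))) (hS : IsOpenConvexCone S)
    (hSL : ∀ x ∈ S, ∀ v ∈ linSpan (m+1) k, x + v ∈ S)
    (hNoLine : ∀ p v : Euc (m+1), (∀ t : ℝ, p + t • v ∈ S) → v ∈ linSpan (m+1) k)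
    (w : Euc (m+1) → ℝ) (hw : IsAdmissibleWeight S α w) :
    (∀ r : ℝ, 0 < r → ∀ x₀ ∈ linSpan (m+1) k,
      wPer S w (ball x₀ r ∩ S) /
          (wVol w (ball x₀ r ∩ S)) ^ ((((m+1:ℕ) : ℝ) + α - 1) / (((m+1:ℕ) : ℝ) + α)) =
        wPer S w (ball (0 : Euc (m+1)) 1 ∩ S) /
          (wVol w (ball (0 : Euc (m+1)) 1 ∩ S)) ^ ((((m+1:ℕ) : ℝ) + α - 1) / (((m+1:ℕ) : ℝ) + α)))
    ∧
    (∀ E : Set (Euc (m+1)), E ⊆ S → IsOpen E →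
      0 < wVol w E → wVol w E < ⊤ → wPer S w E < ⊤ →
      wPer S w E / (wVol w E) ^ ((((m+1:ℕ) : ℝ) + α - 1) / (((m+1:ℕ) : ℝ) + α)) =
        wPer S w (ball (0 : Euc (m+1)) 1 ∩ S) /
          (wVol w (ball (0 : Euc (m+1)) 1 ∩ S)) ^ ((((m+1:ℕ) : ℝ) + α - 1) / (((m+1:ℕ) : ℝ) + α)) →
      ∃ r : ℝ, 0 < r ∧ ∃ x₀ ∈ linSpan (m+1) k,
        wVol w (symmDiff E (ball x₀ r ∩ S)) = 0) := by
  have h : Ctx S α w := Ctx.mk' hk α hα S hS hNoLine w hw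
  constructor
  · intro r hr x₀ hx
    have hc := lin_cl h hSL hx
    have hc' : -x₀ ∈ closure S := lin_cl h hSL (v := -x₀) (fun i hi => by simp [hx i hi])
    have mb : MeasurableSet (ball x₀ r ∩ S) := measurableSet_ball.inter h.op.measurableSet
    have e1 : (fun z => z + x₀) ⁻¹' (ball x₀ r ∩ S) = ball 0 r ∩ S := by
      ext z
      simp only [mem_preimage, mem_inter_iff, h.Str hc hc' z, mem_ball, dist_eq_norm, add_sub_cancel_right, sub_zero]
    have e2 : (fun z => r • z) ⁻¹' (ball (0 : Euc (m+1)) r ∩ S) = ball 0 1 ∩ S := by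
      ext z
      simp only [mem_preimage, mem_inter_iff, h.Ssm hr z, mem_ball, dist_zero_right, norm_smul, Real.norm_of_nonneg hr.le]
      rw [mul_lt_iff_lt_one_right hr]
    rw [h.per_tr hc hc' (ball x₀ r ∩ S), h.vol_tr hc hc' mb inter_subset_right, e1,
      h.ratio_sm hr (measurableSet_ball.inter h.op.measurableSet) inter_subset_right, e2]
  · intro E hES hE hv0 hvt hpt heq
    have hD : 0 < ((m+1:ℕ):ℝ) + α := by positivity
    have hq : 0 ≤ ((((m+1:ℕ) : ℝ) + α - 1) / (((m+1:ℕ) : ℝ) + α)) := by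
      have : ((m+1:ℕ):ℝ) + α - 1 = m + α := by push_cast; ring
      rw [this]; positivity
    have hB : wVol w (BS S) = wm S w (BS S) := (h.wm_eq_wVol h.BSo.measurableSet h.BSs).symm
    have hV0 := h.V0
    have hVr : wVol w (BS S) = ENNReal.ofReal (VV S w) := by
      rw [hB, VV, measureReal_def, ENNReal.ofReal_toReal h.Vt]
    set v : ℝ := (wVol w E).toReal with hv
    have v0 : 0 < v := ENNReal.toReal_pos hv0.ne' hvt.ne
    have hEv : wVol w E = ENNReal.ofReal v := (ENNReal.ofReal_toReal hvt.ne).symm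
    set r : ℝ := (v / VV S w) ^ (1 / (((m+1:ℕ):ℝ) + α)) with hr'
    have hr : 0 < r := by positivity
    have hrD : r ^ (((m+1:ℕ):ℝ) + α) = v / VV S w := by
      rw [hr', ← Real.rpow_mul (by positivity), one_div, inv_mul_cancel₀ hD.ne', Real.rpow_one]
    set E' : Set (Euc (m+1)) := (fun z => r • z) ⁻¹' E with hE'
    have E'o : IsOpen E' := hE.preimage (by fun_prop)
    have E'S : E' ⊆ S := fun z hz => (h.Ssm hr z).1 (hES hz)
    have hV' : wVol w E' = wVol w (BS S) := by
      have h1 := h.vol_sm hr hE.measurableSet hES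
      have h2 : wVol w E = ENNReal.ofReal (r ^ (((m+1:ℕ):ℝ) + α)) * wVol w (BS S) := by
        rw [hVr, hrD, hEv, ← ENNReal.ofReal_mul (by positivity), div_mul_cancel₀ _ hV0.ne']
      rw [h2] at h1
      exact ((ENNReal.mul_right_inj (by simpa using Real.rpow_pos_of_pos hr _) ENNReal.ofReal_ne_top).1 h1).symm
    have hP' : wPer S w E' = wPer S w (BS S) := by
      rw [h.ratio_sm hr hE.measurableSet hES] at heq
      change wPer S w E' / wVol w E' ^ _ = wPer S w (BS S) / wVol w (BS S) ^ _ at heq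
      rw [hV', hVr, ENNReal.ofReal_rpow_of_pos hV0] at heq
      rw [div_eq_mul_inv, div_eq_mul_inv] at heq
      refine (ENNReal.mul_left_inj ?_ ?_).1 heq
      · exact ENNReal.inv_ne_zero.2 ENNReal.ofReal_ne_top
      · refine ENNReal.inv_ne_top.2 ?_
        simpa using Real.rpow_pos_of_pos hV0 _
    have hPB : ∫⁻ z in frontier (BS S) ∩ S, ENNReal.ofReal (w z) ∂μH[(m:ℝ)] ≤
        ∫⁻ z in sphere 0 1 ∩ S, ENNReal.ofReal (w z) ∂μH[(m:ℝ)] := lintegral_mono_set h.frsub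
    have hPE : ∫⁻ z in frontier E' ∩ S, ENNReal.ofReal (w z) ∂μH[(m:ℝ)] ≤
        ∫⁻ z in sphere 0 1 ∩ S, ENNReal.ofReal (w z) ∂μH[(m:ℝ)] := by
      rw [Ctx.wPer_eq, Ctx.wPer_eq] at hP'
      rw [hP']; exact hPB
    have hVm : wm S w E' = wm S w (BS S) := by
      rw [h.wm_eq_wVol E'o.measurableSet E'S, hV', hB]
    obtain ⟨f, q, g⟩ := h.exGS E'o E'S hVm (hPE.trans h.perB)
    obtain ⟨f', q', g'⟩ := h.exGS h.BSo h.BSs rfl (hPB.trans h.perB)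
    obtain ⟨p, hp, hae⟩ := h.trans g g'
    have hp' := h.m7 E'o E'S hp hae hPE
    have hrp := h.conecl hp hr
    have hrp' := h.conecl hp' hr
    rw [smul_neg] at hrp'
    refine ⟨r, hr, r • p, cl_lin h hNoLine hrp hrp', ?_⟩
    have e1 : symmDiff E (ball (r • p) r ∩ S) = (fun z => r⁻¹ • z) ⁻¹' (symmDiff E' {z | z - p ∈ BS S}) := by
      have a1 : (fun z : Euc (m+1) => r⁻¹ • z) ⁻¹' E' = E := by
        ext z
        simp only [hE', mem_preimage]
        rw [smul_smul, mul_inv_cancel₀ hr.ne', one_smul]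
      have a2 : (fun z : Euc (m+1) => r⁻¹ • z) ⁻¹' {z | z - p ∈ BS S} = ball (r • p) r ∩ S := by
        ext z
        have b1 : r⁻¹ • z - p = r⁻¹ • (z - r • p) := by
          rw [smul_sub, smul_smul, inv_mul_cancel₀ hr.ne', one_smul]
        have b2 : r⁻¹ • (z - r • p) ∈ S ↔ z ∈ S := by
          rw [h.Ssm (inv_pos.2 hr), ← h.Str hrp hrp' (z - r • p), sub_add_cancel]
        simp only [mem_preimage, mem_setOf_eq, b1, BS, mem_inter_iff, b2, mem_ball, dist_eq_norm, sub_zero]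
        rw [norm_smul, norm_inv, Real.norm_of_nonneg hr.le, inv_mul_lt_iff₀ hr, mul_one]
      rw [← a2]
      conv_lhs => rw [← a1]
      rfl
    have hnull : volume (symmDiff E (ball (r • p) r ∩ S)) = 0 := by
      rw [e1, Measure.addHaar_preimage_smul _ (inv_pos.2 hr).ne', measure_symmDiff_eq_zero_iff.2 hae, mul_zero]
    rw [wVol, Measure.restrict_eq_zero.2 hnull, lintegral_zero_measure]

end

/-- Characterization of the optimal sets in the weighted isoperimetric inequality. -/
theorem stmt_1 {n k : ℕ} (hn : 1 ≤ n) (hk : k < n) (α : ℝ) (hα : 0 < α)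
    (S : Set (Euc n)) (hS : IsOpenConvexCone S)
    -- `S = ℝ^k × Σ̃` : `S` is invariant under translations in the first `k` coordinates ...
    (hSL : ∀ x ∈ S, ∀ v ∈ linSpan n k, x + v ∈ S)
    -- ... and `Σ̃` contains no lines: every line contained in `S` points in a direction of `ℝ^k`.
    (hNoLine : ∀ p v : Euc n, (∀ t : ℝ, p + t • v ∈ S) → v ∈ linSpan n k)
    (w : Euc n → ℝ) (hw : IsAdmissibleWeight S α w) :
    -- (i) balls centered at points of `ℝ^k × {0}` achieve equality
    (∀ r : ℝ, 0 < r → ∀ x₀ ∈ linSpan n k,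
      wPer S w (ball x₀ r ∩ S) /
          (wVol w (ball x₀ r ∩ S)) ^ (((n : ℝ) + α - 1) / ((n : ℝ) + α)) =
        wPer S w (ball (0 : Euc n) 1 ∩ S) /
          (wVol w (ball (0 : Euc n) 1 ∩ S)) ^ (((n : ℝ) + α - 1) / ((n : ℝ) + α)))
    ∧
    -- (ii) conversely, any optimal set is such a ball, up to a `w`-null set
    (∀ E : Set (Euc n), E ⊆ S → IsOpen E →
      0 < wVol w E → wVol w E < ⊤ → wPer S w E < ⊤ →
      wPer S w E / (wVol w E) ^ (((n : ℝ) + α - 1) / ((n : ℝ) + α)) =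
        wPer S w (ball (0 : Euc n) 1 ∩ S) /
          (wVol w (ball (0 : Euc n) 1 ∩ S)) ^ (((n : ℝ) + α - 1) / ((n : ℝ) + α)) →
      ∃ r : ℝ, 0 < r ∧ ∃ x₀ ∈ linSpan n k,
        wVol w (symmDiff E (ball x₀ r ∩ S)) = 0) := by
  obtain ⟨m, rfl⟩ : ∃ m, n = m + 1 := ⟨n - 1, by omega⟩
  exact main_aux hk α hα S hS hSL hNoLine w hw
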